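/- arXiv:1504.03755 — 2 statements merged into one kernel-verified Lean document; each statement's English description precedes it below -/
import Mathlib

section
/- Let K be an algebraically closed field and let S ⊆ K^m × K^n be a constructible set with respect to the Zariski topology on K^{m+n}. Then the set { a ∈ K^m : the Zariski closure of S_a in K^n is irreducible } is a constructible subset of K^m, where a subset of K^n is irreducible if it is nonempty and is not the union of two proper relatively closed subsets. (This is part of Theorem A.6(2) of the paper's appendix: irreducibility of the Zariski closure is a definable property in families.) -/
/-- The Zariski topology on affine space `σ → K`: the closed sets are the common
zero loci of sets of polynomials over `K`. -/
def zariskiTopology (K : Type*) [CommRing K] (σ : Type*) :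
    TopologicalSpace (σ → K) :=
  TopologicalSpace.generateFrom
    {U | ∃ f : MvPolynomial σ K, U = {x | MvPolynomial.eval x f ≠ 0}}

/-- A set is constructible w.r.t. a topology `t` if it is a finite union of
differences of `t`-closed sets (equivalently, a finite Boolean combination of
closed sets). -/
def IsConstructibleIn {α : Type*} (t : TopologicalSpace α) (S : Set α) : Prop :=
  ∃ (r : ℕ) (C D : Fin r → Set α),
    (∀ i, @IsClosed _ t (C i)) ∧ (∀ i, @IsClosed _ t (D i)) ∧
    S = ⋃ i, C i \ D i

section ZariskiTopology

open MvPolynomial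

variable {K : Type*} [Field K] {σ : Type*}

/-- The common zero locus in `σ → K` of a set of polynomials. -/
def zeroSet (F : Set (MvPolynomial σ K)) : Set (σ → K) :=
  {x | ∀ p ∈ F, eval x p = 0}

theorem zeroSet_span (F : Set (MvPolynomial σ K)) :
    zeroSet (Ideal.span F : Set (MvPolynomial σ K)) = zeroSet F := by
  apply Set.Subset.antisymm
  · exact fun x hx p hp => hx p (Ideal.subset_span hp)
  · intro x hx p hp
    have : Ideal.span F ≤ RingHom.ker (eval x) := Ideal.span_le.2 hx
    exact this hp

theorem isClosed_zeroSet (F : Set (MvPolynomial σ K)) :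
    @IsClosed _ (zariskiTopology K σ) (zeroSet F) := by
  let := zariskiTopology K σ
  have : zeroSet F = ⋂ p ∈ F, {x | eval x p ≠ 0}ᶜ := by
    ext x; simp [zeroSet]
  rw [this]
  refine isClosed_biInter fun p _ => IsOpen.isClosed_compl ?_
  exact TopologicalSpace.isOpen_generateFrom_of_mem ⟨p, rfl⟩

theorem isOpen_setOf_eval_ne_zero (p : MvPolynomial σ K) :
    @IsOpen _ (zariskiTopology K σ) {x | eval x p ≠ 0} :=
  TopologicalSpace.isOpen_generateFrom_of_mem ⟨p, rfl⟩

theorem exists_eval_ne_zero_of_isOpen {U : Set (σ → K)}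
    (hU : @IsOpen _ (zariskiTopology K σ) U) {x : σ → K} (hx : x ∈ U) :
    ∃ p : MvPolynomial σ K, eval x p ≠ 0 ∧ ∀ y, eval y p ≠ 0 → y ∈ U := by
  have hU' : TopologicalSpace.GenerateOpen
    {U : Set (σ → K) | ∃ f : MvPolynomial σ K, U = {x | MvPolynomial.eval x f ≠ 0}} U := hU
  clear hU
  induction hU' with
  | basic s hs =>
    obtain ⟨f, rfl⟩ := hs
    exact ⟨f, hx, fun y hy => hy⟩
  | univ => exact ⟨1, by simp, fun y _ => trivial⟩
  | inter s t _ _ ihs iht =>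
    obtain ⟨p, hp, hps⟩ := ihs hx.1
    obtain ⟨q, hq, hqt⟩ := iht hx.2
    refine ⟨p * q, by simp [hp, hq], fun y hy => ?_⟩
    rw [map_mul] at hy
    exact ⟨hps y (left_ne_zero_of_mul hy), hqt y (right_ne_zero_of_mul hy)⟩
  | sUnion S _ ih =>
    obtain ⟨s, hs, hxs⟩ := hx
    obtain ⟨p, hp, hps⟩ := ih s hs hxs
    exact ⟨p, hp, fun y hy => ⟨s, hs, hps y hy⟩⟩

theorem exists_finset_zeroSet_of_isClosed [Finite σ] {C : Set (σ → K)}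
    (hC : @IsClosed _ (zariskiTopology K σ) C) :
    ∃ F : Finset (MvPolynomial σ K), C = zeroSet F := by
  let := zariskiTopology K σ
  have h1 : C = zeroSet {p | ∀ x ∈ C, eval x p = 0} := by
    apply Set.Subset.antisymm
    · exact fun x hx p hp => hp x hx
    · intro x hx
      by_contra hxC
      obtain ⟨p, hp, hpC⟩ := exists_eval_ne_zero_of_isOpen hC.isOpen_compl hxC
      exact hp (hx p fun y hy => by_contra fun h => hpC y h hy)
  obtain ⟨F, hF⟩ := IsNoetherian.noetherian (Ideal.span {p | ∀ x ∈ C, eval x p = 0})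
  refine ⟨F, ?_⟩
  rw [h1, ← zeroSet_span, ← hF]
  exact zeroSet_span _

/-- A set of points is irreducible when it is nonempty and a product of two polynomials vanishes
on it only if one of the factors does. -/
def PolyIrreducible (T : Set (σ → K)) : Prop :=
  T.Nonempty ∧ ∀ p q : MvPolynomial σ K, (∀ x ∈ T, eval x p * eval x q = 0) →
    (∀ x ∈ T, eval x p = 0) ∨ ∀ x ∈ T, eval x q = 0

theorem isIrreducible_zariski_iff (T : Set (σ → K)) :
    @IsIrreducible _ (zariskiTopology K σ) T ↔ PolyIrreducible T := by
  let := zariskiTopology K σ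
  refine and_congr_right fun _ => ⟨fun h p q hpq => ?_, fun h u v hu hv => ?_⟩
  · by_contra! hne
    obtain ⟨⟨x, hx, hxp⟩, y, hy, hyq⟩ := hne
    obtain ⟨z, hz, hzp, hzq⟩ := h _ _ (isOpen_setOf_eval_ne_zero p)
      (isOpen_setOf_eval_ne_zero q) ⟨x, hx, hxp⟩ ⟨y, hy, hyq⟩
    exact mul_ne_zero hzp hzq (hpq z hz)
  · rintro ⟨x, hx, hxu⟩ ⟨y, hy, hyv⟩
    obtain ⟨p, hp, hpu⟩ := exists_eval_ne_zero_of_isOpen hu hxu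
    obtain ⟨q, hq, hqv⟩ := exists_eval_ne_zero_of_isOpen hv hyv
    by_contra hne
    rcases h p q fun z hz => by_contra fun hz0 => hne ⟨z, hz, hpu z (left_ne_zero_of_mul hz0),
      hqv z (right_ne_zero_of_mul hz0)⟩ with h0 | h0
    · exact hp (h0 x hx)
    · exact hq (h0 y hy)

theorem IsConstructibleIn.union {α : Type*} {t : TopologicalSpace α} {S S' : Set α}
    (h : IsConstructibleIn t S) (h' : IsConstructibleIn t S') : IsConstructibleIn t (S ∪ S') := by
  obtain ⟨r, C, D, hC, hD, rfl⟩ := h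
  obtain ⟨r', C', D', hC', hD', rfl⟩ := h'
  refine ⟨r + r', Fin.append C C', Fin.append D D', fun i => ?_, fun i => ?_, ?_⟩
  · refine Fin.addCases (fun i => ?_) (fun i => ?_) i <;> simp [hC, hC']
  · refine Fin.addCases (fun i => ?_) (fun i => ?_) i <;> simp [hD, hD']
  · ext x
    simp only [Set.mem_union, Set.mem_iUnion]
    constructor
    · rintro (⟨i, hi⟩ | ⟨i, hi⟩)
      · exact ⟨Fin.castAdd r' i, by simpa using hi⟩
      · exact ⟨Fin.natAdd r i, by simpa using hi⟩
    · rintro ⟨i, hi⟩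
      induction i using Fin.addCases with
      | left i => exact Or.inl ⟨i, by simpa using hi⟩
      | right i => exact Or.inr ⟨i, by simpa using hi⟩

theorem isConstructibleIn_diff {α : Type*} {t : TopologicalSpace α} {C D : Set α}
    (hC : @IsClosed _ t C) (hD : @IsClosed _ t D) : IsConstructibleIn t (C \ D) :=
  ⟨1, fun _ => C, fun _ => D, fun _ => hC, fun _ => hD, by simp [Set.iUnion_const]⟩

theorem isConstructibleIn_empty {α : Type*} {t : TopologicalSpace α} :
    IsConstructibleIn t (∅ : Set α) :=
  ⟨0, fun _ => ∅, fun _ => ∅, fun i => i.elim0, fun i => i.elim0, by simp⟩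

/-- Noetherian induction: a set is constructible as soon as it generically contains or generically
avoids each irreducible closed set. -/
theorem isConstructibleIn_of_forall_isPrime [Finite σ] (E : Set (σ → K))
    (h : ∀ P : Ideal (MvPolynomial σ K), P.IsPrime → ∃ s ∉ P,
      (∀ a ∈ zeroSet (P : Set (MvPolynomial σ K)), eval a s ≠ 0 → a ∈ E) ∨
      (∀ a ∈ zeroSet (P : Set (MvPolynomial σ K)), eval a s ≠ 0 → a ∉ E)) :
    IsConstructibleIn (zariskiTopology K σ) E := by
  have key : ∀ I : Ideal (MvPolynomial σ K), IsConstructibleIn (zariskiTopology K σ)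
      (E ∩ zeroSet (I : Set (MvPolynomial σ K))) := by
    intro I
    induction I using (wellFounded_gt (α := Ideal (MvPolynomial σ K))).induction with
    | _ I ih =>
    have hlt : ∀ s ∉ I, I < I ⊔ Ideal.span {s} := fun s hs =>
      lt_of_le_of_ne le_sup_left fun heq => hs <| by
        rw [heq]
        exact Ideal.mem_sup_right (Ideal.subset_span rfl)
    have hz : ∀ s, zeroSet ((I ⊔ Ideal.span {s} : Ideal _) : Set (MvPolynomial σ K)) =
        zeroSet (I : Set (MvPolynomial σ K)) ∩ {x | eval x s = 0} := by
      intro s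
      apply Set.Subset.antisymm
      · exact fun x hx => ⟨fun p hp => hx p (Ideal.mem_sup_left hp),
          hx s (Ideal.mem_sup_right (Ideal.subset_span rfl))⟩
      · rintro x ⟨hx, hxs⟩
        have : I ⊔ Ideal.span {s} ≤ RingHom.ker (eval x) :=
          sup_le hx (by simpa [Ideal.span_le] using hxs)
        exact fun p hp => this hp
    by_cases hI : I.IsPrime
    · obtain ⟨s, hs, hE | hE⟩ := h I hI
      · have := (isConstructibleIn_diff (isClosed_zeroSet (I : Set (MvPolynomial σ K)))
          (isClosed_zeroSet {s})).union (ih _ (hlt s hs))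
        convert this using 1
        rw [hz]
        ext x
        have hx := hE x
        simp only [zeroSet, Set.mem_singleton_iff, forall_eq, Set.mem_union, Set.mem_inter_iff,
          Set.mem_sdiff, Set.mem_ofPred_eq] at hx ⊢
        tauto
      · convert ih _ (hlt s hs) using 1
        rw [hz]
        ext x
        have hx := hE x
        simp only [Set.mem_inter_iff, Set.mem_ofPred_eq] at hx ⊢
        tauto
    · rw [Ideal.not_isPrime_iff] at hI
      rcases hI with rfl | ⟨x, hx, y, hy, hxy⟩
      · convert isConstructibleIn_empty using 1
        ext x
        simp only [Set.mem_inter_iff, Set.mem_empty_iff_false, iff_false, not_and]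
        intro _ hx
        simpa using hx 1 trivial
      · convert (ih _ (hlt x hx)).union (ih _ (hlt y hy)) using 1
        rw [hz, hz]
        ext z
        simp only [Set.mem_inter_iff, Set.mem_union, Set.mem_ofPred_eq]
        have : z ∈ zeroSet (I : Set (MvPolynomial σ K)) → eval z x = 0 ∨ eval z y = 0 :=
          fun hz => by simpa using hz _ hxy
        tauto
  convert key ⊥ using 1
  ext x
  simp [zeroSet]

end ZariskiTopology

section Places

open MvPolynomial Filter

/-- A partially defined `K`-algebra homomorphism from `L` to `K`. -/
structure PartialPlace (K L : Type*) [Field K] [Field L] [Algebra K L] where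
  /-- The domain of definition. -/
  ring : Subalgebra K L
  /-- The homomorphism. -/
  hom : ring →ₐ[K] K

variable {K L : Type*} [Field K] [Field L] [Algebra K L]

variable (K L) in
/-- The filter of properties of partial places that hold as soon as the place is defined at
finitely many given elements. -/
def genericFilter : Filter (PartialPlace K L) where
  sets := {s | ∃ T : Finset L, ∀ ψ : PartialPlace K L, (∀ x ∈ T, x ∈ ψ.ring) → ψ ∈ s}
  univ_sets := ⟨∅, fun _ _ => trivial⟩
  sets_of_superset := fun ⟨T, hT⟩ hst => ⟨T, fun ψ h => hst (hT ψ h)⟩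
  inter_sets := fun ⟨T, hT⟩ ⟨T', hT'⟩ => by
    classical
    exact ⟨T ∪ T', fun ψ h => ⟨hT ψ fun x hx => h x (Finset.mem_union_left _ hx),
      hT' ψ fun x hx => h x (Finset.mem_union_right _ hx)⟩⟩

theorem eventually_genericFilter {p : PartialPlace K L → Prop} :
    (∀ᶠ ψ in genericFilter K L, p ψ) ↔
      ∃ T : Finset L, ∀ ψ : PartialPlace K L, (∀ x ∈ T, x ∈ ψ.ring) → p ψ :=
  Iff.rfl

theorem eventually_mem_ring (x : L) : ∀ᶠ ψ in genericFilter K L, x ∈ ψ.ring :=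
  eventually_genericFilter.2 ⟨{x}, fun _ h => h x (Finset.mem_singleton_self x)⟩

namespace PartialPlace

variable (ψ : PartialPlace K L)

open Classical in
/-- The value of a partial place, with junk value `0` outside the domain of definition. -/
noncomputable def red (x : L) : K :=
  if h : x ∈ ψ.ring then ψ.hom ⟨x, h⟩ else 0

@[simp]
theorem red_coe (x : ψ.ring) : ψ.red x = ψ.hom x := by
  simp [red]

@[simp]
theorem red_zero : ψ.red 0 = 0 := by
  simpa using ψ.red_coe 0

variable {σ τ : Type*}

/-- Reduction of polynomials along a partial place. -/
noncomputable def redPoly (p : MvPolynomial σ L) : MvPolynomial σ K :=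
  ∑ s ∈ p.support, monomial s (ψ.red (coeff s p))

/-- Inclusion of the polynomials over the domain of a place. -/
noncomputable def incl : MvPolynomial σ ψ.ring →+* MvPolynomial σ L :=
  map (algebraMap ψ.ring L)

/-- Reduction of polynomials over the domain of a place. -/
noncomputable def reduce : MvPolynomial σ ψ.ring →+* MvPolynomial σ K :=
  map (ψ.hom : ψ.ring →+* K)

theorem incl_injective : Function.Injective (ψ.incl (σ := σ)) :=
  map_injective _ (FaithfulSMul.algebraMap_injective _ _)

theorem coeff_redPoly (p : MvPolynomial σ L) (s : σ →₀ ℕ) :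
    coeff s (ψ.redPoly p) = ψ.red (coeff s p) := by
  classical
  simp only [redPoly, coeff_sum, coeff_monomial, Finset.sum_ite_eq', mem_support_iff]
  split_ifs with h
  · rfl
  · rw [not_not.1 h, red_zero]

@[simp]
theorem redPoly_incl (p : MvPolynomial σ ψ.ring) : ψ.redPoly (ψ.incl p) = ψ.reduce p := by
  ext s
  rw [coeff_redPoly, incl, reduce, coeff_map, coeff_map]
  exact ψ.red_coe _

@[simp]
theorem redPoly_zero : ψ.redPoly (0 : MvPolynomial σ L) = 0 := by
  simp [redPoly]

theorem exists_incl_eq {p : MvPolynomial σ L} (h : ∀ s ∈ p.support, coeff s p ∈ ψ.ring) :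
    ∃ q : MvPolynomial σ ψ.ring, ψ.incl q = p := by
  have : p ∈ Set.range (ψ.incl (σ := σ)) := by
    rw [incl]
    refine (mem_range_map_iff_coeffs_subset (f := algebraMap ψ.ring L)).2 fun c hc => ?_
    obtain ⟨s, hs, rfl⟩ := mem_coeffs_iff.1 hc
    exact ⟨⟨_, h s hs⟩, rfl⟩
  exact this

theorem eval_reduce_hom (z : σ → ψ.ring) (p : MvPolynomial σ ψ.ring) :
    eval (fun i => ψ.hom (z i)) (ψ.reduce p) = ψ.red (eval (fun i => (z i : L)) (ψ.incl p)) := by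
  have h1 : eval (fun i => ψ.hom (z i)) (ψ.reduce p) = ψ.hom (eval z p) := by
    rw [reduce, eval_map]
    exact (eval₂_comp (ψ.hom : ψ.ring →+* K) z p).symm
  have h2 : eval (fun i => (z i : L)) (ψ.incl p) = ((eval z p : ψ.ring) : L) := by
    rw [incl, eval_map]
    exact (eval₂_comp (algebraMap ψ.ring L) z p).symm
  rw [h1, h2, red_coe]

end PartialPlace

variable {σ τ : Type*}

theorem eventually_exists_incl_eq (p : MvPolynomial σ L) :
    ∀ᶠ ψ in genericFilter K L, ∃ q : MvPolynomial σ ψ.ring, ψ.incl q = p := by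
  filter_upwards [(eventually_all_finset (l := genericFilter K L) p.support).2
    fun s _ => eventually_mem_ring (coeff s p)] with ψ h
  exact ψ.exists_incl_eq h

theorem eventually_redPoly_add (p q : MvPolynomial σ L) :
    ∀ᶠ ψ in genericFilter K L, ψ.redPoly (p + q) = ψ.redPoly p + ψ.redPoly q := by
  filter_upwards [eventually_exists_incl_eq p, eventually_exists_incl_eq q]
  rintro ψ ⟨p, rfl⟩ ⟨q, rfl⟩
  simp [← map_add]

theorem eventually_redPoly_mul (p q : MvPolynomial σ L) :
    ∀ᶠ ψ in genericFilter K L, ψ.redPoly (p * q) = ψ.redPoly p * ψ.redPoly q := by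
  filter_upwards [eventually_exists_incl_eq p, eventually_exists_incl_eq q]
  rintro ψ ⟨p, rfl⟩ ⟨q, rfl⟩
  simp [← map_mul]

theorem eventually_redPoly_sub (p q : MvPolynomial σ L) :
    ∀ᶠ ψ in genericFilter K L, ψ.redPoly (p - q) = ψ.redPoly p - ψ.redPoly q := by
  filter_upwards [eventually_exists_incl_eq p, eventually_exists_incl_eq q]
  rintro ψ ⟨p, rfl⟩ ⟨q, rfl⟩
  simp [← map_sub]

theorem PartialPlace.redPoly_one (ψ : PartialPlace K L) :
    ψ.redPoly (1 : MvPolynomial σ L) = 1 := by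
  simpa using ψ.redPoly_incl (σ := σ) 1

theorem PartialPlace.redPoly_X (ψ : PartialPlace K L) (i : σ) :
    ψ.redPoly (X i : MvPolynomial σ L) = X i := by
  simpa [PartialPlace.incl, PartialPlace.reduce] using ψ.redPoly_incl (σ := σ) (X i)

theorem eventually_redPoly_pow (p : MvPolynomial σ L) (n : ℕ) :
    ∀ᶠ ψ in genericFilter K L, ψ.redPoly (p ^ n) = ψ.redPoly p ^ n := by
  filter_upwards [eventually_exists_incl_eq p]
  rintro ψ ⟨p, rfl⟩
  simp [← map_pow]

theorem eventually_redPoly_bind₁ [Finite σ] (f : σ → MvPolynomial τ L) (p : MvPolynomial σ L) :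
    ∀ᶠ ψ in genericFilter K L,
      ψ.redPoly (bind₁ f p) = bind₁ (fun i => ψ.redPoly (f i)) (ψ.redPoly p) := by
  filter_upwards [eventually_exists_incl_eq p,
    eventually_all.2 fun i => eventually_exists_incl_eq (f i)]
  rintro ψ ⟨p, rfl⟩ hf
  choose g hg using hf
  obtain rfl : (fun i => ψ.incl (g i)) = f := funext hg
  have h1 : bind₁ (fun i => ψ.incl (g i)) (ψ.incl p) = ψ.incl (bind₁ g p) := (map_bind₁ _ _ _).symm
  rw [h1]
  simp only [PartialPlace.redPoly_incl]
  exact map_bind₁ _ _ _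

theorem eventually_red_ne_zero {x : L} (hx : x ≠ 0) :
    ∀ᶠ ψ in genericFilter K L, ψ.red x ≠ 0 := by
  filter_upwards [eventually_mem_ring x, eventually_mem_ring x⁻¹] with ψ h h' h0
  have : (⟨x, h⟩ : ψ.ring) * ⟨x⁻¹, h'⟩ = 1 := Subtype.ext (mul_inv_cancel₀ hx)
  have h1 : ψ.hom ⟨x, h⟩ = 0 := by rw [← ψ.red_coe]; exact h0
  have h2 := congrArg ψ.hom this
  rw [map_mul, h1, zero_mul, map_one] at h2
  exact zero_ne_one h2

theorem eventually_eval_redPoly [Finite σ] (p : MvPolynomial σ L) (z : σ → L) :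
    ∀ᶠ ψ in genericFilter K L,
      eval (fun i => ψ.red (z i)) (ψ.redPoly p) = ψ.red (eval z p) := by
  filter_upwards [eventually_exists_incl_eq p, eventually_all.2 fun i => eventually_mem_ring (z i)]
  rintro ψ ⟨p, rfl⟩ hz
  have := ψ.eval_reduce_hom (fun i => ⟨z i, hz i⟩) p
  simpa [← PartialPlace.red_coe] using this

theorem eventually_redPoly_mem_span {F : Set (MvPolynomial σ L)} {p : MvPolynomial σ L}
    (hp : p ∈ Ideal.span F) :
    ∀ᶠ ψ in genericFilter K L, ψ.redPoly p ∈ Ideal.span (ψ.redPoly '' F) := by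
  induction hp using Submodule.span_induction with
  | mem x h => exact Eventually.of_forall fun ψ => Ideal.subset_span ⟨x, h, rfl⟩
  | zero => exact Eventually.of_forall fun ψ => by simp
  | add x y _ _ hx hy =>
    filter_upwards [hx, hy, eventually_redPoly_add x y] with ψ hx hy h
    rw [h]
    exact add_mem hx hy
  | smul a x _ hx =>
    filter_upwards [hx, eventually_redPoly_mul a x] with ψ hx h
    rw [smul_eq_mul, h]
    exact Ideal.mul_mem_left _ _ hx

/-- An inclusion between zero loci over `L` specializes to generic places. -/
theorem eventually_eval_redPoly_eq_zero [IsAlgClosed L] [Finite σ] {F : Set (MvPolynomial σ L)}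
    {p : MvPolynomial σ L} (h : ∀ x ∈ zeroSet F, eval x p = 0) :
    ∀ᶠ ψ in genericFilter K L, ∀ x ∈ zeroSet (ψ.redPoly '' F), eval x (ψ.redPoly p) = 0 := by
  have hp : p ∈ (Ideal.span F).radical := by
    rw [← vanishingIdeal_zeroLocus_eq_radical (K := L), mem_vanishingIdeal_iff, zeroLocus_span]
    intro x hx
    simpa [aeval_eq_eval] using h x fun p hp => by simpa [aeval_eq_eval] using hx p hp
  obtain ⟨n, hn⟩ := hp
  filter_upwards [eventually_redPoly_mem_span hn, eventually_redPoly_pow p n] with ψ h1 h2 x hx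
  rw [h2] at h1
  rw [← zeroSet_span] at hx
  have := hx _ h1
  rw [map_pow] at this
  exact eq_zero_of_pow_eq_zero this

end Places

section Extension

open MvPolynomial Filter

variable {K : Type*} [Field K] [IsAlgClosed K]

/-- A `K`-point of a `K`-algebra extends to every integral extension. -/
theorem exists_algHom_extension_of_isIntegral {A B : Type*} [CommRing A] [CommRing B]
    [Algebra K A] [Algebra K B] [Algebra A B] [IsScalarTower K A B] [Algebra.IsIntegral A B]
    (hinj : Function.Injective (algebraMap A B)) (α : A →ₐ[K] K) :
    ∃ β : B →ₐ[K] K, ∀ x, β (algebraMap A B x) = α x := by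
  have hsurj : Function.Surjective α := fun c => ⟨algebraMap K A c, by simp⟩
  have : (RingHom.ker α).IsMaximal := RingHom.ker_isMaximal_of_surjective _ hsurj
  obtain ⟨Q, hQ, hQc⟩ := Ideal.exists_ideal_over_maximal_of_isIntegral (S := B) (RingHom.ker α)
    (by rw [(RingHom.injective_iff_ker_eq_bot _).1 hinj]; exact bot_le)
  let : Field (B ⧸ Q) := Ideal.Quotient.field Q
  have hα : ∀ x, algebraMap A (B ⧸ Q) x = algebraMap K (B ⧸ Q) (α x) := by
    intro x
    have h1 : x - algebraMap K A (α x) ∈ Q.comap (algebraMap A B) := by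
      rw [hQc, RingHom.mem_ker]
      simp
    have h2 := Ideal.Quotient.eq_zero_iff_mem.2 (Ideal.mem_comap.1 h1)
    rw [map_sub, map_sub, sub_eq_zero, ← IsScalarTower.algebraMap_apply K A B] at h2
    exact h2
  have : Algebra.IsIntegral K (B ⧸ Q) := by
    refine ⟨fun y => ?_⟩
    obtain ⟨p, hp, hpy⟩ := (Algebra.IsIntegral.isIntegral (R := A) y)
    refine ⟨p.map (α : A →+* K), hp.map _, ?_⟩
    rw [Polynomial.eval₂_map]
    have : (algebraMap K (B ⧸ Q)).comp (α : A →+* K) = algebraMap A (B ⧸ Q) :=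
      RingHom.ext fun x => (hα x).symm
    rw [this]
    exact hpy
  let e : K ≃ₐ[K] (B ⧸ Q) := AlgEquiv.ofBijective (Algebra.ofId K (B ⧸ Q))
    IsAlgClosed.algebraMap_bijective_of_isIntegral
  refine ⟨(e.symm : (B ⧸ Q) →ₐ[K] K).comp (Ideal.Quotient.mkₐ K Q), fun x => ?_⟩
  change e.symm (algebraMap A (B ⧸ Q) x) = α x
  rw [hα, AlgEquiv.symm_apply_eq]
  rfl

/-- A generic property of partial places on `L` is satisfied by an extension of any sufficiently
general `K`-point of a domain over which `L` is algebraic. -/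
theorem exists_partialPlace_of_eventually {A L : Type*} [CommRing A] [IsDomain A] [Algebra K A]
    [Field L] [Algebra K L] [Algebra A L] [IsScalarTower K A L] [FaithfulSMul A L]
    [Algebra.IsAlgebraic A L] {p : PartialPlace K L → Prop}
    (hp : ∀ᶠ ψ in genericFilter K L, p ψ) :
    ∃ s : A, s ≠ 0 ∧ ∀ α : A →ₐ[K] K, α s ≠ 0 →
      ∃ ψ, p ψ ∧ ∀ x : A, ∃ h : algebraMap A L x ∈ ψ.ring, ψ.hom ⟨_, h⟩ = α x := by
  obtain ⟨T, hT⟩ := eventually_genericFilter.1 hp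
  obtain ⟨s, hs, hsT⟩ := Algebra.IsAlgebraic.exists_integral_multiples A T
  refine ⟨s, hs, fun α hα => ?_⟩
  have hsL : IsUnit (algebraMap A L s) :=
    ((map_ne_zero_iff _ (FaithfulSMul.algebraMap_injective A L)).2 hs).isUnit
  let As := Localization.Away s
  let : Algebra As L := (IsLocalization.Away.lift (S := As) s hsL).toAlgebra
  have hcomp : ∀ x, algebraMap As L (algebraMap A As x) = algebraMap A L x :=
    fun x => IsLocalization.Away.lift_eq s hsL x
  have : IsScalarTower A As L := IsScalarTower.of_algebraMap_eq fun x => (hcomp x).symm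
  have : IsScalarTower K As L := IsScalarTower.of_algebraMap_eq fun x => by
    rw [IsScalarTower.algebraMap_apply K A As, hcomp, ← IsScalarTower.algebraMap_apply]
  have hinj : Function.Injective (algebraMap As L) := by
    refine (IsLocalization.lift_injective_iff (M := Submonoid.powers s) (S := As) _).2 fun x y => ?_
    rw [(IsLocalization.injective As (powers_le_nonZeroDivisors_of_noZeroDivisors hs)).eq_iff,
      (FaithfulSMul.algebraMap_injective A L).eq_iff]
  have hαu : IsUnit ((α : A →+* K) s) := Ne.isUnit (by simpa using hα)
  have hαs : ∀ x, IsLocalization.Away.lift (S := As) s hαu (algebraMap A As x) = α x :=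
    fun x => IsLocalization.Away.lift_eq s hαu x
  let αs : As →ₐ[K] K :=
    { IsLocalization.Away.lift (S := As) s hαu with
      commutes' := fun c =>
        (congrArg _ (IsScalarTower.algebraMap_apply K A As c)).trans
          ((hαs _).trans (α.commutes c)) }
  let O := integralClosure As L
  obtain ⟨β, hβ⟩ := exists_algHom_extension_of_isIntegral (A := As) (B := O)
    (fun x y hxy => hinj (congrArg Subtype.val hxy)) αs
  let ψ : PartialPlace K L := ⟨O.restrictScalars K, β⟩
  refine ⟨ψ, hT ψ fun x hx => ?_, fun x => ?_⟩
  · change IsIntegral As x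
    have h1 : IsIntegral As (s • x) := (hsT x hx).tower_top
    have h2 : x = algebraMap As L (IsLocalization.Away.invSelf s) * (s • x) := by
      rw [Algebra.smul_def, ← mul_assoc, ← hcomp, ← map_mul,
        mul_comm (IsLocalization.Away.invSelf s), IsLocalization.Away.mul_invSelf, map_one, one_mul]
    rw [h2]
    exact isIntegral_algebraMap.mul h1
  · refine ⟨?_, ?_⟩
    · change IsIntegral As (algebraMap A L x)
      rw [← hcomp]
      exact isIntegral_algebraMap
    · refine Eq.trans ?_ ((hβ _).trans (hαs x))
      change β _ = _
      congr 1
      exact Subtype.ext (hcomp x).symm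

end Extension

section Groebner

open MvPolynomial Filter

variable {K L : Type*} [Field K] [Field L] [Algebra K L] {σ : Type*}

/-- Every ideal has a finite Gröbner basis. -/
theorem exists_groebnerBasis [Finite σ] (m : MonomialOrder σ) (I : Ideal (MvPolynomial σ L)) :
    ∃ B : Finset (MvPolynomial σ L), (∀ b ∈ B, b ∈ I) ∧ (∀ b ∈ B, m.Monic b) ∧
      ∀ r ∈ I, (∀ c ∈ r.support, ∀ b ∈ B, ¬ m.degree b ≤ c) → r = 0 := by
  classical
  let D : Set (σ →₀ ℕ) := {d | ∃ p ∈ I, m.Monic p ∧ m.degree p = d}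
  have hfin : {d | Minimal (· ∈ D) d}.Finite :=
    WellQuasiOrderedLE.finite_of_isAntichain (setOfPred_minimal_antichain _)
  have hD : ∀ d : {d | Minimal (· ∈ D) d}, ∃ p ∈ I, m.Monic p ∧ m.degree p = d :=
    fun d => d.2.prop
  choose f hfI hfm hfd using hD
  have := hfin.fintype
  refine ⟨Finset.univ.image f, by simpa using fun b d hd h => h ▸ hfI ⟨d, hd⟩,
    by simpa using fun b d hd h => h ▸ hfm ⟨d, hd⟩, fun r hr hrs => ?_⟩
  by_contra hr0
  have hlc : m.leadingCoeff r ≠ 0 := m.leadingCoeff_ne_zero_iff.2 hr0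
  have hdeg : m.degree (C (m.leadingCoeff r)⁻¹ * r) = m.degree r := by
    rw [← smul_eq_C_mul]
    exact m.degree_smul_of_isRegular (IsRegular.of_ne_zero (inv_ne_zero hlc))
  have hrD : m.degree r ∈ D := by
    refine ⟨C (m.leadingCoeff r)⁻¹ * r, I.mul_mem_left _ hr, ?_, hdeg⟩
    rw [MonomialOrder.Monic, m.leadingCoeff_mul, m.leadingCoeff_C, inv_mul_cancel₀ hlc]
  obtain ⟨d, hdle, hd⟩ := exists_minimal_le_of_wellFoundedLT (· ∈ D) _ hrD
  refine hrs _ (m.degree_mem_support hr0) (f ⟨d, hd⟩) (by simp) ?_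
  rw [hfd]
  exact hdle

theorem PartialPlace.degree_incl (ψ : PartialPlace K L) (m : MonomialOrder σ)
    (p : MvPolynomial σ ψ.ring) : m.degree (ψ.incl p) = m.degree p := by
  rw [MonomialOrder.degree, MonomialOrder.degree, PartialPlace.incl,
    support_map_of_injective _ (FaithfulSMul.algebraMap_injective _ _)]

theorem PartialPlace.support_incl (ψ : PartialPlace K L)
    (p : MvPolynomial σ ψ.ring) : (ψ.incl p).support = p.support :=
  support_map_of_injective _ (FaithfulSMul.algebraMap_injective _ _)

theorem PartialPlace.monic_of_monic_incl (ψ : PartialPlace K L) (m : MonomialOrder σ)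
    {p : MvPolynomial σ ψ.ring} (h : m.Monic (ψ.incl p)) : m.Monic p := by
  rw [MonomialOrder.Monic, MonomialOrder.leadingCoeff, ψ.degree_incl, PartialPlace.incl,
    coeff_map] at h
  exact FaithfulSMul.algebraMap_injective ψ.ring L (h.trans (map_one _).symm)

/-- Division by a Gröbner basis with coefficients in the domain of a place. -/
theorem PartialPlace.mem_mul_span_of_groebnerBasis (ψ : PartialPlace K L) (m : MonomialOrder σ)
    {I : Ideal (MvPolynomial σ L)} {B : Set (MvPolynomial σ ψ.ring)}
    (hB : ∀ b ∈ B, ψ.incl b ∈ I) (hBm : ∀ b ∈ B, m.Monic b)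
    (hstd : ∀ r ∈ I, (∀ c ∈ r.support, ∀ b ∈ B, ¬ m.degree b ≤ c) → r = 0)
    (J : Ideal ψ.ring) {z : MvPolynomial σ ψ.ring}
    (hzJ : z ∈ J.map (C : ψ.ring →+* MvPolynomial σ ψ.ring)) (hzI : ψ.incl z ∈ I) :
    z ∈ J.map (C : ψ.ring →+* MvPolynomial σ ψ.ring) * Ideal.span B := by
  let N := restrictSupport ψ.ring {c : σ →₀ ℕ | ∀ b ∈ B, ¬ m.degree b ≤ c}
  have hdiv : ∀ c ∈ J, ∀ p : MvPolynomial σ ψ.ring, ∃ r ∈ N,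
      C c * p - r ∈ J.map (C : ψ.ring →+* MvPolynomial σ ψ.ring) * Ideal.span B := by
    intro c hc p
    obtain ⟨g, r, hg, -, hr⟩ := m.div_set (B := B)
      (fun b hb => by rw [(hBm b hb).leadingCoeff_eq_one]; exact isUnit_one) p
    refine ⟨c • r, N.smul_mem c ((mem_restrictSupport_iff _).2 hr), ?_⟩
    rw [smul_eq_C_mul, ← mul_sub]
    refine Ideal.mul_mem_mul (Ideal.mem_map_of_mem _ hc) ?_
    rw [hg, add_sub_cancel_right, Finsupp.linearCombination_apply]
    exact Submodule.sum_mem _ fun b _ => Submodule.smul_mem _ _ (Ideal.subset_span b.2)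
  have hz : ∃ r ∈ N, z - r ∈ J.map (C : ψ.ring →+* MvPolynomial σ ψ.ring) * Ideal.span B := by
    choose! f hfN hf using hdiv
    refine ⟨∑ s ∈ z.support, f (coeff s z) (monomial s 1), Submodule.sum_mem _ fun s _ =>
      hfN _ (mem_map_C_iff.1 hzJ s) _, ?_⟩
    nth_rw 1 [z.as_sum]
    rw [← Finset.sum_sub_distrib]
    refine Submodule.sum_mem _ fun s _ => ?_
    have := hf _ (mem_map_C_iff.1 hzJ s) (monomial s 1)
    rwa [C_mul_monomial, mul_one] at this
  obtain ⟨r, hrN, hr⟩ := hz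
  have hr0 : ψ.incl r = 0 := by
    refine hstd _ ?_ fun c hc => ?_
    · have h1 : J.map (C : ψ.ring →+* MvPolynomial σ ψ.ring) * Ideal.span B ≤ I.comap ψ.incl :=
        Ideal.mul_le_right.trans (Ideal.span_le.2 hB)
      have h2 : ψ.incl (z - r) ∈ I := h1 hr
      have h3 := I.sub_mem hzI h2
      rwa [map_sub, sub_sub_cancel] at h3
    · rw [ψ.support_incl] at hc
      exact (mem_restrictSupport_iff _).1 hrN hc
  rw [map_eq_zero_iff _ ψ.incl_injective] at hr0
  rwa [hr0, sub_zero] at hr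

/-- Reduction of an ideal along a partial place. -/
noncomputable def PartialPlace.redIdeal (ψ : PartialPlace K L) (I : Ideal (MvPolynomial σ L)) :
    Ideal (MvPolynomial σ K) :=
  (I.comap ψ.incl).map ψ.reduce

theorem PartialPlace.reduce_map_algebraMap (ψ : PartialPlace K L) (p : MvPolynomial σ K) :
    ψ.reduce (map (algebraMap K ψ.ring) p) = p := by
  rw [PartialPlace.reduce, MvPolynomial.map_map]
  have : (ψ.hom : ψ.ring →+* K).comp (algebraMap K ψ.ring) = RingHom.id K :=
    RingHom.ext fun c => ψ.hom.commutes c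
  rw [this, MvPolynomial.map_id]

theorem PartialPlace.reduce_surjective (ψ : PartialPlace K L) :
    Function.Surjective (ψ.reduce (σ := σ)) := fun p =>
  ⟨_, ψ.reduce_map_algebraMap p⟩

theorem nonempty_monomialOrder.{u} (σ : Type u) [Finite σ] : Nonempty (MonomialOrder.{u, u} σ) := by
  let : LinearOrder σ := LinearOrder.lift' (Finite.equivFin σ) (Finite.equivFin σ).injective
  exact ⟨MonomialOrder.lex⟩

theorem eventually_redIdeal_span [Finite σ] (G : Finset (MvPolynomial σ L)) :
    ∀ᶠ ψ in genericFilter K L, ψ.redIdeal (Ideal.span (G : Set (MvPolynomial σ L))) =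
      Ideal.span (ψ.redPoly '' (G : Set (MvPolynomial σ L))) := by
  obtain ⟨m⟩ := nonempty_monomialOrder σ
  obtain ⟨B, hB, hBm, hstd⟩ := exists_groebnerBasis m (Ideal.span (G : Set (MvPolynomial σ L)))
  filter_upwards [(eventually_all_finset B).2 fun b _ => eventually_exists_incl_eq b,
    (eventually_all_finset B).2 fun b hb => eventually_redPoly_mem_span (hB b hb),
    (eventually_all_finset G).2 fun g _ => eventually_exists_incl_eq g] with ψ h1 h2 h3
  apply le_antisymm
  · rw [PartialPlace.redIdeal, Ideal.map_le_iff_le_comap]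
    intro z hz
    have := ψ.mem_mul_span_of_groebnerBasis m (I := Ideal.span G) (B := ψ.incl ⁻¹' B)
      (fun b hb => hB _ hb) (fun b hb => ψ.monic_of_monic_incl m (hBm _ hb))
      (fun r hr hrs => hstd r hr fun c hc b hb => by
        obtain ⟨b, rfl⟩ := h1 b hb
        rw [ψ.degree_incl]
        exact hrs c hc b hb) ⊤
      (mem_map_C_iff.2 fun _ => Submodule.mem_top) hz
    refine (Ideal.mul_le_right.trans (Ideal.span_le.2 (fun b hb => ?_)) :
      _ ≤ (Ideal.span (ψ.redPoly '' (G : Set (MvPolynomial σ L)))).comap ψ.reduce) this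
    have := h2 _ hb
    rwa [ψ.redPoly_incl] at this
  · rw [Ideal.span_le]
    rintro _ ⟨g, hg, rfl⟩
    obtain ⟨g, rfl⟩ := h3 g hg
    rw [ψ.redPoly_incl]
    exact Ideal.mem_map_of_mem _ (Ideal.subset_span hg)

/-- A nonzerodivisor modulo an ideal stays a nonzerodivisor at generic places. -/
theorem eventually_mem_redIdeal_of_mul_mem [Finite σ] {Q : Ideal (MvPolynomial σ L)}
    {h : MvPolynomial σ L} (hh : ∀ p, h * p ∈ Q → p ∈ Q) :
    ∀ᶠ ψ in genericFilter K L, ∀ p, ψ.redPoly h * p ∈ ψ.redIdeal Q → p ∈ ψ.redIdeal Q := by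
  obtain ⟨m⟩ := nonempty_monomialOrder σ
  obtain ⟨B, hB, hBm, hstd⟩ := exists_groebnerBasis m (Q ⊔ Ideal.span {h})
  have hB' : ∀ b ∈ B, ∃ q ∈ Q, ∃ c, q + c * h = b := fun b hb => by
    obtain ⟨q, hq, y, hy, rfl⟩ := Submodule.mem_sup.1 (hB b hb)
    obtain ⟨c, rfl⟩ := Ideal.mem_span_singleton'.1 hy
    exact ⟨q, hq, c, rfl⟩
  choose! q hq c hqc using hB'
  filter_upwards [(eventually_all_finset B).2 fun b _ => eventually_exists_incl_eq b,
    (eventually_all_finset B).2 fun b _ => eventually_exists_incl_eq (q b),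
    (eventually_all_finset B).2 fun b _ => eventually_exists_incl_eq (c b),
    eventually_exists_incl_eq h]
  rintro ψ h1 h2 h3 ⟨h, rfl⟩ p hp
  rw [ψ.redPoly_incl, PartialPlace.redIdeal,
    Ideal.mem_map_iff_of_surjective _ ψ.reduce_surjective] at hp
  obtain ⟨i, hi, hip⟩ := hp
  have hpred := ψ.reduce_map_algebraMap p
  generalize map (algebraMap K ψ.ring) p = p' at hpred
  subst hpred
  let 𝔪 := (RingHom.ker (ψ.hom : ψ.ring →+* K)).map (C : ψ.ring →+* MvPolynomial σ ψ.ring)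
  have h𝔪 : 𝔪 = RingHom.ker (ψ.reduce (σ := σ)) := (ker_map _).symm
  have hz : h * p' - i ∈ 𝔪 := by
    rw [h𝔪, RingHom.mem_ker, map_sub, map_mul, hip, sub_self]
  have hzI : ψ.incl (h * p' - i) ∈ Q ⊔ Ideal.span {ψ.incl h} := by
    rw [map_sub, map_mul]
    exact sub_mem (Ideal.mem_sup_right (Ideal.mul_mem_right _ _ (Ideal.subset_span rfl)))
      (Ideal.mem_sup_left hi)
  have hmem := ψ.mem_mul_span_of_groebnerBasis m (B := ψ.incl ⁻¹' B)
      (fun b hb => hB _ hb) (fun b hb => ψ.monic_of_monic_incl m (hBm _ hb))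
      (fun r hr hrs => hstd r hr fun c hc b hb => by
        obtain ⟨b, rfl⟩ := h1 b hb
        rw [ψ.degree_incl]
        exact hrs c hc b hb) _ hz hzI
  have hspan : Ideal.span (ψ.incl ⁻¹' B) ≤ Q.comap ψ.incl ⊔ Ideal.span {h} := by
    rw [Ideal.span_le]
    intro b hb
    obtain ⟨q', hq'⟩ := h2 _ hb
    obtain ⟨c', hc'⟩ := h3 _ hb
    have : b = q' + c' * h := ψ.incl_injective (by
      rw [map_add, map_mul, hq', hc', hqc _ hb])
    rw [this]
    refine add_mem (Ideal.mem_sup_left ?_) (Ideal.mem_sup_right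
      (Ideal.mul_mem_left _ _ (Ideal.subset_span rfl)))
    rw [Ideal.mem_comap, hq']
    exact hq _ hb
  have hmem' := (Ideal.mul_mono_right hspan : 𝔪 * _ ≤ 𝔪 * _) hmem
  rw [Ideal.mul_sup] at hmem'
  obtain ⟨q', hq', y, hy, hqy⟩ := Submodule.mem_sup.1 hmem'
  obtain ⟨b, hb, rfl⟩ := Ideal.mem_mul_span_singleton.1 hy
  have hfin : p' - b ∈ Q.comap ψ.incl := by
    refine hh _ ?_
    rw [← map_mul]
    have : h * (p' - b) = i + q' := by linear_combination -hqy
    rw [this, map_add]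
    have hq'Q : q' ∈ Q.comap ψ.incl :=
      (Ideal.mul_le_right : 𝔪 * Q.comap ψ.incl ≤ Q.comap ψ.incl) hq'
    exact add_mem hi hq'Q
  have := Ideal.mem_map_of_mem ψ.reduce hfin
  rw [map_sub, RingHom.mem_ker.1 (h𝔪 ▸ hb : b ∈ RingHom.ker (ψ.reduce (σ := σ))),
    sub_zero] at this
  exact this

/-- A dense principal open subset stays dense at generic places. -/
theorem eventually_eval_eq_zero_of_basicOpen [IsAlgClosed K] [Finite σ]
    {Q : Ideal (MvPolynomial σ L)} [hQ : Q.IsPrime]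
    {G : Finset (MvPolynomial σ L)} (hG : Ideal.span G = Q) {h : MvPolynomial σ L} (hh : h ∉ Q) :
    ∀ᶠ ψ in genericFilter K L, ∀ p : MvPolynomial σ K,
      (∀ x ∈ zeroSet (ψ.redPoly '' G), eval x (ψ.redPoly h) ≠ 0 → eval x p = 0) →
      ∀ x ∈ zeroSet (ψ.redPoly '' G), eval x p = 0 := by
  filter_upwards [eventually_redIdeal_span (K := K) G, eventually_mem_redIdeal_of_mul_mem (K := K)
    (h := h) fun p hp => (hQ.mem_or_mem hp).resolve_left hh] with ψ h1 h2 p hp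
  rw [← hG, h1] at h2
  have h3 : ψ.redPoly h * p ∈ (Ideal.span (ψ.redPoly '' G)).radical := by
    rw [← vanishingIdeal_zeroLocus_eq_radical (K := K), mem_vanishingIdeal_iff, zeroLocus_span]
    intro x hx
    rw [aeval_eq_eval, map_mul]
    by_cases hx0 : eval x (ψ.redPoly h) = 0
    · rw [hx0, zero_mul]
    · rw [hp x (fun p hp => by simpa [aeval_eq_eval] using hx p hp) hx0, mul_zero]
  obtain ⟨N, hN⟩ := h3
  have h4 : p ^ N ∈ Ideal.span (ψ.redPoly '' G) := by
    rw [mul_pow] at hN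
    have : ∀ k, ψ.redPoly h ^ k * p ^ N ∈ Ideal.span (ψ.redPoly '' (G : Set (MvPolynomial σ L))) →
        p ^ N ∈ Ideal.span (ψ.redPoly '' (G : Set (MvPolynomial σ L))) := by
      intro k
      induction k with
      | zero => simp
      | succ k ih => exact fun hk => ih (h2 _ (by rwa [← mul_assoc, ← pow_succ']))
    exact this N hN
  intro x hx
  rw [← zeroSet_span] at hx
  have := hx _ h4
  rw [map_pow] at this
  exact eq_zero_of_pow_eq_zero this

end Groebner

section Irreducible

open MvPolynomial Filter

variable {σ : Type*}

open Classical in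
/-- The equation expressing that the coefficients of exponent `γ` agree in a factorization of `f`
into two polynomials with exponents in `Δ`. -/
noncomputable def factorizationEq {R : Type*} [CommRing R] (Δ : Finset (σ →₀ ℕ))
    (f : MvPolynomial σ R) (γ : σ →₀ ℕ) : MvPolynomial (Δ ⊕ Δ) R :=
  ∑ α : Δ, ∑ β : Δ, (if (α : σ →₀ ℕ) + β = γ then X (.inl α) * X (.inr β) else 0) - C (coeff γ f)

theorem map_factorizationEq {R S : Type*} [CommRing R] [CommRing S] (φ : R →+* S)
    (Δ : Finset (σ →₀ ℕ)) (f : MvPolynomial σ R) (γ : σ →₀ ℕ) :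
    MvPolynomial.map φ (factorizationEq Δ f γ) = factorizationEq Δ (MvPolynomial.map φ f) γ := by
  simp only [factorizationEq, map_sub, map_sum, map_C, coeff_map]
  congr! 3
  split_ifs <;> simp

theorem eval_factorizationEq {R : Type*} [CommRing R] (Δ : Finset (σ →₀ ℕ))
    (f : MvPolynomial σ R) (γ : σ →₀ ℕ) (u v : Δ → R) :
    eval (Sum.elim u v) (factorizationEq Δ f γ) =
      coeff γ ((∑ α : Δ, monomial (α : σ →₀ ℕ) (u α)) * (∑ β : Δ, monomial (β : σ →₀ ℕ) (v β)) -
        f) := by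
  simp only [factorizationEq, map_sub, map_sum, eval_C, Finset.sum_mul_sum, coeff_sub, coeff_sum,
    monomial_mul]
  congr! 3
  classical rw [coeff_monomial]
  split_ifs <;> simp

variable {K L : Type*} [Field K] [Field L] [Algebra K L]

theorem eventually_redPoly_factorizationEq (Δ : Finset (σ →₀ ℕ)) (f : MvPolynomial σ L) :
    ∀ᶠ ψ in genericFilter K L, ∀ γ,
      ψ.redPoly (factorizationEq Δ f γ) = factorizationEq Δ (ψ.redPoly f) γ := by
  filter_upwards [eventually_exists_incl_eq f]
  rintro ψ ⟨f, rfl⟩ γ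
  have : factorizationEq Δ (ψ.incl f) γ = ψ.incl (factorizationEq Δ f γ) :=
    (map_factorizationEq _ _ _ _).symm
  rw [this, ψ.redPoly_incl, ψ.redPoly_incl]
  exact map_factorizationEq _ _ _ _

theorem isUnit_of_coeff_eq_zero {p : MvPolynomial σ K} (hp : p ≠ 0)
    (h : ∀ α ≠ 0, coeff α p = 0) : IsUnit p := by
  refine MvPolynomial.isUnit_iff.2 ⟨Ne.isUnit fun h0 => hp ?_, fun i hi => by simp [h i hi]⟩
  ext α
  by_cases hα : α = 0
  · rw [hα, h0, coeff_zero]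
  · rw [h α hα, coeff_zero]

theorem PartialPlace.totalDegree_redPoly_le (ψ : PartialPlace K L) (f : MvPolynomial σ L) :
    (ψ.redPoly f).totalDegree ≤ f.totalDegree := by
  refine Finset.sup_mono fun s hs => ?_
  rw [mem_support_iff] at hs ⊢
  rintro h
  rw [ψ.coeff_redPoly, h, ψ.red_zero] at hs
  exact hs rfl

/-- Irreducible polynomials stay irreducible at generic places. -/
theorem eventually_irreducible_redPoly [Finite σ] [IsAlgClosed L] {f : MvPolynomial σ L}
    (hf : Irreducible f) : ∀ᶠ ψ in genericFilter K L, Irreducible (ψ.redPoly f) := by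
  classical
  let Δ : Finset (σ →₀ ℕ) := (Finsupp.finite_of_degree_le (σ := σ) f.totalDegree).toFinset
  have hΔ : ∀ s, s ∈ Δ ↔ s.degree ≤ f.totalDegree := by simp [Δ]
  obtain ⟨γ, hγ0, hγ⟩ : ∃ γ ≠ 0, coeff γ f ≠ 0 := by
    by_contra! h
    exact hf.not_isUnit (isUnit_of_coeff_eq_zero hf.ne_zero h)
  have hsum : ∀ {q : MvPolynomial σ K}, q.totalDegree ≤ f.totalDegree → ∑ α : Δ, monomial (α : σ →₀ ℕ) (coeff (α : σ →₀ ℕ) q) = q := by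
    intro q hq
    rw [Finset.sum_coe_sort Δ fun α => monomial α (coeff α q)]
    refine Eq.trans (Finset.sum_subset (fun s hs => ?_) fun s _ hs => ?_).symm q.as_sum.symm
    · exact (hΔ s).2 ((le_totalDegree hs).trans hq)
    · rw [notMem_support_iff.1 hs, monomial_zero]
  have hL : ∀ α β : Δ, (α : σ →₀ ℕ) ≠ 0 → (β : σ →₀ ℕ) ≠ 0 →
      ∀ x ∈ zeroSet (Set.range (factorizationEq Δ f)), eval x (X (.inl α) * X (.inr β)) = 0 := by
    intro α β hα hβ x hx
    obtain ⟨u, v, rfl⟩ : ∃ u v, x = Sum.elim u v := ⟨_, _, (Sum.elim_comp_inl_inr x).symm⟩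
    have hUV : (∑ α : Δ, monomial (α : σ →₀ ℕ) (u α)) * (∑ β : Δ, monomial (β : σ →₀ ℕ) (v β))
        = f := by
      rw [← sub_eq_zero]
      ext γ
      rw [← eval_factorizationEq, coeff_zero]
      exact hx _ ⟨γ, rfl⟩
    have hco : ∀ (w : Δ → L) (α : Δ), coeff α (∑ α : Δ, monomial (α : σ →₀ ℕ) (w α)) = w α := by
      intro w α
      simp [coeff_sum, coeff_monomial]
    rcases hf.isUnit_or_isUnit hUV.symm with h | h
    · have := (MvPolynomial.isUnit_iff.1 h).2 α hα
      rw [hco, isNilpotent_iff_eq_zero] at this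
      simp [this]
    · have := (MvPolynomial.isUnit_iff.1 h).2 β hβ
      rw [hco, isNilpotent_iff_eq_zero] at this
      simp [this]
  have hK := eventually_all.2 fun α : Δ => eventually_all.2 fun β : Δ =>
    eventually_imp_distrib_left.2 fun hα => eventually_imp_distrib_left.2 fun hβ =>
      eventually_eval_redPoly_eq_zero (K := K) (hL α β hα hβ)
  have hX : ∀ᶠ ψ in genericFilter K L, ∀ α β : Δ,
      ψ.redPoly (X (.inl α) * X (.inr β) : MvPolynomial (Δ ⊕ Δ) L) = X (.inl α) * X (.inr β) := by
    refine eventually_all.2 fun α => eventually_all.2 fun β => ?_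
    filter_upwards [eventually_redPoly_mul (K := K) (X (.inl α) : MvPolynomial (Δ ⊕ Δ) L)
      (X (.inr β))] with ψ h
    rw [h, ψ.redPoly_X, ψ.redPoly_X]
  filter_upwards [hK, hX, eventually_redPoly_factorizationEq Δ f, eventually_red_ne_zero hγ]
    with ψ h1 h2 h3 h4
  have hfγ : coeff γ (ψ.redPoly f) ≠ 0 := by rwa [ψ.coeff_redPoly]
  refine ⟨fun hu => hfγ ?_, fun a b hab => ?_⟩
  · exact isNilpotent_iff_eq_zero.1 ((MvPolynomial.isUnit_iff.1 hu).2 γ hγ0)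
  have hf0 : ψ.redPoly f ≠ 0 := fun h => hfγ (by rw [h, coeff_zero])
  have ha0 : a ≠ 0 := left_ne_zero_of_mul (hab ▸ hf0)
  have hb0 : b ≠ 0 := right_ne_zero_of_mul (hab ▸ hf0)
  have hdeg : a.totalDegree + b.totalDegree ≤ f.totalDegree := by
    rw [← totalDegree_mul_of_isDomain ha0 hb0, ← hab]
    exact ψ.totalDegree_redPoly_le f
  have hz : ∀ α β : Δ, (α : σ →₀ ℕ) ≠ 0 → (β : σ →₀ ℕ) ≠ 0 → coeff α a * coeff β b = 0 := by
    intro α β hα hβ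
    have := h1 α β hα hβ (Sum.elim (fun α : Δ => coeff α a) fun β : Δ => coeff β b) ?_
    · simpa [h2] using this
    · rintro _ ⟨_, ⟨γ, rfl⟩, rfl⟩
      rw [h3, eval_factorizationEq, hsum (by omega), hsum (by omega), ← hab, sub_self, coeff_zero]
  by_contra! hne
  obtain ⟨α, hα, hαa⟩ : ∃ α ≠ 0, coeff α a ≠ 0 := by
    by_contra! h
    exact hne.1 (isUnit_of_coeff_eq_zero ha0 h)
  obtain ⟨β, hβ, hβb⟩ : ∃ β ≠ 0, coeff β b ≠ 0 := by
    by_contra! h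
    exact hne.2 (isUnit_of_coeff_eq_zero hb0 h)
  refine mul_ne_zero hαa hβb (hz ⟨α, (hΔ α).2 ?_⟩ ⟨β, (hΔ β).2 ?_⟩ hα hβ)
  · have := le_totalDegree (mem_support_iff.2 hαa)
    exact this.trans (by omega)
  · have := le_totalDegree (mem_support_iff.2 hβb)
    exact this.trans (by omega)

end Irreducible

section Birational

open MvPolynomial Filter

variable {σ τ : Type*}

/-- A polynomial expression in fractions with a common denominator is a fraction, uniformly in the
homomorphism along which the numerators and denominators are evaluated. -/
theorem exists_clear_denominators {R A : Type*} (F F' : Type*) [CommRing R] [CommRing A]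
    [Algebra R A] [Field F] [Algebra R F] [Field F'] [Algebra R F'] (d : A) (P : σ → A)
    (g : MvPolynomial σ R) : ∃ (N : ℕ) (a : A),
      (∀ θ : A →ₐ[R] F, θ d ≠ 0 → aeval (fun i => θ (P i) / θ d) g * θ d ^ N = θ a) ∧
      (∀ θ : A →ₐ[R] F', θ d ≠ 0 → aeval (fun i => θ (P i) / θ d) g * θ d ^ N = θ a) := by
  induction g using MvPolynomial.induction_on with
  | C c => exact ⟨0, algebraMap R A c, by simp, by simp⟩
  | add p q hp hq =>
    obtain ⟨N, a, ha, ha'⟩ := hp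
    obtain ⟨N', b, hb, hb'⟩ := hq
    refine ⟨N + N', a * d ^ N' + b * d ^ N, fun θ hθ => ?_, fun θ hθ => ?_⟩
    · simp only [map_add, map_mul, map_pow, ← ha θ hθ, ← hb θ hθ]
      ring
    · simp only [map_add, map_mul, map_pow, ← ha' θ hθ, ← hb' θ hθ]
      ring
  | mul_X p i hp =>
    obtain ⟨N, a, ha, ha'⟩ := hp
    refine ⟨N + 1, a * P i, fun θ hθ => ?_, fun θ hθ => ?_⟩
    · rw [map_mul, map_mul, aeval_X, ← ha θ hθ]
      field_simp
      ring
    · rw [map_mul, map_mul, aeval_X, ← ha' θ hθ]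
      field_simp
      ring

variable {K L : Type*} [Field K] [Field L] [Algebra K L]

/-- The zero locus of a prime polynomial determines the polynomial. -/
theorem dvd_of_forall_eval_eq_zero [IsAlgClosed K] [Finite σ] {f p : MvPolynomial σ K}
    (hf : Prime f) (h : ∀ x, eval x f = 0 → eval x p = 0) : f ∣ p := by
  have hpr : (Ideal.span {f}).IsPrime := (Ideal.span_singleton_prime hf.ne_zero).2 hf
  rw [← Ideal.mem_span_singleton, ← hpr.radical, ← vanishingIdeal_zeroLocus_eq_radical (K := K),
    mem_vanishingIdeal_iff, zeroLocus_span]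
  intro x hx
  simpa [aeval_eq_eval] using h x (by simpa [aeval_eq_eval] using hx)

theorem PartialPlace.redPoly_rename_of_injective (ψ : PartialPlace K L) {φ : σ → τ}
    (hφ : Function.Injective φ) (p : MvPolynomial σ L) :
    ψ.redPoly (rename φ p) = rename φ (ψ.redPoly p) := by
  ext s
  rw [ψ.coeff_redPoly]
  by_cases h : ∃ u, Finsupp.mapDomain φ u = s
  · obtain ⟨u, rfl⟩ := h
    rw [coeff_rename_mapDomain _ hφ, coeff_rename_mapDomain _ hφ, ψ.coeff_redPoly]
  · rw [coeff_rename_eq_zero _ _ _ fun u hu => (h ⟨u, hu⟩).elim,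
      coeff_rename_eq_zero _ _ _ fun u hu => (h ⟨u, hu⟩).elim, ψ.red_zero]

theorem eventually_eval_redPoly_bind₁ [Finite σ] (φ : σ → MvPolynomial τ L)
    (p : MvPolynomial σ L) :
    ∀ᶠ ψ in genericFilter K L, ∀ y,
      eval y (ψ.redPoly (bind₁ φ p)) = eval (fun i => eval y (ψ.redPoly (φ i))) (ψ.redPoly p) := by
  filter_upwards [eventually_redPoly_bind₁ φ p] with ψ h y
  rw [h]
  exact eval₂Hom_bind₁ (RingHom.id K) y _ _

/-- The point of `Option σ → R` with special coordinate `w`. -/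
def optionPoint {R : Type*} (w : R) (x : σ → R) (o : Option σ) : R :=
  o.elim w x

theorem eval_optionPoint_rename {R : Type*} [CommRing R] (w : R) (x : σ → R)
    (p : MvPolynomial σ R) : eval (optionPoint w x) (rename some p) = eval x p := by
  rw [eval_rename]
  rfl

theorem eventually_eval_redPoly_X_mul_rename (p : MvPolynomial σ L) :
    ∀ᶠ ψ in genericFilter K L, ∀ w x,
      eval (optionPoint w x) (ψ.redPoly (X none * rename some p)) = w * eval x (ψ.redPoly p) := by
  filter_upwards [eventually_redPoly_mul (X none) (rename some p)] with ψ h w x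
  rw [h, ψ.redPoly_rename_of_injective (Option.some_injective σ), ψ.redPoly_X, map_mul, eval_optionPoint_rename, eval_X]
  rfl

/-- Relations between fractions specialize to generic places. -/
theorem eventually_eval_optionPoint_eq_zero [IsAlgClosed L] [Finite σ] {M : Type*} [Field M]
    [Algebra L M] {θ : MvPolynomial σ L →ₐ[L] M} {F : Set (MvPolynomial σ L)}
    (hF : RingHom.ker θ = Ideal.span F) {d : MvPolynomial σ L} (hd : θ d ≠ 0)
    {q : MvPolynomial (Option σ) L}
    (hq : aeval (optionPoint (θ d)⁻¹ fun i => θ (X i)) q = 0) :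
    ∀ᶠ ψ in genericFilter K L, ∀ x ∈ zeroSet (ψ.redPoly '' F), ∀ w,
      w * eval x (ψ.redPoly d) = 1 → eval (optionPoint w x) (ψ.redPoly q) = 0 := by
  have hL : ∀ y ∈ zeroSet (rename some '' F ∪ {X none * rename some d - 1}), eval y q = 0 := by
    intro y hy
    obtain ⟨w, x, rfl⟩ : ∃ w x, y = optionPoint w x :=
      ⟨y none, fun i => y (some i), funext fun o => by cases o <;> rfl⟩
    have hw : w * eval x d = 1 := by
      have := hy _ (Or.inr rfl)
      rwa [map_sub, map_mul, eval_optionPoint_rename, eval_X, map_one, sub_eq_zero] at this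
    have hd0 : eval x d ≠ 0 := right_ne_zero_of_mul_eq_one hw
    have hx : RingHom.ker θ ≤ RingHom.ker (aeval x : MvPolynomial σ L →ₐ[L] L) := by
      rw [hF, Ideal.span_le]
      intro p hp
      have := hy _ (Or.inl ⟨p, hp, rfl⟩)
      rw [eval_optionPoint_rename] at this
      simpa [aeval_eq_eval] using this
    let P : Option σ → MvPolynomial σ L := optionPoint 1 fun i => X i * d
    obtain ⟨N, a, ha, ha'⟩ := exists_clear_denominators M L d P q
    have hθP : (fun i => θ (P i) / θ d) = optionPoint (θ d)⁻¹ fun i => θ (X i) := by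
      funext o
      cases o with
      | none => simp [P, optionPoint]
      | some i => simp [P, optionPoint, hd]
    have hxP : (fun i => (aeval x : MvPolynomial σ L →ₐ[L] L) (P i) / aeval x d) =
        optionPoint w x := by
      funext o
      cases o with
      | none => simpa [P, optionPoint, aeval_eq_eval] using (eq_inv_of_mul_eq_one_left hw).symm
      | some i => simp [P, optionPoint, aeval_eq_eval, hd0]
    have h1 := ha θ hd
    rw [hθP, hq, zero_mul] at h1
    have h2 := ha' (aeval x) (by simpa [aeval_eq_eval] using hd0)
    rw [hxP, RingHom.mem_ker.1 (hx (RingHom.mem_ker.2 h1.symm))] at h2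
    have h3 := (mul_eq_zero.1 h2).resolve_right
      (pow_ne_zero _ (by simpa [aeval_eq_eval] using hd0))
    simpa [aeval_eq_eval] using h3
  filter_upwards [eventually_eval_redPoly_eq_zero (K := K) hL,
    eventually_redPoly_sub (X none * rename some d) 1,
    eventually_eval_redPoly_X_mul_rename d] with ψ h1 h2 h3 x hx w hw
  refine h1 _ ?_
  rintro _ ⟨p, ⟨p, hp, rfl⟩ | rfl, rfl⟩
  · rw [ψ.redPoly_rename_of_injective (Option.some_injective σ), eval_optionPoint_rename]
    exact hx _ ⟨p, hp, rfl⟩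
  · rw [h2, map_sub, h3, hw, ψ.redPoly_one, map_one, sub_self]

end Birational

section Image

open MvPolynomial Filter

variable {σ τ : Type*} {K L : Type*} [Field K] [Field L] [Algebra K L]

/-- The image of an irreducible hypersurface under a rational map is irreducible. -/
theorem polyIrreducible_image [IsAlgClosed K] [Finite τ] {f d : MvPolynomial τ K}
    (hf : Prime f) (P : σ → MvPolynomial τ K) (hd : ∃ z, eval z f = 0 ∧ eval z d ≠ 0) :
    PolyIrreducible
      ((fun z i => eval z (P i) / eval z d) '' {z | eval z f = 0 ∧ eval z d ≠ 0}) := by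
  refine ⟨Set.Nonempty.image _ hd, fun p q hpq => ?_⟩
  have key : ∀ p : MvPolynomial σ K, ∃ (N : ℕ) (a : MvPolynomial τ K), ∀ z, eval z d ≠ 0 →
      eval (fun i => eval z (P i) / eval z d) p * eval z d ^ N = eval z a := by
    intro p
    obtain ⟨N, a, ha, -⟩ := exists_clear_denominators K K d P p
    refine ⟨N, a, fun z hz => ?_⟩
    simpa [aeval_eq_eval] using ha (aeval z) (by simpa [aeval_eq_eval] using hz)
  obtain ⟨N, a, ha⟩ := key p
  obtain ⟨N', b, hb⟩ := key q
  have hdvd : f ∣ a * b * d := by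
    refine dvd_of_forall_eval_eq_zero hf fun z hz => ?_
    rw [map_mul, map_mul]
    by_cases hdz : eval z d = 0
    · rw [hdz, mul_zero]
    · rw [← ha z hdz, ← hb z hdz, mul_mul_mul_comm, hpq _ ⟨z, ⟨hz, hdz⟩, rfl⟩, zero_mul, zero_mul]
  obtain ⟨z, hz, hdz⟩ := hd
  have hfd : ¬ f ∣ d := by
    rintro ⟨c, rfl⟩
    exact hdz (by rw [map_mul, hz, zero_mul])
  have fin : ∀ (p : MvPolynomial σ K) (N : ℕ) (a : MvPolynomial τ K), (∀ z, eval z d ≠ 0 →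
      eval (fun i => eval z (P i) / eval z d) p * eval z d ^ N = eval z a) → f ∣ a →
      ∀ x ∈ (fun z i => eval z (P i) / eval z d) '' {z | eval z f = 0 ∧ eval z d ≠ 0},
        eval x p = 0 := by
    rintro p N _ h ⟨c, rfl⟩ _ ⟨z, ⟨hz, hdz⟩, rfl⟩
    have := h z hdz
    rw [map_mul, hz, zero_mul] at this
    exact (mul_eq_zero.1 this).resolve_right (pow_ne_zero _ hdz)
  exact ((hf.dvd_or_dvd hdvd).resolve_right hfd |> hf.dvd_or_dvd).imp (fin p N a ha) (fin q N' b hb)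

theorem aeval_optionPoint_bind₁ {M : Type*} [Field M] [Algebra L M] (θ : MvPolynomial τ L →ₐ[L] M)
    (w : M) (P : σ → MvPolynomial τ L) (g : MvPolynomial σ L) :
    aeval (optionPoint w fun j => θ (X j)) (bind₁ (fun i => X none * rename some (P i)) g) =
      aeval (fun i => w * θ (P i)) g := by
  rw [aeval_bind₁]
  congr 2
  funext i
  rw [map_mul, aeval_X, aeval_rename]
  congr 1
  exact (DFunLike.congr_fun (aeval_unique θ) (P i)).symm

theorem eventually_eval_optionPoint_bind₁ [Finite σ] (P : σ → MvPolynomial τ L)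
    (g : MvPolynomial σ L) : ∀ᶠ ψ in genericFilter K L, ∀ w x,
      eval (optionPoint w x) (ψ.redPoly (bind₁ (fun i => X none * rename some (P i)) g)) =
        eval (fun i => w * eval x (ψ.redPoly (P i))) (ψ.redPoly g) := by
  filter_upwards [eventually_eval_redPoly_bind₁ (fun i => X none * rename some (P i)) g,
    eventually_all.2 fun i => eventually_eval_redPoly_X_mul_rename (P i)] with ψ h1 h2 w x
  rw [h1]
  simp only [h2]

/-- A variety that is birational to an irreducible hypersurface specializes to varieties that
contain irreducible sets which are large in an explicit sense. -/
theorem eventually_exists_polyIrreducible [IsAlgClosed K] [IsAlgClosed L] [Finite σ] [Finite τ]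
    {M : Type*} [Field M] [Algebra L M] {π : MvPolynomial σ L →ₐ[L] M}
    {θ : MvPolynomial τ L →ₐ[L] M} {G : Finset (MvPolynomial σ L)} {f d : MvPolynomial τ L}
    {P : σ → MvPolynomial τ L} {h b : MvPolynomial σ L} {a : τ → MvPolynomial σ L}
    (hG : RingHom.ker π = Ideal.span G) (hθ : RingHom.ker θ = Ideal.span {f})
    (hf : Irreducible f) (hd : θ d ≠ 0) (hh : π h ≠ 0)
    (hP : ∀ i, π (X i) = (θ d)⁻¹ * θ (P i)) (ha : ∀ j, θ (X j) = (π h)⁻¹ * π (a j))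
    (hb : (θ d)⁻¹ = (π h)⁻¹ * π b) :
    ∀ᶠ ψ in genericFilter K L, ∃ W, PolyIrreducible W ∧ W ⊆ zeroSet (ψ.redPoly '' G) ∧
      ∀ x ∈ zeroSet (ψ.redPoly '' G), eval x (ψ.redPoly h) ≠ 0 → x ∈ W := by
  have hfθ : θ f = 0 := RingHom.mem_ker.1 (hθ ▸ Ideal.mem_span_singleton_self f)
  have hGπ : ∀ g ∈ G, π g = 0 := fun g hg => RingHom.mem_ker.1 (hG ▸ Ideal.subset_span hg)
  have hσ : ∀ g, aeval (fun i => (θ d)⁻¹ * θ (P i)) g = π g := fun g => by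
    simp only [← hP]
    exact (DFunLike.congr_fun (aeval_unique π) g).symm
  have hτ : ∀ g, aeval (fun j => (π h)⁻¹ * π (a j)) g = θ g := fun g => by
    simp only [← ha]
    exact (DFunLike.congr_fun (aeval_unique θ) g).symm
  have hz : ∃ z, eval z f = 0 ∧ eval z d ≠ 0 := by
    by_contra! H
    refine hd (RingHom.mem_ker.1 ?_)
    rw [hθ, Ideal.mem_span_singleton]
    exact dvd_of_forall_eval_eq_zero hf.prime H
  obtain ⟨z, hz, hdz⟩ := hz
  let A : MvPolynomial τ L →ₐ[L] MvPolynomial (Option σ) L :=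
    bind₁ fun j => X none * rename some (a j)
  have hA : ∀ g, aeval (optionPoint (π h)⁻¹ fun i => π (X i)) (A g) = θ g := fun g =>
    (aeval_optionPoint_bind₁ π _ a g).trans (hτ g)
  have hAev : ∀ g, ∀ᶠ ψ in genericFilter K L, ∀ w x,
      eval (optionPoint w x) (ψ.redPoly (A g)) =
        eval (fun j => w * eval x (ψ.redPoly (a j))) (ψ.redPoly g) := fun g =>
    eventually_eval_optionPoint_bind₁ a g
  filter_upwards [eventually_irreducible_redPoly (K := K) hf,
    eventually_eval_redPoly f z, eventually_eval_redPoly d z, eventually_red_ne_zero hdz,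
    (eventually_all_finset (l := genericFilter K L) G).2 fun g hg =>
      eventually_eval_optionPoint_eq_zero (q := bind₁ (fun i => X none * rename some (P i)) g) hθ hd
        (by rw [aeval_optionPoint_bind₁, hσ, hGπ g hg]),
    (eventually_all_finset (l := genericFilter K L) G).2 fun g _ =>
      eventually_eval_optionPoint_bind₁ P g,
    eventually_eval_optionPoint_eq_zero (q := A f) hG hh (by rw [hA, hfθ]),
    eventually_eval_optionPoint_eq_zero (q := A d * (X none * rename some b) - 1) hG hh (by
      rw [map_sub, map_mul, hA, map_mul, aeval_X, aeval_rename, map_one, sub_eq_zero,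
        ← mul_inv_cancel₀ hd, hb]
      congr 2
      exact (DFunLike.congr_fun (aeval_unique π) b).symm),
    eventually_all.2 fun i =>
      eventually_eval_optionPoint_eq_zero (q := X (some i) * A d - A (P i)) hG hh (by
        rw [map_sub, map_mul, hA, hA, aeval_X, sub_eq_zero]
        exact (congrArg (· * θ d) (hP i)).trans (by field_simp)),
    hAev f, hAev d, eventually_all.2 fun i => hAev (P i),
    eventually_redPoly_sub (A d * (X none * rename some b)) 1,
    eventually_redPoly_mul (A d) (X none * rename some b),
    eventually_all.2 fun i => eventually_redPoly_sub (X (some i) * A d) (A (P i)),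
    eventually_all.2 fun i => eventually_redPoly_mul (X (some i)) (A d)]
    with ψ hfψ hz' hdz' hdz'' hGψ hGψ' h1 h2 h3 hAf hAd hAP e1 e2 e3 e4
  refine ⟨_, polyIrreducible_image (d := ψ.redPoly d) hfψ.prime (fun i => ψ.redPoly (P i))
    ⟨_, by rw [hz', hz, ψ.red_zero], by rwa [hdz']⟩, ?_, ?_⟩
  · rintro _ ⟨y, ⟨hy, hdy⟩, rfl⟩ _ ⟨g, hg, rfl⟩
    have := hGψ g hg y (by rintro _ ⟨_, rfl, rfl⟩; exact hy) _ (inv_mul_cancel₀ hdy)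
    rw [hGψ' g hg] at this
    simpa only [div_eq_inv_mul] using this
  · intro x hx hhx
    have hw := inv_mul_cancel₀ hhx
    have h1 := h1 x hx _ hw
    have h2 := h2 x hx _ hw
    have h3 := fun i => h3 i x hx _ hw
    rw [hAf] at h1
    rw [e1, e2, map_sub, map_mul, hAd, ψ.redPoly_one, map_one, sub_eq_zero] at h2
    have hne := left_ne_zero_of_mul_eq_one h2
    refine ⟨_, ⟨h1, hne⟩, funext fun i => ?_⟩
    have h3 := h3 i
    rw [e3, e4, map_sub, map_mul, hAd, hAP, ψ.redPoly_X, eval_X, sub_eq_zero] at h3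
    exact (eq_div_of_mul_eq hne h3).symm

end Image

section Hypersurface

open MvPolynomial

theorem exists_prime_ker_eq_span {R M : Type*} [CommRing R] [IsDomain R]
    [UniqueFactorizationMonoid R] [CommRing M] [IsDomain M] (φ : Polynomial R →+* M)
    (hφ : Function.Injective (φ.comp Polynomial.C)) (hker : RingHom.ker φ ≠ ⊥) :
    ∃ f, Prime f ∧ RingHom.ker φ = Ideal.span {f} := by
  obtain ⟨f, hf, hfp⟩ := (RingHom.ker_isPrime φ).exists_mem_prime_of_ne_bot hker
  refine ⟨f, hfp, le_antisymm (fun p hp => ?_) ((Ideal.span_singleton_le_iff_mem _).2 hf)⟩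
  have hpr : (Ideal.span {f}).IsPrime := (Ideal.span_singleton_prime hfp.ne_zero).2 hfp
  have hdom : IsDomain (AdjoinRoot f) := Ideal.Quotient.isDomain (Ideal.span {f})
  have halg : ∀ x : AdjoinRoot f, IsAlgebraic R x := by
    intro x
    have hx : x ∈ Algebra.adjoin R {AdjoinRoot.root f} := by
      rw [AdjoinRoot.adjoinRoot_eq_top]
      exact Algebra.mem_top
    have hle : Algebra.adjoin R {AdjoinRoot.root f} ≤
        Subalgebra.algebraicClosure R (AdjoinRoot f) := by
      rw [Algebra.adjoin_le_iff, Set.singleton_subset_iff]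
      exact ⟨f, hfp.ne_zero, by rw [AdjoinRoot.aeval_eq, AdjoinRoot.mk_self]⟩
    exact hle hx
  by_contra hpf
  have hne : AdjoinRoot.mk f p ≠ 0 := fun h => hpf (Ideal.mem_span_singleton.2
    (AdjoinRoot.mk_eq_zero.1 h))
  obtain ⟨r, hr, c, hc⟩ := (halg _).exists_nonzero_dvd (mem_nonZeroDivisors_of_ne_zero hne)
  obtain ⟨c, rfl⟩ := AdjoinRoot.mk_surjective c
  have hdvd : f ∣ Polynomial.C r - p * c := by
    rw [← AdjoinRoot.mk_eq_zero, map_sub, map_mul, ← hc, AdjoinRoot.mk_C]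
    exact sub_self _
  obtain ⟨e, he⟩ := hdvd
  have := congrArg φ he
  rw [map_sub, map_mul, map_mul, RingHom.mem_ker.1 hp, RingHom.mem_ker.1 hf, zero_mul, zero_mul,
    sub_zero] at this
  exact hr (hφ (by simpa using this))

variable {L : Type*} [Field L]

/-- A finitely generated extension of a perfect field is the function field of a hypersurface. -/
theorem exists_irreducible_ker_eq_span [PerfectField L] (M : Type*) [Field M] [Algebra L M]
    [Algebra.EssFiniteType L M] :
    ∃ (s : Finset M) (θ : MvPolynomial (Option s) L →ₐ[L] M) (f : MvPolynomial (Option s) L),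
      Irreducible f ∧ RingHom.ker θ = Ideal.span {f} ∧ ∀ x, ∃ p q, x = θ p / θ q := by
  obtain ⟨s, hs, hsep⟩ := exists_isTranscendenceBasis_and_isSeparable_of_perfectField L M
  have : Algebra.EssFiniteType (IntermediateField.adjoin L (s : Set M)) M :=
    Algebra.EssFiniteType.of_comp L _ M
  have : FiniteDimensional (IntermediateField.adjoin L (s : Set M)) M :=
    Algebra.finite_of_essFiniteType_of_isAlgebraic
  obtain ⟨y, hy⟩ := Field.exists_primitive_element (IntermediateField.adjoin L (s : Set M)) M
  let v : Option s → M := fun o => o.elim y (fun i => (i : M))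
  have hv : IntermediateField.adjoin L (Set.range v) = ⊤ := by
    have hr : Set.range v = (s : Set M) ∪ {y} := by
      ext x
      simp [v, Set.mem_range, Option.exists, eq_comm]
    rw [hr, ← IntermediateField.adjoin_adjoin_left, hy]
    rfl
  let θ : MvPolynomial (Option s) L →ₐ[L] M := aeval v
  let e := optionEquivLeft L s
  have hker : RingHom.ker θ ≠ ⊥ := by
    intro h
    have hinj : AlgebraicIndependent L v := (RingHom.injective_iff_ker_eq_bot θ).2 h
    refine (hs.1.option_iff_transcendental y).1 hinj ?_
    exact hs.isAlgebraic.isAlgebraic y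
  let φ : Polynomial (MvPolynomial s L) →+* M := (θ.comp e.symm.toAlgHom).toRingHom
  have hφ : ∀ p, φ p = θ (e.symm p) := fun _ => rfl
  have hφC : Function.Injective (φ.comp Polynomial.C) := by
    have : φ.comp Polynomial.C = (aeval (fun i : s => (i : M)) : MvPolynomial s L →ₐ[L] M) := by
      refine MvPolynomial.ringHom_ext (fun r => ?_) fun i => ?_
      · simp [hφ, e]
      · simp [hφ, e, θ, v]
    rw [this]
    exact hs.1
  obtain ⟨f, hf, hfk⟩ := exists_prime_ker_eq_span φ hφC (by
    obtain ⟨p, hp, hp0⟩ := Submodule.exists_mem_ne_zero_of_ne_bot hker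
    intro h
    have : e p ∈ RingHom.ker φ := by
      rw [RingHom.mem_ker, hφ, e.symm_apply_apply]
      exact hp
    rw [h] at this
    exact hp0 (e.map_eq_zero_iff.1 this))
  refine ⟨s, θ, e.symm f, ((MulEquiv.prime_iff e.symm).2 hf).irreducible, ?_, fun x => ?_⟩
  · ext p
    rw [Ideal.mem_span_singleton, RingHom.mem_ker, ← e.symm_apply_apply p, ← hφ, ← RingHom.mem_ker,
      hfk, Ideal.mem_span_singleton]
    exact (map_dvd_iff e.symm).symm
  · have := hv.symm ▸ IntermediateField.mem_top (F := L) (x := x)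
    exact (IntermediateField.mem_adjoin_range_iff L v x).1 this

theorem exists_common_denominator {ι κ M : Type*} [Finite κ] [Field M] [Algebra L M]
    (ρ : MvPolynomial ι L →ₐ[L] M) (hρ : ∀ x, ∃ p q, x = ρ p / ρ q) (v : κ → M) :
    ∃ (d : MvPolynomial ι L) (P : κ → MvPolynomial ι L),
      ρ d ≠ 0 ∧ ∀ k, v k = (ρ d)⁻¹ * ρ (P k) := by
  classical
  cases nonempty_fintype κ
  have : ∀ k, ∃ p q, ρ q ≠ 0 ∧ v k = ρ p / ρ q := by
    intro k
    obtain ⟨p, q, h⟩ := hρ (v k)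
    by_cases hq : ρ q = 0
    · exact ⟨0, 1, by simp, by simp [h, hq]⟩
    · exact ⟨p, q, hq, h⟩
  choose p q hq h using this
  refine ⟨∏ k, q k, fun k => p k * ∏ j ∈ Finset.univ.erase k, q j, ?_, fun k => ?_⟩
  · rw [map_prod]
    exact Finset.prod_ne_zero_iff.2 fun k _ => hq k
  · rw [← Finset.mul_prod_erase Finset.univ q (Finset.mem_univ k), map_mul, map_mul, h]
    have : ρ (∏ j ∈ Finset.univ.erase k, q j) ≠ 0 := by
      rw [map_prod]
      exact Finset.prod_ne_zero_iff.2 fun k _ => hq k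
    have := hq k
    field_simp

end Hypersurface

section Specialization

open MvPolynomial Filter

variable {σ : Type*} {K L : Type*} [Field K] [Field L] [Algebra K L]

theorem eventually_exists_polyIrreducible_of_isPrime [IsAlgClosed K] [IsAlgClosed L] [Finite σ]
    {Q : Ideal (MvPolynomial σ L)} [Q.IsPrime] {G : Finset (MvPolynomial σ L)}
    (hG : Ideal.span G = Q) : ∃ h ∉ Q, ∀ᶠ ψ in genericFilter K L, ∃ W, PolyIrreducible W ∧
      W ⊆ zeroSet (ψ.redPoly '' G) ∧
      ∀ x ∈ zeroSet (ψ.redPoly '' G), eval x (ψ.redPoly h) ≠ 0 → x ∈ W := by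
  let B := MvPolynomial σ L ⧸ Q
  let M := FractionRing B
  have : Algebra.EssFiniteType B M := .of_isLocalization M (nonZeroDivisors B)
  have : Algebra.EssFiniteType L M := .comp L B M
  let π : MvPolynomial σ L →ₐ[L] M :=
    (IsScalarTower.toAlgHom L B M).comp (Ideal.Quotient.mkₐ L Q)
  have hπ : ∀ p, π p = algebraMap B M (Ideal.Quotient.mk Q p) := fun _ => rfl
  have hker : RingHom.ker π = Q := by
    ext p
    rw [RingHom.mem_ker, hπ, map_eq_zero_iff _ (IsFractionRing.injective B M),
      Ideal.Quotient.eq_zero_iff_mem]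
  have hdiv : ∀ x, ∃ p q, x = π p / π q := by
    intro x
    obtain ⟨a, b, -, rfl⟩ := IsFractionRing.div_surjective (A := B) x
    obtain ⟨p, rfl⟩ := Ideal.Quotient.mk_surjective a
    obtain ⟨q, rfl⟩ := Ideal.Quotient.mk_surjective b
    exact ⟨p, q, rfl⟩
  obtain ⟨s, θ, f, hf, hθ, hθdiv⟩ := exists_irreducible_ker_eq_span (L := L) M
  obtain ⟨d, P, hd, hP⟩ := exists_common_denominator θ hθdiv fun i => π (X i)
  obtain ⟨h, a, hh, ha⟩ := exists_common_denominator π hdiv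
    (optionPoint (θ d)⁻¹ fun j => θ (X j))
  refine ⟨h, fun hQ => hh (RingHom.mem_ker.1 (hker.symm ▸ hQ)), ?_⟩
  exact eventually_exists_polyIrreducible (hker.trans hG.symm) hθ hf hd hh hP
    (fun j => ha (some j)) (ha none)

/-- Irreducible varieties specialize to irreducible varieties. -/
theorem eventually_polyIrreducible_of_isPrime [IsAlgClosed K] [IsAlgClosed L] [Finite σ]
    {Q : Ideal (MvPolynomial σ L)} [Q.IsPrime] {G : Finset (MvPolynomial σ L)}
    (hG : Ideal.span G = Q) {g : MvPolynomial σ L} (hg : g ∉ Q) :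
    ∀ᶠ ψ in genericFilter K L, ∀ T ⊆ zeroSet (ψ.redPoly '' G),
      (∀ x ∈ zeroSet (ψ.redPoly '' G), eval x (ψ.redPoly g) ≠ 0 → x ∈ T) → PolyIrreducible T := by
  obtain ⟨h, hh, hW⟩ := eventually_exists_polyIrreducible_of_isPrime (K := K) hG
  filter_upwards [hW, eventually_eval_eq_zero_of_basicOpen (K := K) hG hh,
    eventually_eval_eq_zero_of_basicOpen (K := K) hG hg] with ψ hW hdh hdg T hTG hT
  obtain ⟨W, hWirr, hWG, hW⟩ := hW
  have hWV : ∀ p, (∀ x ∈ W, eval x p = 0) → ∀ x ∈ zeroSet (ψ.redPoly '' G), eval x p = 0 :=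
    fun p hp => hdh p fun x hx hhx => hp x (hW x hx hhx)
  have hTV : ∀ p, (∀ x ∈ T, eval x p = 0) → ∀ x ∈ zeroSet (ψ.redPoly '' G), eval x p = 0 :=
    fun p hp => hdg p fun x hx hgx => hp x (hT x hx hgx)
  refine ⟨?_, fun p q hpq => ?_⟩
  · by_contra hne
    rw [Set.not_nonempty_iff_eq_empty] at hne
    obtain ⟨x, hx⟩ := hWirr.1
    simpa using hTV 1 (by simp [hne]) x (hWG hx)
  · have hpq' := hTV (p * q) fun x hx => by rw [map_mul, hpq x hx]
    refine (hWirr.2 p q fun x hx => ?_).imp (fun h x hx => hWV p h x (hTG hx))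
      fun h x hx => hWV q h x (hTG hx)
    rw [← map_mul]
    exact hpq' x (hWG hx)

end Specialization

section Locus

open MvPolynomial Filter

/-- The finite union of the basic constructible sets given by equations `F i = 0` and `g i ≠ 0`. -/
def locus {σ ι K : Type*} [Field K] (F : ι → Set (MvPolynomial σ K))
    (g : ι → MvPolynomial σ K) : Set (σ → K) :=
  {x | ∃ i, x ∈ zeroSet (F i) ∧ eval x (g i) ≠ 0}

variable {σ ι : Type*} {K L : Type*} [Field K] [Field L] [Algebra K L]

/-- The specialization of a constructible set along a partial place. -/
def PartialPlace.redLocus (ψ : PartialPlace K L) (F : ι → Finset (MvPolynomial σ L))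
    (g : ι → MvPolynomial σ L) : Set (σ → K) :=
  locus (fun i => ψ.redPoly '' F i) fun i => ψ.redPoly (g i)

variable {F : ι → Finset (MvPolynomial σ L)} {g : ι → MvPolynomial σ L}

theorem eventually_forall_redLocus [IsAlgClosed L] [Finite σ] [Finite ι] {p : MvPolynomial σ L}
    (hp : ∀ x ∈ locus (fun i => (F i : Set (MvPolynomial σ L))) g, eval x p = 0) :
    ∀ᶠ ψ in genericFilter K L, ∀ x ∈ ψ.redLocus F g, eval x (ψ.redPoly p) = 0 := by
  filter_upwards [eventually_all.2 fun i => eventually_eval_redPoly_eq_zero (K := K)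
      (F := (F i : Set (MvPolynomial σ L))) (p := p * g i) fun x hx => by
        rw [map_mul]
        by_cases h : eval x (g i) = 0
        · rw [h, mul_zero]
        · rw [hp x ⟨i, hx, h⟩, zero_mul],
    eventually_all.2 fun i => eventually_redPoly_mul p (g i)] with ψ h1 h2
  rintro x ⟨i, hx, hgx⟩
  have := h1 i x hx
  rw [h2, map_mul] at this
  exact (mul_eq_zero.1 this).resolve_right hgx

theorem eventually_exists_redLocus [Finite σ] {p : MvPolynomial σ L} {x : σ → L}
    (hx : x ∈ locus (fun i => (F i : Set (MvPolynomial σ L))) g) (hp : eval x p ≠ 0) :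
    ∀ᶠ ψ in genericFilter K L, ∃ y ∈ ψ.redLocus F g, eval y (ψ.redPoly p) ≠ 0 := by
  obtain ⟨i, hx, hgx⟩ := hx
  filter_upwards [eventually_eval_redPoly p x, eventually_red_ne_zero hp,
    eventually_eval_redPoly (g i) x, eventually_red_ne_zero hgx,
    (eventually_all_finset (l := genericFilter K L) (F i)).2
      fun q _ => eventually_eval_redPoly q x] with ψ h1 h2 h3 h4 h5
  refine ⟨fun j => ψ.red (x j), ⟨i, ?_, by rwa [h3]⟩, by rwa [h1]⟩
  rintro _ ⟨q, hq, rfl⟩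
  rw [h5 q hq, hx q hq, ψ.red_zero]

theorem eventually_not_polyIrreducible_redLocus [IsAlgClosed L] [Finite σ] [Finite ι]
    (h : ¬ PolyIrreducible (locus (fun i => (F i : Set (MvPolynomial σ L))) g)) :
    ∀ᶠ ψ in genericFilter K L, ¬ PolyIrreducible (ψ.redLocus F g) := by
  rw [PolyIrreducible, not_and] at h
  by_cases hne : (locus (fun i => (F i : Set (MvPolynomial σ L))) g).Nonempty
  · have h := h hne
    push Not at h
    obtain ⟨p, q, hpq, ⟨x, hx, hxp⟩, y, hy, hyq⟩ := h
    filter_upwards [eventually_exists_redLocus (K := K) hx hxp,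
      eventually_exists_redLocus (K := K) hy hyq,
      eventually_forall_redLocus (K := K) (p := p * q) fun x hx => by rw [map_mul, hpq x hx],
      eventually_redPoly_mul p q] with ψ h1 h2 h3 h4 hirr
    obtain ⟨x, hx, hxp⟩ := h1
    obtain ⟨y, hy, hyq⟩ := h2
    rcases hirr.2 (ψ.redPoly p) (ψ.redPoly q) fun x hx => by
      rw [← map_mul, ← h4, h3 x hx] with h | h
    · exact hxp (h x hx)
    · exact hyq (h y hy)
  · filter_upwards [eventually_forall_redLocus (K := K) (F := F) (g := g) (p := 1)
      fun x hx => (hne ⟨x, hx⟩).elim] with ψ h1 hirr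
    obtain ⟨x, hx⟩ := hirr.1
    simpa [ψ.redPoly_one] using h1 x hx

theorem eventually_polyIrreducible_redLocus [IsAlgClosed K] [IsAlgClosed L] [Finite σ] [Finite ι]
    (h : PolyIrreducible (locus (fun i => (F i : Set (MvPolynomial σ L))) g)) :
    ∀ᶠ ψ in genericFilter K L, PolyIrreducible (ψ.redLocus F g) := by
  cases nonempty_fintype ι
  let Q : Ideal (MvPolynomial σ L) :=
    vanishingIdeal L (locus (fun i => (F i : Set (MvPolynomial σ L))) g)
  have hmem : ∀ p, p ∈ Q ↔
      ∀ x ∈ locus (fun i => (F i : Set (MvPolynomial σ L))) g, eval x p = 0 := by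
    intro p
    simp [Q, mem_vanishingIdeal_iff, aeval_eq_eval]
  have hQ : Q.IsPrime := by
    refine Ideal.isPrime_iff.2 ⟨fun htop => ?_, fun {p q} hpq => ?_⟩
    · obtain ⟨x, hx⟩ := h.1
      simpa using (hmem 1).1 ((Ideal.eq_top_iff_one Q).1 htop) x hx
    · rw [hmem, hmem]
      exact h.2 p q fun x hx => by rw [← map_mul]; exact (hmem _).1 hpq x hx
  obtain ⟨i, hi⟩ : ∃ i, ∀ p, (∀ x ∈ zeroSet (F i : Set (MvPolynomial σ L)),
      eval x (g i) ≠ 0 → eval x p = 0) → p ∈ Q := by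
    by_contra! H
    choose p hp hpQ using H
    have : ∏ i, p i ∈ Q := by
      rw [hmem]
      rintro x ⟨i, hx, hgx⟩
      rw [map_prod]
      exact Finset.prod_eq_zero (Finset.mem_univ i) (hp i x hx hgx)
    obtain ⟨i, -, hi⟩ := hQ.prod_mem_iff.1 this
    exact hpQ i hi
  have hFQ : ∀ p ∈ F i, p ∈ Q := fun p hp => hi p fun x hx _ => hx p hp
  have hgQ : g i ∉ Q := fun hg => hQ.ne_top ((Ideal.eq_top_iff_one Q).2
    (hi 1 fun x hx hgx => (hgx ((hmem _).1 hg x ⟨i, hx, hgx⟩)).elim))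
  obtain ⟨G, hG⟩ := IsNoetherian.noetherian Q
  filter_upwards [eventually_polyIrreducible_of_isPrime (K := K) hG hgQ,
    (eventually_all_finset (l := genericFilter K L) G).2 fun p hp =>
      eventually_forall_redLocus ((hmem p).1 (hG ▸ Ideal.subset_span hp)),
    (eventually_all_finset (l := genericFilter K L) (F i)).2 fun p hp =>
      eventually_redPoly_mem_span (hG.ge (hFQ p hp))]
    with ψ h1 h2 h3
  refine h1 _ ?_ fun x hx hgx => ⟨i, ?_, hgx⟩
  · rintro x hx _ ⟨p, hp, rfl⟩
    exact h2 p hp x hx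
  · rintro _ ⟨p, hp, rfl⟩
    rw [← zeroSet_span] at hx
    exact hx _ (h3 p hp)

end Locus

section Fibers

open MvPolynomial Filter

variable {α σ K : Type*} [Field K]

/-- The polynomial obtained by substituting parameters for the first block of variables. -/
noncomputable def fiberPoly {R : Type*} [CommRing R] [Algebra K R] (a : α → R)
    (p : MvPolynomial (α ⊕ σ) K) : MvPolynomial σ R :=
  aeval (Sum.elim (fun j => C (a j)) X) p

theorem map_fiberPoly {R R' : Type*} [CommRing R] [Algebra K R] [CommRing R'] [Algebra K R']
    (f : R →ₐ[K] R') (a : α → R) (p : MvPolynomial (α ⊕ σ) K) :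
    MvPolynomial.map (f : R →+* R') (fiberPoly a p) = fiberPoly (fun j => f (a j)) p := by
  refine (comp_aeval_apply (Sum.elim (fun j => C (a j)) X) (mapAlgHom (σ := σ) f) p).trans ?_
  rw [fiberPoly]
  congr 2
  funext i
  cases i <;> simp

theorem eval_fiberPoly (a : α → K) (x : σ → K) (p : MvPolynomial (α ⊕ σ) K) :
    eval x (fiberPoly a p) = eval (Sum.elim a x) p := by
  have := comp_aeval_apply (R := K) (Sum.elim (fun j => C (a j)) X) (aeval (S₁ := K) x) p
  rw [aeval_eq_eval] at this
  refine this.trans ?_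
  rw [aeval_eq_eval]
  congr 2
  funext i
  cases i <;> simp

theorem PartialPlace.redPoly_fiberPoly {L : Type*} [Field L] [Algebra K L] (ψ : PartialPlace K L)
    {η : α → L} {a : α → K} (h : ∀ j, ∃ hj : η j ∈ ψ.ring, ψ.hom ⟨η j, hj⟩ = a j)
    (p : MvPolynomial (α ⊕ σ) K) : ψ.redPoly (fiberPoly η p) = fiberPoly a p := by
  choose hη ha using h
  have h1 : ψ.incl (fiberPoly (fun j => (⟨η j, hη j⟩ : ψ.ring)) p) = fiberPoly η p :=
    map_fiberPoly ψ.ring.val _ p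
  rw [← h1, ψ.redPoly_incl]
  refine (map_fiberPoly ψ.hom _ p).trans ?_
  simp only [ha]

theorem isConstructibleIn_setOf_polyIrreducible_locus [IsAlgClosed K] [Finite α] [Finite σ]
    {ι : Type*} [Finite ι] (F : ι → Finset (MvPolynomial (α ⊕ σ) K))
    (g : ι → MvPolynomial (α ⊕ σ) K) :
    IsConstructibleIn (zariskiTopology K α)
      {a | PolyIrreducible (locus (fun i => fiberPoly a '' (F i : Set (MvPolynomial (α ⊕ σ) K)))
        fun i => fiberPoly a (g i))} := by
  classical
  refine isConstructibleIn_of_forall_isPrime _ fun P hP => ?_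
  let A := MvPolynomial α K ⧸ P
  let L := AlgebraicClosure (FractionRing A)
  have : FaithfulSMul A L := (faithfulSMul_iff_algebraMap_injective A L).2 <| by
    rw [IsScalarTower.algebraMap_eq A (FractionRing A) L]
    exact (algebraMap (FractionRing A) L).injective.comp (IsFractionRing.injective _ _)
  have : Algebra.IsAlgebraic A L :=
    (IsFractionRing.comap_isAlgebraic_iff (K := FractionRing A)).2 inferInstance
  let η : α → L := fun j => algebraMap A L (Ideal.Quotient.mk P (X j))
  let F' : ι → Finset (MvPolynomial σ L) := fun i => (F i).image (fiberPoly η)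
  let g' : ι → MvPolynomial σ L := fun i => fiberPoly η (g i)
  have key : ∀ p : Set (σ → K) → Prop,
      (∀ᶠ ψ in genericFilter K L, p (ψ.redLocus F' g')) →
      ∃ s ∉ P, ∀ a ∈ zeroSet (P : Set (MvPolynomial α K)), eval a s ≠ 0 →
        p (locus (fun i => fiberPoly a '' (F i : Set (MvPolynomial (α ⊕ σ) K)))
          fun i => fiberPoly a (g i)) := by
    intro p hp
    obtain ⟨s, hs, h⟩ := exists_partialPlace_of_eventually (A := A) hp
    obtain ⟨s, rfl⟩ := Ideal.Quotient.mk_surjective s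
    refine ⟨s, fun hsP => hs (Ideal.Quotient.eq_zero_iff_mem.2 hsP), fun a ha has => ?_⟩
    let β : A →ₐ[K] K := Ideal.Quotient.liftₐ P (aeval a) fun q hq => by
      simpa [aeval_eq_eval] using ha q hq
    have hβ : ∀ q, β (Ideal.Quotient.mk P q) = eval a q := fun q => by
      rw [← aeval_eq_eval]
      rfl
    obtain ⟨ψ, hψ, hψA⟩ := h β (by rwa [hβ])
    have hη : ∀ j, ∃ hj : η j ∈ ψ.ring, ψ.hom ⟨η j, hj⟩ = a j := fun j => by
      obtain ⟨hj, e⟩ := hψA (Ideal.Quotient.mk P (X j))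
      exact ⟨hj, by rw [e, hβ, eval_X]⟩
    convert hψ using 1
    simp only [PartialPlace.redLocus, F', g', Finset.coe_image, Set.image_image,
      ψ.redPoly_fiberPoly hη]
  by_cases h : PolyIrreducible (locus (fun i => (F' i : Set (MvPolynomial σ L))) g')
  · obtain ⟨s, hs, hsP⟩ := key _ (eventually_polyIrreducible_redLocus h)
    exact ⟨s, hs, Or.inl hsP⟩
  · obtain ⟨s, hs, hsP⟩ := key (¬ PolyIrreducible ·) (eventually_not_polyIrreducible_redLocus h)
    exact ⟨s, hs, Or.inr hsP⟩

end Fibers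

/-- Irreducibility of the Zariski closure is definable in families over an
algebraically closed field: if `S ⊆ K^m × K^n` is constructible (the product
being identified with `K^{m+n}`, coordinates indexed by `Fin m ⊕ Fin n`), then
the set of parameters `a` such that the Zariski closure of the fiber `S_a` is
irreducible is a constructible subset of `K^m`. -/
theorem irreducible_closure_definable_in_families
    {K : Type*} [Field K] [IsAlgClosed K] (m n : ℕ)
    (S : Set (Fin m ⊕ Fin n → K))
    (hS : IsConstructibleIn (zariskiTopology K (Fin m ⊕ Fin n)) S) :
    IsConstructibleIn (zariskiTopology K (Fin m))
      {a : Fin m → K |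
        @IsIrreducible _ (zariskiTopology K (Fin n))
          (@closure _ (zariskiTopology K (Fin n))
            {x : Fin n → K | Sum.elim a x ∈ S})} := by
  obtain ⟨r, C, D, hC, hD, rfl⟩ := hS
  choose F hF using fun i => exists_finset_zeroSet_of_isClosed (hC i)
  choose G hG using fun i => exists_finset_zeroSet_of_isClosed (hD i)
  convert isConstructibleIn_setOf_polyIrreducible_locus (ι := Σ i, G i) (fun k => F k.1)
    (fun k => (k.2 : MvPolynomial (Fin m ⊕ Fin n) K)) using 1
  ext a
  rw [Set.mem_ofPred_eq, Set.mem_ofPred_eq,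
    @isIrreducible_iff_closure _ (zariskiTopology K (Fin n)), isIrreducible_zariski_iff]
  congr! 1
  ext x
  simp only [Set.mem_ofPred_eq, Set.mem_iUnion, Set.mem_sdiff, hF, hG, locus, zeroSet,
    Set.forall_mem_image, eval_fiberPoly, Sigma.exists, Subtype.exists]
  simp
end

section
/- Let K be an algebraically closed field and let S ⊆ K^m × K^n be a constructible set with respect to the Zariski topology on K^{m+n}. Then there exists N ∈ ℕ such that for every a ∈ K^m the Zariski closure of S_a in K^n has at most N irreducible components, and for every k ∈ ℕ the set { a ∈ K^m : the Zariski closure of S_a has exactly k irreducible components } is a constructible subset of K^m. (This is the second part of Theorem A.6(2) of the paper's appendix: the number of irreducible components of the Zariski closure is definable and bounded in families.) -/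
/-- The irreducible components of a (closed) subset `C` of a topological space:
the maximal irreducible closed subsets contained in `C`. -/
def irredComps {α : Type*} (t : TopologicalSpace α) (C : Set α) : Set (Set α) :=
  {T | Maximal (fun T => T ⊆ C ∧ @IsClosed _ t T ∧ @IsIrreducible _ t T) T}

theorem exists_finite_subset_forall_exists_le {α : Type*} [PartialOrder α] [WellQuasiOrderedLE α]
    (U : Set α) : ∃ s : Set α, s.Finite ∧ s ⊆ U ∧ ∀ u ∈ U, ∃ m ∈ s, m ≤ u := by
  refine ⟨{m | Minimal (· ∈ U) m}, WellQuasiOrderedLE.finite_of_isAntichain ?_, fun m hm => hm.1, ?_⟩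
  · intro a ha b hb hab hle
    exact hab (hb.eq_of_le ha.1 hle)
  · intro u hu
    obtain ⟨m, hmu, hm⟩ := exists_minimal_le_of_wellFoundedLT (· ∈ U) u hu
    exact ⟨m, hm, hmu⟩

/-- `v` is linearly independent and spans, up to multiplication by powers of `h`. -/
def IsBasisAwayFrom {R C ι : Type*} [CommRing R] [CommRing C] [Algebra R C] (h : R) (v : ι → C) :
    Prop :=
  LinearIndependent R v ∧ ∀ c, ∃ N, h ^ N • c ∈ Submodule.span R (Set.range v)

/-- Generic freeness of algebras of finite type over a domain. -/
theorem exists_isBasisAwayFrom (R C : Type*) [CommRing R] [IsDomain R]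
    [CommRing C] [Algebra R C] [Algebra.FiniteType R C] :
    ∃ h : R, h ≠ 0 ∧ ∃ (n : ℕ) (Δ : Set (Fin n →₀ ℕ)) (v : Δ → C), IsBasisAwayFrom h v := by
  obtain ⟨n, π, hπ⟩ := Algebra.FiniteType.iff_quotient_mvPolynomial''.mp
    (inferInstance : Algebra.FiniteType R C)
  let o : MonomialOrder (Fin n) := MonomialOrder.degLex
  let mon : (Fin n →₀ ℕ) → C := fun μ => π (MvPolynomial.monomial μ 1)
  have mon_add : ∀ μ ρ, mon (μ + ρ) = mon μ * mon ρ := by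
    intro μ ρ
    simp [mon, ← map_mul, MvPolynomial.monomial_mul]
  let low : (Fin n →₀ ℕ) → Submodule R C :=
    fun μ => Submodule.span R (mon '' {ν | o.toSyn ν < o.toSyn μ})
  let U : Set (Fin n →₀ ℕ) := {μ | ∃ r : R, r ≠ 0 ∧ r • mon μ ∈ low μ}
  have low_mul : ∀ μ ρ c, c ∈ low μ → c * mon ρ ∈ low (μ + ρ) := by
    intro μ ρ c hc
    induction hc using Submodule.span_induction with
    | mem x hx =>
      obtain ⟨ν, hν, rfl⟩ := hx
      rw [← mon_add]
      refine Submodule.subset_span ⟨_, ?_, rfl⟩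
      simpa using hν
    | zero => simp
    | add x y _ _ hx hy => rw [add_mul]; exact add_mem hx hy
    | smul a x _ hx => rw [smul_mul_assoc]; exact Submodule.smul_mem _ _ hx
  obtain ⟨s, hsf, hsU, hs⟩ := exists_finite_subset_forall_exists_le U
  choose! r hr0 hr using fun μ (hμ : μ ∈ U) => hμ
  let h : R := ∏ μ ∈ hsf.toFinset, r μ
  have hU : ∀ μ ∈ U, h • mon μ ∈ low μ := by
    intro μ hμ
    obtain ⟨m, hm, hle⟩ := hs μ hμ
    obtain ⟨ρ, rfl⟩ := le_iff_exists_add.mp hle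
    have hd : r m ∣ h := Finset.dvd_prod_of_mem _ (by simpa using hm)
    obtain ⟨q, hq⟩ := hd
    rw [hq, mul_comm, mul_smul]
    refine Submodule.smul_mem _ _ ?_
    rw [mon_add, ← smul_mul_assoc]
    exact low_mul _ _ _ (hr m (hsU hm))
  let v : (Uᶜ : Set _) → C := fun μ => mon μ
  have key : ∀ t : o.syn, ∀ μ, o.toSyn μ = t →
      ∃ N, h ^ N • mon μ ∈ Submodule.span R (Set.range v) := by
    intro t
    induction t using WellFoundedLT.induction with
    | ind t ih =>
      intro μ hμt
      by_cases hμ : μ ∈ U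
      · have h1 := hU μ hμ
        have : ∀ c ∈ low μ, ∃ N, h ^ N • c ∈ Submodule.span R (Set.range v) := by
          intro c hc
          induction hc using Submodule.span_induction with
          | mem x hx =>
            obtain ⟨ν, hν, rfl⟩ := hx
            exact ih _ (hμt ▸ hν) ν rfl
          | zero => exact ⟨0, by simp⟩
          | add x y _ _ hx hy =>
            obtain ⟨N, hN⟩ := hx
            obtain ⟨M, hM⟩ := hy
            refine ⟨N + M, ?_⟩
            rw [smul_add]
            refine add_mem ?_ ?_
            · rw [pow_add, mul_comm, mul_smul]; exact Submodule.smul_mem _ _ hN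
            · rw [pow_add, mul_smul]; exact Submodule.smul_mem _ _ hM
          | smul a x _ hx =>
            obtain ⟨N, hN⟩ := hx
            exact ⟨N, by rw [smul_comm]; exact Submodule.smul_mem _ _ hN⟩
        obtain ⟨N, hN⟩ := this _ h1
        exact ⟨N + 1, by rwa [pow_succ, mul_smul]⟩
      · exact ⟨0, by simpa using Submodule.subset_span (Set.mem_range_self (f := v) ⟨μ, hμ⟩)⟩
  refine ⟨h, ?_, n, Uᶜ, v, ?_, ?_⟩
  · exact Finset.prod_ne_zero_iff.mpr fun μ hμ => hr0 μ (hsU (by simpa using hμ))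
  · rw [linearIndependent_iff]
    intro l hl
    by_contra hne
    obtain ⟨μ, hμs, hμ⟩ := l.support.exists_max_image (fun μ => o.toSyn μ)
      (Finsupp.support_nonempty_iff.mpr hne)
    refine μ.2 ⟨l μ, Finsupp.mem_support_iff.mp hμs, ?_⟩
    rw [Finsupp.linearCombination_apply, Finsupp.sum, ← Finset.add_sum_erase _ _ hμs] at hl
    have : l μ • mon μ = - ∑ x ∈ l.support.erase μ, l x • v x := eq_neg_of_add_eq_zero_left hl
    rw [this]
    refine neg_mem (sum_mem fun ν hν => Submodule.smul_mem _ _ (Submodule.subset_span ⟨ν, ?_, rfl⟩))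
    rw [Finset.mem_erase] at hν
    refine lt_of_le_of_ne (hμ ν hν.2) fun he => hν.1 (Subtype.ext (o.toSyn.injective he))
  · intro c
    obtain ⟨p, rfl⟩ := hπ c
    induction p using MvPolynomial.induction_on' with
    | monomial μ a =>
      obtain ⟨N, hN⟩ := key _ μ rfl
      refine ⟨N, ?_⟩
      have : π (MvPolynomial.monomial μ a) = a • mon μ := by
        rw [← map_smul, MvPolynomial.smul_monomial]; simp
      rw [this, smul_comm]
      exact Submodule.smul_mem _ _ hN
    | add p q hp hq =>
      obtain ⟨N, hN⟩ := hp
      obtain ⟨M, hM⟩ := hq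
      refine ⟨N + M, ?_⟩
      rw [map_add, smul_add]
      refine add_mem ?_ ?_
      · rw [pow_add, mul_comm, mul_smul]; exact Submodule.smul_mem _ _ hN
      · rw [pow_add, mul_smul]; exact Submodule.smul_mem _ _ hM

namespace IsBasisAwayFrom

variable {R C ι : Type*} [CommRing R] [CommRing C] [Algebra R C] {h : R} {v : ι → C}

theorem exists_linearCombination_of_mem_map (hv : IsBasisAwayFrom h v) {I : Ideal R} {c : C}
    (hc : c ∈ I.map (algebraMap R C)) :
    ∃ N, ∃ l : ι →₀ R, (∀ i, l i ∈ I) ∧ h ^ N • c = Finsupp.linearCombination R v l := by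
  have hc' : c ∈ I • (⊤ : Submodule R C) := by
    rw [Ideal.smul_top_eq_map]; exact hc
  induction hc' using Submodule.smul_induction_on' with
  | smul r hr n _ =>
    obtain ⟨N, hN⟩ := hv.2 n
    obtain ⟨l, hl⟩ := (Finsupp.mem_span_range_iff_exists_finsupp).mp hN
    refine ⟨N, r • l, fun i => I.mul_mem_right _ hr, ?_⟩
    rw [smul_comm, ← hl, map_smul, Finsupp.linearCombination_apply]
  | add x hx y hy hx' hy' =>
    rw [Ideal.smul_top_eq_map] at hx hy
    obtain ⟨N, l, hl, hlx⟩ := hx' hx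
    obtain ⟨M, k, hk, hky⟩ := hy' hy
    refine ⟨N + M, h ^ M • l + h ^ N • k, fun i => add_mem (I.mul_mem_left _ (hl i))
      (I.mul_mem_left _ (hk i)), ?_⟩
    rw [map_add, map_smul, map_smul, ← hlx, ← hky, smul_smul, smul_smul, smul_add, pow_add,
      mul_comm]

theorem exists_pow_smul_mem_map (hv : IsBasisAwayFrom h v) {I : Ideal R} [I.IsPrime] (hh : h ∉ I)
    {p : R} (hp : p ∉ I) {c : C} (hc : p • c ∈ I.map (algebraMap R C)) :
    ∃ N, h ^ N • c ∈ I.map (algebraMap R C) := by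
  obtain ⟨N, l, hl, hlc⟩ := hv.exists_linearCombination_of_mem_map hc
  obtain ⟨M, hM⟩ := hv.2 c
  obtain ⟨s, hs⟩ := (Finsupp.mem_span_range_iff_exists_finsupp).mp hM
  rw [← Finsupp.linearCombination_apply R] at hs
  have key : h ^ M • l = (h ^ N * p) • s := by
    refine hv.1 ?_
    rw [map_smul, map_smul, hs, ← hlc]
    simp only [smul_smul]
    ring_nf
  refine ⟨M, ?_⟩
  rw [← hs, Finsupp.linearCombination_apply]
  refine sum_mem fun i _ => ?_
  simp only [Algebra.smul_def]
  refine Ideal.mul_mem_right _ _ (Ideal.mem_map_of_mem _ ?_)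
  have h1 : (h ^ N * p) * s i ∈ I := by
    have := congrArg (fun f => f i) key
    simp only [Finsupp.smul_apply, smul_eq_mul] at this
    rw [← this]
    exact I.mul_mem_left _ (hl i)
  have h2 : h ^ N * p ∉ I := fun hm => by
    rcases (‹I.IsPrime›).mem_or_mem hm with h3 | h3
    · exact hh ((‹I.IsPrime›).mem_of_pow_mem _ h3)
    · exact hp h3
  exact ((‹I.IsPrime›).mem_or_mem h1).resolve_left h2

theorem exists_pow_smul_mem_map_of_mul_mem {B : Type*} [CommRing B] [IsDomain B] [Algebra R B]
    {g : B} (hg : g ≠ 0) {w : ι → B} {v : ι → B ⧸ Ideal.span {g}}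
    (hw : ∀ i, Ideal.Quotient.mk _ (w i) = v i) (hv : IsBasisAwayFrom h v)
    {I : Ideal R} {b : B} (hb : g * b ∈ I.map (algebraMap R B)) :
    ∃ N, h ^ N • b ∈ I.map (algebraMap R B) := by
  have main : ∀ y ∈ I • (⊤ : Submodule R B), ∃ N, ∃ l : ι →₀ R, ∃ c ∈ I.map (algebraMap R B),
      h ^ N • y = Finsupp.linearCombination R w l + g * c := by
    intro y hy
    induction hy using Submodule.smul_induction_on' with
    | smul r hr n _ =>
      obtain ⟨N, hN⟩ := hv.2 (Ideal.Quotient.mk _ n)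
      obtain ⟨l, hl⟩ := (Finsupp.mem_span_range_iff_exists_finsupp).mp hN
      have : Ideal.Quotient.mk (Ideal.span {g}) (h ^ N • n) =
          Ideal.Quotient.mk _ (Finsupp.linearCombination R w l) := by
        rw [← Ideal.Quotient.mkₐ_eq_mk R, map_smul, Finsupp.linearCombination_apply, Finsupp.sum,
          map_sum]
        simp only [map_smul, Ideal.Quotient.mkₐ_eq_mk, hw]
        rw [← hl, Finsupp.sum]
      rw [Ideal.Quotient.mk_eq_mk_iff_sub_mem, Ideal.mem_span_singleton] at this
      obtain ⟨c, hc⟩ := this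
      refine ⟨N, r • l, algebraMap R B r * c, Ideal.mul_mem_right _ _ (Ideal.mem_map_of_mem _ hr), ?_⟩
      rw [smul_comm, map_smul, eq_add_of_sub_eq' hc, smul_add, Algebra.smul_def r (g * c)]
      ring
    | add x hx y hy hx' hy' =>
      obtain ⟨N, l, c, hc, hlx⟩ := hx'
      obtain ⟨M, k, d, hd, hky⟩ := hy'
      refine ⟨N + M, h ^ M • l + h ^ N • k, h ^ M • c + h ^ N • d, ?_, ?_⟩
      · simp only [Algebra.smul_def]
        exact add_mem (Ideal.mul_mem_left _ _ hc) (Ideal.mul_mem_left _ _ hd)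
      · have e1 : h ^ (N + M) • x = h ^ M • (h ^ N • x) := by rw [smul_smul, pow_add, mul_comm]
        have e2 : h ^ (N + M) • y = h ^ N • (h ^ M • y) := by rw [smul_smul, pow_add]
        rw [smul_add, e1, e2, hlx, hky, map_add, map_smul, map_smul, smul_add, smul_add, mul_add,
          mul_smul_comm, mul_smul_comm]
        abel
  obtain ⟨N, l, c, hc, he⟩ := main (g * b) (by rw [Ideal.smul_top_eq_map]; exact hb)
  have hl : l = 0 := by
    refine linearIndependent_iff.mp hv.1 l ?_
    have := congrArg (Ideal.Quotient.mkₐ R (Ideal.span {g})) he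
    rw [map_smul, map_add, map_mul, map_mul] at this
    have hg0 : Ideal.Quotient.mkₐ R (Ideal.span {g}) g = 0 := by
      rw [Ideal.Quotient.mkₐ_eq_mk, Ideal.Quotient.eq_zero_iff_mem]
      exact Ideal.mem_span_singleton_self g
    rw [hg0, zero_mul, zero_mul, smul_zero, add_zero, Finsupp.linearCombination_apply, Finsupp.sum,
      map_sum] at this
    rw [Finsupp.linearCombination_apply, Finsupp.sum, this]
    simp only [map_smul, Ideal.Quotient.mkₐ_eq_mk, hw]
  refine ⟨N, ?_⟩
  rw [hl, map_zero, zero_add, ← mul_smul_comm] at he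
  rw [mul_left_cancel₀ hg he]
  exact hc

end IsBasisAwayFrom

theorem Ideal.exists_pow_mul_mem_of_mem_minimalPrimes {R : Type*} [CommRing R] {I p : Ideal R}
    (hp : p ∈ I.minimalPrimes) {x : R} (hx : x ∈ p) : ∃ s ∉ p, ∃ n, x ^ n * s ∈ I := by
  obtain ⟨⟨hp₁, hp₂⟩, hp₃⟩ := hp
  have : p.map (algebraMap R (Localization.AtPrime p)) ≤ (I.map (algebraMap _ _)).radical := by
    rw [Ideal.radical_eq_sInf, le_sInf_iff]
    rintro q ⟨hq', hq⟩
    obtain ⟨h₁, h₂⟩ := ((IsLocalization.AtPrime.orderIsoOfPrime _ p) ⟨q, hq⟩).2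
    rw [Ideal.map_le_iff_le_comap] at hq' ⊢
    exact hp₃ ⟨h₁, hq'⟩ h₂
  obtain ⟨n, hn⟩ := this (Ideal.mem_map_of_mem _ hx)
  rw [IsLocalization.mem_map_algebraMap_iff (M := p.primeCompl)] at hn
  obtain ⟨⟨a, b⟩, hn⟩ := hn
  rw [← map_pow, ← map_mul, IsLocalization.eq_iff_exists p.primeCompl] at hn
  obtain ⟨t, ht⟩ := hn
  refine ⟨t * b, (t * b).2, n, ?_⟩
  simp only at ht
  have : x ^ n * (t.1 * b.1) = t.1 * a := by
    rw [← ht]; ring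
  rw [this]
  exact I.mul_mem_left _ a.2

/-- A nonzero element of `B` is a nonzerodivisor modulo general primes of the base; in particular
it avoids all minimal primes over their extensions. -/
theorem exists_forall_notMem_of_mem_minimalPrimes_map {A B : Type*} [CommRing A] [IsDomain A]
    [CommRing B] [IsDomain B] [Algebra A B] [Algebra.FiniteType A B] {g : B} (hg : g ≠ 0) :
    ∃ f : A, f ≠ 0 ∧ ∀ I : Ideal A, I.IsMaximal → f ∉ I →
      ∀ q ∈ (I.map (algebraMap A B)).minimalPrimes, g ∉ q := by
  have : Algebra.FiniteType A (B ⧸ Ideal.span {g}) :=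
    Algebra.FiniteType.of_surjective (Ideal.Quotient.mkₐ A (Ideal.span {g}))
      (Ideal.Quotient.mkₐ_surjective _ _)
  obtain ⟨f, hf, n, Δ, v, hv⟩ := exists_isBasisAwayFrom A (B ⧸ Ideal.span {g})
  choose w hw using fun i => Ideal.Quotient.mk_surjective (v i)
  refine ⟨f, hf, fun I hI hfI q hq hgq => ?_⟩
  have := hI
  have hqp : q.IsPrime := hq.1.1
  obtain ⟨s, hs, N, hN⟩ := Ideal.exists_pow_mul_mem_of_mem_minimalPrimes hq hgq
  have key : ∀ N s, g ^ N * s ∈ I.map (algebraMap A B) →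
      ∃ M, f ^ M • s ∈ I.map (algebraMap A B) := by
    intro N
    induction N with
    | zero => exact fun s hs => ⟨0, by simpa using hs⟩
    | succ N ih =>
      intro s hs
      rw [pow_succ', mul_assoc] at hs
      obtain ⟨M, hM⟩ := hv.exists_pow_smul_mem_map_of_mul_mem hg hw hs
      rw [← mul_smul_comm] at hM
      obtain ⟨M', hM'⟩ := ih _ hM
      exact ⟨M' + M, by rwa [pow_add, mul_smul]⟩
  obtain ⟨M, hM⟩ := key N s hN
  have h1 := hq.1.2 hM
  rw [Algebra.smul_def, map_pow] at h1
  have h2 : algebraMap A B f ∈ q := hqp.mem_of_pow_mem _ ((hqp.mem_or_mem h1).resolve_right hs)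
  have h3 : I ≤ q.comap (algebraMap A B) := Ideal.map_le_iff_le_comap.mp hq.1.2
  rw [hI.eq_of_le (Ideal.IsPrime.ne_top inferInstance) h3] at hfI
  exact hfI h2

theorem IsBasisAwayFrom.comap_eq_of_mem_minimalPrimes {R B ι : Type*} [CommRing R] [CommRing B]
    [Algebra R B] {h : R} {v : ι → B} (hv : IsBasisAwayFrom h v) {J : Ideal R} [J.IsPrime]
    (hJ : h ∉ J) {q : Ideal B} (hq : q ∈ (J.map (algebraMap R B)).minimalPrimes)
    (hhq : algebraMap R B h ∉ q) : q.comap (algebraMap R B) = J := by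
  have hqp : q.IsPrime := hq.1.1
  refine le_antisymm (fun r hr => ?_) (Ideal.map_le_iff_le_comap.mp hq.1.2)
  by_contra hrJ
  obtain ⟨s, hs, N, hN⟩ := Ideal.exists_pow_mul_mem_of_mem_minimalPrimes hq (Ideal.mem_comap.mp hr)
  rw [← map_pow, ← Algebra.smul_def] at hN
  obtain ⟨M, hM⟩ := hv.exists_pow_smul_mem_map hJ
    (fun hm => hrJ (Ideal.IsPrime.mem_of_pow_mem inferInstance _ hm)) hN
  have h1 := hq.1.2 hM
  rw [Algebra.smul_def, map_pow] at h1
  exact hhq (hqp.mem_of_pow_mem _ ((hqp.mem_or_mem h1).resolve_right hs))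

theorem MvPolynomial.totalDegree_map_le {σ R S : Type*} [CommSemiring R] [CommSemiring S]
    (f : R →+* S) (p : MvPolynomial σ R) : (map f p).totalDegree ≤ p.totalDegree :=
  Finset.sup_mono (support_map_subset f p)

theorem MvPolynomial.totalDegree_aeval_le_of_forall_le_one {σ τ R : Type*} [CommSemiring R]
    (p : MvPolynomial σ R) (f : σ → MvPolynomial τ R) (hf : ∀ i, (f i).totalDegree ≤ 1) :
    (aeval f p).totalDegree ≤ p.totalDegree := by
  rw [aeval_def, eval₂_eq]
  refine totalDegree_finsetSum_le fun d hd => ?_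
  refine (totalDegree_mul _ _).trans ?_
  rw [algebraMap_eq, totalDegree_C, zero_add]
  refine (totalDegree_finsetProd _ _).trans ?_
  refine le_trans (Finset.sum_le_sum (g := fun i => d i) fun i _ => ?_) (le_totalDegree hd)
  exact (totalDegree_pow _ _).trans (by simpa using Nat.mul_le_mul_left (d i) (hf i))

theorem MvPolynomial.exists_forall_map_ne_zero {τ A : Type*} [CommRing A]
    {r : MvPolynomial τ A} (hr : r ≠ 0) :
    ∃ f : A, f ≠ 0 ∧ ∀ {K : Type*} [CommRing K] (φ : A →+* K), φ f ≠ 0 → map φ r ≠ 0 := by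
  obtain ⟨d, hd⟩ := ne_zero_iff.mp hr
  refine ⟨r.coeff d, hd, fun φ hφ h => hφ ?_⟩
  rw [← coeff_map, h, coeff_zero]

/-- A homomorphism to an algebraically closed field extends to an algebraic extension, with a
prescribed prime over its kernel as kernel. -/
theorem exists_ringHom_ker_eq_of_comap_eq_ker {R B Ω : Type*} [CommRing R] [CommRing B]
    [Algebra R B] [Field Ω] [IsAlgClosed Ω] (ρ : R →+* Ω) {q : Ideal B} [q.IsPrime]
    (hq : q.comap (algebraMap R B) = RingHom.ker ρ) {s : Set B} (hs : Algebra.adjoin R s = ⊤)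
    (hroot : ∀ y ∈ s, ∃ F : Polynomial R, F.map ρ ≠ 0 ∧ Polynomial.aeval y F = 0) :
    ∃ θ : B →+* Ω, θ.comp (algebraMap R B) = ρ ∧ RingHom.ker θ = q := by
  have hqp : (RingHom.ker ρ).IsPrime := RingHom.ker_isPrime ρ
  have : q.LiesOver (RingHom.ker ρ) := ⟨hq.symm⟩
  let R' := R ⧸ RingHom.ker ρ
  let B' := B ⧸ q
  let _ : Algebra R' B' := Ideal.Quotient.algebraOfLiesOver q (RingHom.ker ρ)
  let _ : Algebra R' Ω := (RingHom.kerLift ρ).toAlgebra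
  have hR : Function.Injective (algebraMap R' Ω) := RingHom.kerLift_injective ρ
  have hB : Function.Injective (algebraMap R' B') :=
    FaithfulSMul.algebraMap_injective _ _
  have : FaithfulSMul R' Ω := (faithfulSMul_iff_algebraMap_injective _ _).mpr hR
  have : IsDomain R' := Ideal.Quotient.isDomain _
  have : IsDomain B' := Ideal.Quotient.isDomain _
  have : FaithfulSMul R' B' := (faithfulSMul_iff_algebraMap_injective _ _).mpr hB
  have : Module.IsTorsionFree R' B' := Module.isTorsionFree_iff_faithfulSMul.mpr this
  have : Module.IsTorsionFree R' Ω := Module.isTorsionFree_iff_faithfulSMul.mpr inferInstance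
  have hcomp : ∀ r : R, algebraMap R' B' (Ideal.Quotient.mk _ r) =
    Ideal.Quotient.mk _ (algebraMap R B r) := fun r => rfl
  have hle : ∀ b : B, Ideal.Quotient.mk q b ∈ Subalgebra.algebraicClosure R' B' := by
    intro b
    have hb : b ∈ Algebra.adjoin R s := hs ▸ Algebra.mem_top
    induction hb using Algebra.adjoin_induction with
    | mem y hy =>
      obtain ⟨F, hF, hFy⟩ := hroot y hy
      refine ⟨F.map (Ideal.Quotient.mk _), fun h0 => hF ?_, ?_⟩
      · have : (RingHom.kerLift ρ).comp (Ideal.Quotient.mk _) = ρ := RingHom.ext fun r => rfl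
        rw [← this, ← Polynomial.map_map, h0, Polynomial.map_zero]
      · have := congrArg (Ideal.Quotient.mk q) hFy
        rw [map_zero, Polynomial.aeval_def, Polynomial.hom_eval₂] at this
        rw [Polynomial.aeval_def, Polynomial.eval₂_map]
        exact this
    | algebraMap r =>
      rw [← hcomp]
      exact Subalgebra.algebraMap_mem _ _
    | add x y _ _ hx hy => rw [map_add]; exact add_mem hx hy
    | mul x y _ _ hx hy => rw [map_mul]; exact mul_mem hx hy
  have : Algebra.IsAlgebraic R' B' := ⟨fun b => by
    obtain ⟨b, rfl⟩ := Ideal.Quotient.mk_surjective b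
    exact hle b⟩
  let Θ : B' →ₐ[R'] Ω := IsAlgClosed.lift
  refine ⟨(Θ : B' →+* Ω).comp (Ideal.Quotient.mk q), ?_, ?_⟩
  · ext r
    exact Θ.commutes (Ideal.Quotient.mk _ r)
  · have hinj : Function.Injective Θ := by
      rw [injective_iff_map_eq_zero]
      intro b hb
      by_contra hb0
      obtain ⟨F, hF, hFb⟩ := (Algebra.IsAlgebraic.isAlgebraic (R := R') b).exists_nonzero_coeff_and_aeval_eq_zero
        (mem_nonZeroDivisors_of_ne_zero hb0)
      have := congrArg Θ hFb
      rw [← Polynomial.aeval_algHom_apply, hb, map_zero, ← Polynomial.coeff_zero_eq_aeval_zero'] at this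
      exact hF (hR (by rw [this, map_zero]))
    ext b
    rw [RingHom.mem_ker, RingHom.comp_apply, RingHom.coe_coe,
      map_eq_zero_iff Θ hinj, Ideal.Quotient.eq_zero_iff_mem]

open Polynomial in
/-- Over a unique factorization domain, an element of an algebraic closure of the fraction field
is a root of a divisor of any given annihilating polynomial whose roots are all conjugate. -/
theorem exists_dvd_forall_isConjRoot {T Ω : Type*} [CommRing T] [IsDomain T]
    [UniqueFactorizationMonoid T] [Field Ω] [Algebra T Ω] [Algebra (FractionRing T) Ω]
    [IsScalarTower T (FractionRing T) Ω] [IsAlgClosure (FractionRing T) Ω]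
    {H : T[X]} (hH : H ≠ 0) {α : Ω} (hα : aeval α H = 0) :
    ∃ G : T[X], G ∣ H ∧ aeval α G = 0 ∧
      ∀ β : Ω, aeval β G = 0 → ∃ s : Ω ≃ₐ[FractionRing T] Ω, s α = β := by
  classical
  have hinj : Function.Injective (algebraMap T Ω) := by
    rw [IsScalarTower.algebraMap_eq T (FractionRing T) Ω]
    exact (algebraMap (FractionRing T) Ω).injective.comp (IsFractionRing.injective T _)
  obtain ⟨G, hGi, hGH, hGα⟩ : ∃ G : T[X], Irreducible G ∧ G ∣ H ∧ aeval α G = 0 := by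
    induction H using UniqueFactorizationMonoid.induction_on_prime with
    | h₁ => exact absurd rfl hH
    | h₂ x hx =>
      have := hx.map (aeval α)
      rw [hα] at this
      exact absurd this not_isUnit_zero
    | h₃ a p ha hp ih =>
      rw [map_mul, mul_eq_zero] at hα
      rcases hα with h | h
      · exact ⟨p, hp.irreducible, dvd_mul_right _ _, h⟩
      · obtain ⟨G, h1, h2, h3⟩ := ih ha h
        exact ⟨G, h1, h2.mul_left _, h3⟩
  refine ⟨G, hGH, hGα, fun β hβ => ?_⟩
  have hdeg : G.natDegree ≠ 0 := by
    intro h0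
    obtain ⟨g, rfl⟩ := natDegree_eq_zero.mp h0
    rw [aeval_C, map_eq_zero_iff _ hinj] at hGα
    rw [hGα, map_zero] at hGi
    exact not_irreducible_zero hGi
  have hirr : Irreducible (G.map (algebraMap T (FractionRing T))) :=
    ((hGi.isPrimitive hdeg).irreducible_iff_irreducible_map_fraction_map).mp hGi
  have h1 := minpoly.eq_of_irreducible hirr (x := α) (by rw [aeval_map_algebraMap, hGα])
  have h2 := minpoly.eq_of_irreducible hirr (x := β) (by rw [aeval_map_algebraMap, hβ])
  have : Normal (FractionRing T) Ω := IsAlgClosure.normal _ _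
  exact isConjRoot_iff_exists_algEquiv.mp (h2.symm.trans h1)

open Polynomial in
theorem exists_forall_sum_pow_mul_ne {K Ω : Type*} [Field K] [Field Ω] [Algebra K Ω] {n N : ℕ}
    {E : Finset K} (hE : N * n < E.card) {Ξ : Finset (Fin n → Ω)} (hΞ : Ξ.card ≤ N)
    (ξ' : Fin n → Ω) :
    ∃ e ∈ E, ∀ ξ ∈ Ξ, ∑ j, algebraMap K Ω (e ^ j.val) * ξ j =
      ∑ j, algebraMap K Ω (e ^ j.val) * ξ' j → ξ = ξ' := by
  classical
  let P : (Fin n → Ω) → Polynomial Ω := fun ξ => ∑ j : Fin n, C (ξ j - ξ' j) * X ^ (j : ℕ)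
  have hP : ∀ ξ, ξ ≠ ξ' → P ξ ≠ 0 := by
    intro ξ hξ h0
    refine hξ (funext fun j => ?_)
    have := congrArg (fun p => coeff p (j : ℕ)) h0
    simp only [P, finsetSum_coeff, coeff_C_mul, coeff_X_pow, coeff_zero, Fin.val_inj, mul_ite,
      mul_one, mul_zero, Finset.sum_ite_eq, Finset.mem_univ, if_true] at this
    exact sub_eq_zero.mp this
  have hdeg : ∀ ξ, (P ξ).natDegree ≤ n := fun ξ =>
    natDegree_sum_le_of_forall_le _ _ fun j _ =>
      (natDegree_C_mul_X_pow_le _ _).trans j.2.le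
  by_contra! hcon
  refine absurd (eq_zero_of_natDegree_lt_card_of_eval_eq_zero' (∏ ξ ∈ Ξ.erase ξ', P ξ)
    (E.map ⟨algebraMap K Ω, (algebraMap K Ω).injective⟩) ?_ ?_) ?_
  · intro i hi
    obtain ⟨e, he, rfl⟩ := Finset.mem_map.mp hi
    obtain ⟨ξ, hξ, heq, hne⟩ := hcon e he
    rw [eval_prod]
    refine Finset.prod_eq_zero (Finset.mem_erase.mpr ⟨hne, hξ⟩) ?_
    simp only [P, eval_finsetSum, eval_mul, eval_C, eval_pow, eval_X, Function.Embedding.coeFn_mk]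
    rw [← sub_eq_zero, ← Finset.sum_sub_distrib] at heq
    rw [← heq]
    exact Finset.sum_congr rfl fun j _ => by rw [map_pow]; ring
  · rw [Finset.card_map]
    refine lt_of_le_of_lt ((natDegree_prod_le _ _).trans ?_) hE
    refine (Finset.sum_le_card_nsmul _ _ n fun ξ _ => hdeg ξ).trans ?_
    exact Nat.mul_le_mul_right _ ((Finset.card_le_card (Finset.erase_subset _ _)).trans hΞ)
  · exact Finset.prod_ne_zero_iff.mpr fun ξ hξ => hP ξ (Finset.ne_of_mem_erase hξ)

theorem MvPolynomial.aeval_optionEquivLeft {R S τ : Type*} [CommRing R] [CommRing S] [Algebra R S]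
    [Algebra (MvPolynomial τ R) S] [IsScalarTower R (MvPolynomial τ R) S] (α : S)
    (p : MvPolynomial (Option τ) R) :
    Polynomial.aeval α (optionEquivLeft R τ p) =
      aeval (fun o : Option τ => o.elim α fun i => algebraMap (MvPolynomial τ R) S (X i)) p := by
  have : ((Polynomial.aeval (R := MvPolynomial τ R) α).restrictScalars R).comp
      (optionEquivLeft R τ).toAlgHom =
      aeval (fun o : Option τ => o.elim α fun i => algebraMap (MvPolynomial τ R) S (X i)) := by
    ext o
    cases o <;> simp
  exact DFunLike.congr_fun this p

theorem MvPolynomial.map_aeval_eq_aeval_map {A B K Ω ι : Type*} [CommRing A] [CommRing B] [Algebra A B]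
    [CommRing K] [CommRing Ω] [Algebra K Ω] (φ : A →+* K) (θ : B →+* Ω)
    (h : θ.comp (algebraMap A B) = (algebraMap K Ω).comp φ) (y : ι → B) (p : MvPolynomial ι A) :
    θ (aeval y p) = aeval (fun i => θ (y i)) (map φ p) := by
  rw [aeval_def, aeval_def, eval₂_map, ← h]
  exact (eval₂_comp_left θ (algebraMap A B) y p)

section

open MvPolynomial

set_option maxHeartbeats 1000000 in
/-- Primes lying over the kernel of a specialization of a polynomial ring over which `B` is
algebraic are boundedly many and are separated by polynomials of bounded degree. -/
theorem finite_and_exists_separating_of_comap_eq_ker {K A B τ : Type*} [Field K] [CommRing A]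
    [Algebra K A] [CommRing B] [Algebra A B] [Algebra K B] [IsScalarTower K A B] {n : ℕ}
    {x : Fin n → B} (hx : Algebra.adjoin A (Set.range x) = ⊤) [Algebra (MvPolynomial τ A) B]
    [IsScalarTower A (MvPolynomial τ A) B] {c : τ → Fin n}
    (hc : ∀ i, algebraMap (MvPolynomial τ A) B (X i) = x (c i)) (φ : A →ₐ[K] K)
    {F : Fin n → Polynomial (MvPolynomial τ A)} (hF : ∀ j, Polynomial.aeval (x j) (F j) = 0)
    (hF0 : ∀ j, (F j).map (map (φ : A →+* K)) ≠ 0) {E : Finset K}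
    (hE : (∏ j, (F j).natDegree) * n < E.card) {H : K → MvPolynomial (Option τ) A}
    (hH : ∀ e ∈ E, aeval (fun o : Option τ => o.elim (∑ j, algebraMap K B (e ^ j.val) * x j)
      fun i => x (c i)) (H e) = 0)
    (hH0 : ∀ e ∈ E, map (φ : A →+* K) (H e) ≠ 0) {D : ℕ}
    (hD : ∀ e ∈ E, (H e).totalDegree ≤ D) {Q : Set (Ideal B)} (hQp : ∀ q ∈ Q, q.IsPrime)
    (hQ : ∀ q ∈ Q, q.comap (algebraMap (MvPolynomial τ A) B) =
      RingHom.ker (map (φ : A →+* K) : MvPolynomial τ A →+* MvPolynomial τ K)) :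
    Q.Finite ∧ Q.ncard ≤ ∏ j, (F j).natDegree ∧ ∀ q ∈ Q, ∀ q' ∈ Q, q ≠ q' →
      ∃ p : MvPolynomial (Fin n) K, p.totalDegree ≤ D ∧ aeval x p ∈ q ∧ aeval x p ∉ q' := by
  classical
  let T := MvPolynomial τ K
  let Ω := AlgebraicClosure (FractionRing T)
  let ρ : MvPolynomial τ A →+* Ω := (algebraMap T Ω).comp (map (φ : A →+* K))
  have hinj : Function.Injective (algebraMap T Ω) := by
    rw [IsScalarTower.algebraMap_eq T (FractionRing T) Ω]
    exact (algebraMap (FractionRing T) Ω).injective.comp (IsFractionRing.injective T _)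
  have hρX : ∀ i, ρ (X i) = algebraMap T Ω (X i) := fun i =>
    congrArg (algebraMap T Ω) (map_X (φ : A →+* K) i)
  have hρC : ∀ a, ρ (C a) = algebraMap K Ω (φ a) := fun a => by
    rw [IsScalarTower.algebraMap_apply K T Ω]
    exact congrArg (algebraMap T Ω) (map_C (φ : A →+* K) a)
  have hker : RingHom.ker ρ = RingHom.ker (map (φ : A →+* K) : MvPolynomial τ A →+* T) := by
    ext r
    simp only [ρ, RingHom.mem_ker, RingHom.comp_apply, map_eq_zero_iff _ hinj]
  have hρ0 : ∀ j, (F j).map ρ ≠ 0 := fun j => by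
    rw [← Polynomial.map_map]
    exact (Polynomial.map_ne_zero_iff hinj).mpr (hF0 j)
  have hadj : Algebra.adjoin (MvPolynomial τ A) (Set.range x) = ⊤ :=
    top_unique fun b _ => by
      have hb : b ∈ Algebra.adjoin A (Set.range x) := hx ▸ Algebra.mem_top
      exact Algebra.adjoin_le (S := (Algebra.adjoin (MvPolynomial τ A) (Set.range x)).restrictScalars A)
        Algebra.subset_adjoin hb
  have hθ : ∀ q : Ideal B, q ∈ Q → ∃ θ : B →+* Ω,
      θ.comp (algebraMap (MvPolynomial τ A) B) = ρ ∧ RingHom.ker θ = q := by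
    intro q hq
    have := hQp q hq
    refine exists_ringHom_ker_eq_of_comap_eq_ker ρ ((hQ q hq).trans hker.symm) hadj ?_
    rintro _ ⟨j, rfl⟩
    exact ⟨F j, hρ0 j, hF j⟩
  rcases Q.eq_empty_or_nonempty with rfl | ⟨q₀, hq₀⟩
  · simp
  have : Nonempty (B →+* Ω) := ⟨(hθ q₀ hq₀).choose⟩
  choose! θ hθρ hθker using hθ
  have hext : ∀ θ₁ θ₂ : B →+* Ω, θ₁.comp (algebraMap (MvPolynomial τ A) B) = ρ →
      θ₂.comp (algebraMap (MvPolynomial τ A) B) = ρ → (∀ j, θ₁ (x j) = θ₂ (x j)) → θ₁ = θ₂ := by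
    intro θ₁ θ₂ h1 h2 h
    ext b
    have hb : b ∈ Algebra.adjoin (MvPolynomial τ A) (Set.range x) := hadj ▸ Algebra.mem_top
    induction hb using Algebra.adjoin_induction with
    | mem y hy => obtain ⟨j, rfl⟩ := hy; exact h j
    | algebraMap r => exact RingHom.congr_fun (h1.trans h2.symm) r
    | add x y _ _ hx hy => rw [map_add, map_add, hx, hy]
    | mul x y _ _ hx hy => rw [map_mul, map_mul, hx, hy]
  let Ξ : Finset (Fin n → Ω) := Fintype.piFinset fun j => ((F j).map ρ).roots.toFinset
  have hΞcard : Ξ.card ≤ ∏ j, (F j).natDegree := by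
    rw [Fintype.card_piFinset]
    refine Finset.prod_le_prod' fun j _ => ?_
    exact (Multiset.toFinset_card_le _).trans
      ((Polynomial.card_roots' _).trans Polynomial.natDegree_map_le)
  have hΞ : ∀ θ' : B →+* Ω, θ'.comp (algebraMap (MvPolynomial τ A) B) = ρ →
      (fun j => θ' (x j)) ∈ Ξ := by
    intro θ' h
    refine Fintype.mem_piFinset.mpr fun j => ?_
    rw [Multiset.mem_toFinset, Polynomial.mem_roots (hρ0 j), Polynomial.IsRoot, ← h,
      Polynomial.eval_map, ← Polynomial.hom_eval₂, ← Polynomial.aeval_def, hF, map_zero]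
  have hQinj : Set.InjOn (fun q j => θ q (x j)) Q := by
    intro q hq q' hq' h
    rw [← hθker q hq, ← hθker q' hq', hext _ _ (hθρ q hq) (hθρ q' hq') fun j => congrFun h j]
  have hmaps : Set.MapsTo (fun q j => θ q (x j)) Q (Ξ : Set (Fin n → Ω)) :=
    fun q hq => hΞ _ (hθρ q hq)
  refine ⟨Set.Finite.of_injOn hmaps hQinj Ξ.finite_toSet, ?_, ?_⟩
  · refine le_trans ?_ hΞcard
    rw [← Set.ncard_coe_finset]
    exact Set.ncard_le_ncard_of_injOn _ hmaps hQinj Ξ.finite_toSet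
  · intro q hq q' hq' hne
    have hθA : ∀ q ∈ Q, (θ q).comp (algebraMap A B) = (algebraMap K Ω).comp (φ : A →+* K) := by
      intro q hq
      rw [IsScalarTower.algebraMap_eq A (MvPolynomial τ A) B, ← RingHom.comp_assoc, hθρ q hq]
      ext a
      exact hρC a
    have hθK : ∀ q ∈ Q, ∀ k, θ q (algebraMap K B k) = algebraMap K Ω k := by
      intro q hq k
      rw [IsScalarTower.algebraMap_apply K A B]
      have := RingHom.congr_fun (hθA q hq) (algebraMap K A k)
      simpa using this
    have hθc : ∀ q ∈ Q, ∀ i, θ q (x (c i)) = algebraMap T Ω (X i) := by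
      intro q hq i
      rw [← hc]
      exact (RingHom.congr_fun (hθρ q hq) (X i)).trans (hρX i)
    obtain ⟨e, heE, he⟩ := exists_forall_sum_pow_mul_ne hE hΞcard fun j => θ q' (x j)
    let u : B := ∑ j, algebraMap K B (e ^ j.val) * x j
    have hu : ∀ q ∈ Q, θ q u = ∑ j, algebraMap K Ω (e ^ j.val) * θ q (x j) := by
      intro q hq
      simp only [u, map_sum, map_mul (θ q), hθK q hq]
    have hroot : Polynomial.aeval (θ q u)
        (optionEquivLeft K τ (map (φ : A →+* K) (H e))) = 0 := by
      rw [aeval_optionEquivLeft]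
      have := MvPolynomial.map_aeval_eq_aeval_map (φ : A →+* K) (θ q) (hθA q hq) _ (H e)
        |>.symm.trans (congrArg (θ q) (hH e heE))
      rw [map_zero] at this
      rw [← this]
      congr 2
      funext o
      cases o with
      | none => rfl
      | some i => exact (hθc q hq i).symm
    obtain ⟨G, hGH, hGα, hG⟩ := exists_dvd_forall_isConjRoot
      ((map_ne_zero_iff _ (optionEquivLeft K τ).injective).mpr (hH0 e heE)) hroot
    obtain ⟨G, rfl⟩ := (optionEquivLeft K τ).surjective G
    rw [map_dvd_iff] at hGH
    let p : MvPolynomial (Fin n) K := aeval (fun o : Option τ =>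
      o.elim (∑ j : Fin n, C (e ^ j.val) * X j) fun i => X (c i)) G
    have hp : ∀ q ∈ Q, θ q (aeval x p) = Polynomial.aeval (θ q u) (optionEquivLeft K τ G) := by
      intro q hq
      rw [aeval_optionEquivLeft]
      have h1 := MvPolynomial.map_aeval_eq_aeval_map (RingHom.id K) (θ q)
        (RingHom.ext fun k => hθK q hq k) x p
      rw [h1, MvPolynomial.map_id, ← AlgHom.comp_apply]
      refine DFunLike.congr_fun (MvPolynomial.algHom_ext fun o => ?_) G
      cases o with
      | none => simp [hu q hq]
      | some i =>
        simp only [AlgHom.comp_apply, aeval_X, Option.elim]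
        exact hθc q hq i
    refine ⟨p, ?_, ?_, ?_⟩
    · refine (totalDegree_aeval_le_of_forall_le_one G _ fun o => ?_).trans
        ((totalDegree_le_of_dvd_of_isDomain hGH (hH0 e heE)).trans
          ((totalDegree_map_le _ _).trans (hD e heE)))
      cases o with
      | none =>
        refine totalDegree_finsetSum_le fun j _ => (totalDegree_mul _ _).trans ?_
        rw [totalDegree_C, totalDegree_X]
      | some i => simp
    · rw [← hθker q hq, RingHom.mem_ker, hp q hq, hGα]
    · rw [← hθker q' hq', RingHom.mem_ker, hp q' hq']
      intro h0
      obtain ⟨s, hs⟩ := hG _ h0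
      have hsρ : ((s : Ω →+* Ω).comp (θ q)).comp (algebraMap (MvPolynomial τ A) B) = ρ := by
        rw [RingHom.comp_assoc, hθρ q hq]
        ext r
        all_goals
          simp only [ρ, RingHom.comp_apply, RingHom.coe_coe]
          rw [IsScalarTower.algebraMap_apply T (FractionRing T) Ω, AlgEquiv.commutes]
      have hsT : ∀ k : K, s (algebraMap K Ω k) = algebraMap K Ω k := by
        intro k
        rw [IsScalarTower.algebraMap_apply K T Ω,
          IsScalarTower.algebraMap_apply T (FractionRing T) Ω, AlgEquiv.commutes]
      have hξ := he _ (hΞ _ hsρ) (by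
        simp only [RingHom.comp_apply, RingHom.coe_coe]
        rw [← hu q' hq', ← hs, hu q hq, map_sum]
        simp only [map_mul, hsT])
      have heq := hext _ _ hsρ (hθρ q' hq') fun j => congrFun hξ j
      refine hne ?_
      rw [← hθker q hq, ← hθker q' hq', ← heq]
      ext b
      simp [RingHom.mem_ker]

end

section

open MvPolynomial

/-- Uniform bound and separation for the minimal primes of the fibers over a dense open set, with
respect to a polynomial subring over which the algebra is algebraic. -/
theorem exists_bound_and_separating_of_isAlgebraic {K A B τ : Type*} [Field K] [IsAlgClosed K]
    [CommRing A] [IsDomain A] [Algebra K A] [CommRing B] [IsDomain B] [Algebra A B] [Algebra K B]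
    [IsScalarTower K A B] {n : ℕ} {x : Fin n → B} (hx : Algebra.adjoin A (Set.range x) = ⊤)
    [Algebra (MvPolynomial τ A) B] [IsScalarTower A (MvPolynomial τ A) B]
    [Algebra.IsAlgebraic (MvPolynomial τ A) B]
    (hinj : Function.Injective (algebraMap (MvPolynomial τ A) B)) {c : τ → Fin n}
    (hc : ∀ i, algebraMap (MvPolynomial τ A) B (X i) = x (c i)) :
    ∃ N D : ℕ, ∃ f : A, f ≠ 0 ∧ ∀ φ : A →ₐ[K] K, φ f ≠ 0 →
      ((RingHom.ker φ).map (algebraMap A B)).minimalPrimes.Finite ∧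
      ((RingHom.ker φ).map (algebraMap A B)).minimalPrimes.ncard ≤ N ∧
      ∀ q ∈ ((RingHom.ker φ).map (algebraMap A B)).minimalPrimes,
        ∀ q' ∈ ((RingHom.ker φ).map (algebraMap A B)).minimalPrimes, q ≠ q' →
        ∃ p : MvPolynomial (Fin n) K, p.totalDegree ≤ D ∧ aeval x p ∈ q ∧ aeval x p ∉ q' := by
  classical
  have : Algebra.FiniteType A B := ⟨⟨Finset.univ.image x, by simpa using hx⟩⟩
  have : Algebra.FiniteType (MvPolynomial τ A) B :=
    Algebra.FiniteType.of_restrictScalars_finiteType A _ _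
  obtain ⟨h, hh, k, Δ, v, hv⟩ := exists_isBasisAwayFrom (MvPolynomial τ A) B
  obtain ⟨f₁, hf₁, hf₁h⟩ := exists_forall_map_ne_zero hh
  obtain ⟨f₂, hf₂, hf₂h⟩ := exists_forall_notMem_of_mem_minimalPrimes_map (A := A)
    ((map_ne_zero_iff _ hinj).mpr hh)
  choose F hF0 hF using fun j => Algebra.IsAlgebraic.isAlgebraic (R := MvPolynomial τ A) (x j)
  choose f₃ hf₃ hf₃F using fun j => exists_forall_map_ne_zero
    (Polynomial.leadingCoeff_ne_zero.mpr (hF0 j))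
  obtain ⟨E, hE⟩ := Infinite.exists_subset_card_eq K ((∏ j, (F j).natDegree) * n + 1)
  let u : K → B := fun e => ∑ j, algebraMap K B (e ^ j.val) * x j
  have hHex : ∀ e, ∃ H : MvPolynomial (Option τ) A, H ≠ 0 ∧
      aeval (fun o : Option τ => o.elim (u e) fun i => x (c i)) H = 0 := by
    intro e
    obtain ⟨P, hP0, hP⟩ := Algebra.IsAlgebraic.isAlgebraic (R := MvPolynomial τ A) (u e)
    obtain ⟨H, rfl⟩ := (optionEquivLeft A τ).surjective P
    refine ⟨H, fun h0 => hP0 (by rw [h0, map_zero]), ?_⟩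
    rw [aeval_optionEquivLeft] at hP
    simpa only [hc] using hP
  choose H hH0 hH using hHex
  choose f₄ hf₄ hf₄H using fun e => exists_forall_map_ne_zero (hH0 e)
  refine ⟨∏ j, (F j).natDegree, E.sup fun e => (H e).totalDegree,
    f₁ * f₂ * (∏ j, f₃ j) * ∏ e ∈ E, f₄ e, ?_, fun φ hφ => ?_⟩
  · exact mul_ne_zero (mul_ne_zero (mul_ne_zero hf₁ hf₂)
      (Finset.prod_ne_zero_iff.mpr fun j _ => hf₃ j)) (Finset.prod_ne_zero_iff.mpr fun e _ => hf₄ e)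
  · simp only [map_mul, map_prod, mul_ne_zero_iff, Finset.prod_ne_zero_iff] at hφ
    obtain ⟨⟨⟨h1, h2⟩, h3⟩, h4⟩ := hφ
    have hmax : (RingHom.ker φ).IsMaximal := RingHom.ker_isMaximal_of_surjective φ
      fun k => ⟨algebraMap K A k, φ.commutes k⟩
    let ψ : MvPolynomial τ A →+* MvPolynomial τ K := map (φ : A →+* K)
    have hJ : (RingHom.ker φ).map (algebraMap A B) =
        (RingHom.ker ψ).map (algebraMap (MvPolynomial τ A) B) := by
      rw [ker_map, Ideal.map_map, IsScalarTower.algebraMap_eq A (MvPolynomial τ A) B]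
      rfl
    have : (RingHom.ker ψ).IsPrime := RingHom.ker_isPrime ψ
    refine finite_and_exists_separating_of_comap_eq_ker hx hc φ hF (fun j h0 => ?_) (E := E) ?_
      (H := H) (fun e _ => hH e) (fun e he => hf₄H e (φ : A →+* K) (h4 e he))
      (fun e he => Finset.le_sup (f := fun e => (H e).totalDegree) he) (fun q hq => hq.1.1)
      fun q hq => ?_
    · refine hf₃F j (φ : A →+* K) (h3 j (Finset.mem_univ j)) ?_
      have := congrArg (fun p => Polynomial.coeff p (F j).natDegree) h0
      simpa using this
    · rw [hE]; exact Nat.lt_succ_self _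
    · have hq2 := hf₂h (RingHom.ker φ) hmax h2 q hq
      rw [hJ] at hq
      exact hv.comap_eq_of_mem_minimalPrimes (hf₁h (φ : A →+* K) h1) hq hq2

/-- Uniform bound and separation for the minimal primes of the fibers over a dense open set. -/
theorem exists_bound_and_separating {K A B : Type*} [Field K] [IsAlgClosed K]
    [CommRing A] [IsDomain A] [Algebra K A] [CommRing B] [IsDomain B] [Algebra A B] [Algebra K B]
    [IsScalarTower K A B] {n : ℕ} {x : Fin n → B} (hx : Algebra.adjoin A (Set.range x) = ⊤)
    (hinj : Function.Injective (algebraMap A B)) :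
    ∃ N D : ℕ, ∃ f : A, f ≠ 0 ∧ ∀ φ : A →ₐ[K] K, φ f ≠ 0 →
      ((RingHom.ker φ).map (algebraMap A B)).minimalPrimes.Finite ∧
      ((RingHom.ker φ).map (algebraMap A B)).minimalPrimes.ncard ≤ N ∧
      ∀ q ∈ ((RingHom.ker φ).map (algebraMap A B)).minimalPrimes,
        ∀ q' ∈ ((RingHom.ker φ).map (algebraMap A B)).minimalPrimes, q ≠ q' →
        ∃ p : MvPolynomial (Fin n) K, p.totalDegree ≤ D ∧ aeval x p ∈ q ∧ aeval x p ∉ q' := by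
  have : FaithfulSMul A B := (faithfulSMul_iff_algebraMap_injective _ _).mpr hinj
  have : Algebra.IsAlgebraic (Algebra.adjoin A (Set.range x)) B := by
    rw [hx]
    exact ⟨fun b => isAlgebraic_algebraMap (⟨b, Algebra.mem_top⟩ : (⊤ : Subalgebra A B))⟩
  obtain ⟨t, ht, htb⟩ := exists_isTranscendenceBasis_subset (R := A) (Set.range x)
  choose c hc using fun i : t => ht i.2
  let _ : Algebra (MvPolynomial t A) B := (aeval (fun i : t => (i : B))).toAlgebra
  have hmap : ∀ p, algebraMap (MvPolynomial t A) B p = aeval (fun i : t => (i : B)) p :=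
    fun _ => rfl
  have : IsScalarTower A (MvPolynomial t A) B :=
    IsScalarTower.of_algebraMap_eq fun a => by rw [hmap, algebraMap_eq, aeval_C]
  have hal := htb.isAlgebraic
  have : Algebra.IsAlgebraic (MvPolynomial t A) B :=
    (Algebra.isAlgebraic_ringHom_iff_of_comp_eq htb.1.aevalEquiv (RingEquiv.refl B)
      (RingHom.ext fun p => by simp [hmap])).mp hal
  exact exists_bound_and_separating_of_isAlgebraic hx (τ := t) htb.1
    fun i => by rw [hmap, aeval_X, hc]

end

namespace MvPolynomial

variable {σ τ K : Type*} [Field K]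

/-- The filter of subsets of affine space containing a nonempty open subset of the zero locus
of the prime ideal `𝔭`. -/
def genericFilter (𝔭 : Ideal (MvPolynomial σ K)) [𝔭.IsPrime] : Filter (σ → K) where
  sets := {U | ∃ f ∉ 𝔭, ∀ a ∈ zeroLocus K 𝔭, aeval a f ≠ 0 → a ∈ U}
  univ_sets := ⟨1, (Ideal.ne_top_iff_one 𝔭).mp (Ideal.IsPrime.ne_top inferInstance),
    fun _ _ _ => Set.mem_univ _⟩
  sets_of_superset := fun ⟨f, hf, h⟩ hUV => ⟨f, hf, fun a ha hfa => hUV (h a ha hfa)⟩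
  inter_sets := by
    rintro U V ⟨f, hf, hU⟩ ⟨g, hg, hV⟩
    refine ⟨f * g, fun h => ?_, fun a ha hfg => ?_⟩
    · exact (Ideal.IsPrime.mem_or_mem inferInstance h).elim hf hg
    · rw [map_mul] at hfg
      exact ⟨hU a ha (left_ne_zero_of_mul hfg), hV a ha (right_ne_zero_of_mul hfg)⟩

theorem eventually_genericFilter {𝔭 : Ideal (MvPolynomial σ K)} [𝔭.IsPrime]
    {p : (σ → K) → Prop} : (∀ᶠ a in genericFilter 𝔭, p a) ↔
      ∃ f ∉ 𝔭, ∀ a ∈ zeroLocus K 𝔭, aeval a f ≠ 0 → p a :=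
  Iff.rfl

/-- The ideal of the fiber over the point `a` of the projection `K^(σ ⊕ τ) → K^σ`. -/
noncomputable def fiberIdeal (τ : Type*) (a : σ → K) : Ideal (MvPolynomial (σ ⊕ τ) K) :=
  (RingHom.ker (aeval a : MvPolynomial σ K →ₐ[K] K)).map
    (rename Sum.inl : MvPolynomial σ K →ₐ[K] MvPolynomial (σ ⊕ τ) K)

theorem zeroLocus_fiberIdeal (a : σ → K) :
    zeroLocus K (fiberIdeal τ a) = {z | z ∘ Sum.inl = a} := by
  ext z
  simp only [mem_zeroLocus_iff, Set.mem_ofPred_eq]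
  constructor
  · intro h
    ext i
    have := h (rename Sum.inl (X i - C (a i))) (Ideal.mem_map_of_mem _ (by simp [RingHom.mem_ker]))
    simpa [sub_eq_zero] using this
  · rintro rfl p hp
    have : fiberIdeal τ (z ∘ Sum.inl) ≤ RingHom.ker (aeval z : MvPolynomial (σ ⊕ τ) K →ₐ[K] K) := by
      rw [fiberIdeal, Ideal.map_le_iff_le_comap]
      intro q hq
      rw [Ideal.mem_comap, RingHom.mem_ker, aeval_rename]
      exact hq
    exact this hp

end MvPolynomial

theorem Ideal.comap_map_map_quotientMap {R S : Type*} [CommRing R] [CommRing S] {i : R →+* S}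
    {𝔭 : Ideal R} {P : Ideal S} (h : 𝔭 ≤ P.comap i) (M : Ideal R) :
    ((M.map (Ideal.Quotient.mk 𝔭)).map (Ideal.quotientMap P i h)).comap (Ideal.Quotient.mk P) =
      P ⊔ M.map i := by
  rw [Ideal.map_map, Ideal.quotientMap_comp_mk, ← Ideal.map_map,
    Ideal.comap_map_of_surjective _ Ideal.Quotient.mk_surjective, ← RingHom.ker_eq_comap_bot,
    Ideal.mk_ker, sup_comm]

namespace MvPolynomial

variable {σ τ K : Type*} [Field K]

theorem minimalPrimes_sup_fiberIdeal {𝔭 : Ideal (MvPolynomial σ K)}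
    {P : Ideal (MvPolynomial (σ ⊕ τ) K)}
    (h : 𝔭 ≤ P.comap (rename Sum.inl : MvPolynomial σ K →ₐ[K] MvPolynomial (σ ⊕ τ) K).toRingHom)
    {a : σ → K} (ha : 𝔭 ≤ RingHom.ker (aeval a : MvPolynomial σ K →ₐ[K] K)) :
    (P ⊔ fiberIdeal τ a).minimalPrimes = Ideal.comap (Ideal.Quotient.mk P) ''
      ((RingHom.ker (Ideal.Quotient.liftₐ 𝔭 (aeval a : MvPolynomial σ K →ₐ[K] K) ha)).map
        (Ideal.quotientMap P _ h)).minimalPrimes := by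
  rw [← Ideal.comap_minimalPrimes_eq_of_surjective Ideal.Quotient.mk_surjective]
  congr 1
  have : RingHom.ker (Ideal.Quotient.liftₐ 𝔭 (aeval a : MvPolynomial σ K →ₐ[K] K) ha) =
      (RingHom.ker (aeval a : MvPolynomial σ K →ₐ[K] K)).map (Ideal.Quotient.mk 𝔭) :=
    Ideal.ker_quotient_lift (aeval a : MvPolynomial σ K →ₐ[K] K).toRingHom ha
  rw [this, Ideal.comap_map_map_quotientMap]
  rfl

theorem eventually_genericFilter_of_quotient {𝔭 : Ideal (MvPolynomial σ K)} [𝔭.IsPrime]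
    {p : (σ → K) → Prop} {f : MvPolynomial σ K ⧸ 𝔭} (hf : f ≠ 0)
    (h : ∀ a, ∀ ha : 𝔭 ≤ RingHom.ker (aeval a : MvPolynomial σ K →ₐ[K] K),
      Ideal.Quotient.liftₐ 𝔭 (aeval a : MvPolynomial σ K →ₐ[K] K) ha f ≠ 0 → p a) :
    ∀ᶠ a in genericFilter 𝔭, p a := by
  obtain ⟨f, rfl⟩ := Ideal.Quotient.mk_surjective f
  exact eventually_genericFilter.mpr
    ⟨f, fun hf' => hf (Ideal.Quotient.eq_zero_iff_mem.mpr hf'), fun a ha hfa => h a ha hfa⟩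

theorem isScalarTower_quotientMap_rename {𝔭 : Ideal (MvPolynomial σ K)}
    {P : Ideal (MvPolynomial (σ ⊕ τ) K)}
    (h : 𝔭 ≤ P.comap (rename Sum.inl : MvPolynomial σ K →ₐ[K] MvPolynomial (σ ⊕ τ) K).toRingHom) :
    let _ : Algebra (MvPolynomial σ K ⧸ 𝔭) (MvPolynomial (σ ⊕ τ) K ⧸ P) :=
      (Ideal.quotientMap P _ h).toAlgebra
    IsScalarTower K (MvPolynomial σ K ⧸ 𝔭) (MvPolynomial (σ ⊕ τ) K ⧸ P) := by
  intro _
  refine IsScalarTower.of_algebraMap_eq (R := K) (S := MvPolynomial σ K ⧸ 𝔭)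
    (A := MvPolynomial (σ ⊕ τ) K ⧸ P) fun c => ?_
  change Ideal.Quotient.mk P (C c) = Ideal.Quotient.mk P (rename Sum.inl (C c))
  rw [rename_C]

theorem eventually_notMem_of_mem_minimalPrimes_sup_fiberIdeal [Finite σ] [Finite τ]
    {𝔭 : Ideal (MvPolynomial σ K)} [𝔭.IsPrime]
    {P : Ideal (MvPolynomial (σ ⊕ τ) K)} [P.IsPrime]
    (h : 𝔭 ≤ P.comap (rename Sum.inl : MvPolynomial σ K →ₐ[K] MvPolynomial (σ ⊕ τ) K).toRingHom)
    {g : MvPolynomial (σ ⊕ τ) K} (hg : g ∉ P) :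
    ∀ᶠ a in genericFilter 𝔭, ∀ q ∈ (P ⊔ fiberIdeal τ a).minimalPrimes, g ∉ q := by
  algebraize [Ideal.quotientMap P _ h]
  have hfin : Algebra.FiniteType (MvPolynomial σ K ⧸ 𝔭) (MvPolynomial (σ ⊕ τ) K ⧸ P) := by
    have : IsScalarTower K (MvPolynomial σ K ⧸ 𝔭) (MvPolynomial (σ ⊕ τ) K ⧸ P) :=
      isScalarTower_quotientMap_rename h
    exact .of_restrictScalars_finiteType K _ _
  have hg' : Ideal.Quotient.mk P g ≠ 0 := fun h0 => hg (Ideal.Quotient.eq_zero_iff_mem.mp h0)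
  obtain ⟨f, hf, hI⟩ := exists_forall_notMem_of_mem_minimalPrimes_map
    (A := MvPolynomial σ K ⧸ 𝔭) hg'
  refine eventually_genericFilter_of_quotient hf fun a ha hfa q hq hgq => ?_
  rw [minimalPrimes_sup_fiberIdeal h ha] at hq
  obtain ⟨q, hq, rfl⟩ := hq
  refine hI _ (RingHom.ker_isMaximal_of_surjective _ ?_) hfa q hq hgq
  exact fun c => ⟨algebraMap _ _ c, by simp⟩

theorem eventually_finite_minimalPrimes_sup_fiberIdeal [IsAlgClosed K] {n : ℕ}
    {𝔭 : Ideal (MvPolynomial σ K)} [𝔭.IsPrime]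
    {P : Ideal (MvPolynomial (σ ⊕ Fin n) K)} [P.IsPrime]
    (h : 𝔭 ≤ P.comap
      (rename Sum.inl : MvPolynomial σ K →ₐ[K] MvPolynomial (σ ⊕ Fin n) K).toRingHom) :
    ∃ N D : ℕ, ∀ᶠ a in genericFilter 𝔭,
      (P ⊔ fiberIdeal (Fin n) a).minimalPrimes.Finite ∧
      (P ⊔ fiberIdeal (Fin n) a).minimalPrimes.ncard ≤ N ∧
      ∀ q ∈ (P ⊔ fiberIdeal (Fin n) a).minimalPrimes,
        ∀ q' ∈ (P ⊔ fiberIdeal (Fin n) a).minimalPrimes, q ≠ q' →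
          ∃ p : MvPolynomial (Fin n) K, p.totalDegree ≤ D ∧
            rename Sum.inr p ∈ q ∧ rename Sum.inr p ∉ q' := by
  algebraize [Ideal.quotientMap P _ h]
  have halg (x : MvPolynomial σ K ⧸ 𝔭) :
      algebraMap (MvPolynomial σ K ⧸ 𝔭) (MvPolynomial (σ ⊕ Fin n) K ⧸ P) x =
        Ideal.quotientMap P _ h x := rfl
  have hst : IsScalarTower K (MvPolynomial σ K ⧸ 𝔭) (MvPolynomial (σ ⊕ Fin n) K ⧸ P) :=
    isScalarTower_quotientMap_rename h
  by_cases hinj : Function.Injective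
      (algebraMap (MvPolynomial σ K ⧸ 𝔭) (MvPolynomial (σ ⊕ Fin n) K ⧸ P))
  · let x : Fin n → MvPolynomial (σ ⊕ Fin n) K ⧸ P :=
      fun j => Ideal.Quotient.mk P (X (Sum.inr j))
    have hx : Algebra.adjoin (MvPolynomial σ K ⧸ 𝔭) (Set.range x) = ⊤ := by
      rw [eq_top_iff]
      rintro b -
      obtain ⟨p, rfl⟩ := Ideal.Quotient.mk_surjective b
      induction p using MvPolynomial.induction_on with
      | C c =>
        have : Ideal.Quotient.mk P (C c) = algebraMap (MvPolynomial σ K ⧸ 𝔭) _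
            (Ideal.Quotient.mk 𝔭 (C c)) := by
          rw [halg, Ideal.quotientMap_mk]
          exact congrArg _ (rename_C _ _).symm
        rw [this]
        exact Subalgebra.algebraMap_mem _ _
      | add p q hp hq => rw [map_add]; exact add_mem hp hq
      | mul_X p i hp =>
        rw [map_mul]
        refine mul_mem hp ?_
        cases i with
        | inl i =>
          have : Ideal.Quotient.mk P (X (Sum.inl i)) = algebraMap (MvPolynomial σ K ⧸ 𝔭) _
              (Ideal.Quotient.mk 𝔭 (X i)) := by
            rw [halg, Ideal.quotientMap_mk]
            exact congrArg _ (rename_X _ _).symm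
          rw [this]
          exact Subalgebra.algebraMap_mem _ _
        | inr j => exact Algebra.subset_adjoin ⟨j, rfl⟩
    obtain ⟨N, D, f, hf, hN⟩ := exists_bound_and_separating (K := K) hx hinj
    have hae (p : MvPolynomial (Fin n) K) :
        aeval x p = Ideal.Quotient.mk P (rename Sum.inr p) := by
      have : (aeval x : MvPolynomial (Fin n) K →ₐ[K] _) =
          (Ideal.Quotient.mkₐ K P).comp (rename Sum.inr) := by
        ext j
        simp [x]
      exact DFunLike.congr_fun this p
    refine ⟨N, D, eventually_genericFilter_of_quotient hf fun a ha hfa => ?_⟩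
    obtain ⟨h1, h2, h3⟩ := hN _ hfa
    rw [minimalPrimes_sup_fiberIdeal h ha]
    refine ⟨h1.image _, (Set.ncard_image_le h1).trans h2, ?_⟩
    rintro _ ⟨q, hq, rfl⟩ _ ⟨q', hq', rfl⟩ hne
    obtain ⟨p, hp, hpq, hpq'⟩ := h3 q hq q' hq' (fun hqq => hne (by rw [hqq]))
    exact ⟨p, hp, by rwa [Ideal.mem_comap, ← hae], by rwa [Ideal.mem_comap, ← hae]⟩
  · obtain ⟨f, hf, hf0⟩ : ∃ f : MvPolynomial σ K ⧸ 𝔭, f ≠ 0 ∧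
        algebraMap _ (MvPolynomial (σ ⊕ Fin n) K ⧸ P) f = 0 := by
      rw [injective_iff_map_eq_zero] at hinj
      push Not at hinj
      obtain ⟨f, h1, h2⟩ := hinj
      exact ⟨f, h2, h1⟩
    refine ⟨0, 0, eventually_genericFilter_of_quotient hf fun a ha hfa => ?_⟩
    have htop : P ⊔ fiberIdeal (Fin n) a = ⊤ := by
      obtain ⟨f, rfl⟩ := Ideal.Quotient.mk_surjective f
      have hfP : rename Sum.inl f ∈ P := Ideal.Quotient.eq_zero_iff_mem.mp hf0
      have hfa' : aeval a f ≠ 0 := hfa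
      have hfM : rename Sum.inl (f - C (aeval a f)) ∈ fiberIdeal (Fin n) a :=
        Ideal.mem_map_of_mem _ (by simp [RingHom.mem_ker])
      refine Ideal.eq_top_of_isUnit_mem _ (x := rename Sum.inl f - rename Sum.inl (f - C (aeval a f)))
        (Ideal.sub_mem _ (Ideal.mem_sup_left hfP) (Ideal.mem_sup_right hfM)) ?_
      simp only [map_sub, sub_sub_cancel, rename_C]
      exact hfa'.isUnit.map C
    rw [htop, Ideal.minimalPrimes_top]
    simp
end MvPolynomial

open MvPolynomial in
theorem isTopologicalBasis_zariskiTopology (K : Type*) [Field K] (σ : Type*) :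
    @TopologicalSpace.IsTopologicalBasis _ (zariskiTopology K σ)
      {U | ∃ f : MvPolynomial σ K, U = {x | eval x f ≠ 0}} := by
  let _ := zariskiTopology K σ
  refine ⟨?_, ?_, rfl⟩
  · rintro _ ⟨f, rfl⟩ _ ⟨g, rfl⟩ x ⟨hf, hg⟩
    refine ⟨_, ⟨f * g, rfl⟩, ?_, ?_⟩
    · simpa using ⟨hf, hg⟩
    · intro y hy
      simpa using hy
  · exact Set.eq_univ_of_forall fun x => ⟨Set.univ, ⟨1, by simp⟩, Set.mem_univ x⟩

namespace zariskiTopology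
open MvPolynomial

variable {K σ : Type*} [Field K]

theorem mem_closure_iff {T : Set (σ → K)} {x : σ → K} :
    x ∈ @closure _ (zariskiTopology K σ) T ↔
      ∀ f : MvPolynomial σ K, (∀ y ∈ T, eval y f = 0) → eval x f = 0 := by
  let _ := zariskiTopology K σ
  rw [(isTopologicalBasis_zariskiTopology K σ).mem_closure_iff]
  constructor
  · intro h f hf
    by_contra hx
    obtain ⟨y, hy, hyT⟩ := h _ ⟨f, rfl⟩ hx
    exact hy (hf y hyT)
  · rintro h _ ⟨f, rfl⟩ hx
    by_contra hne
    refine hx (h f fun y hy => ?_)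
    by_contra hyf
    exact hne ⟨y, hyf, hy⟩

theorem isClosed_zeroLocus (I : Ideal (MvPolynomial σ K)) :
    @IsClosed _ (zariskiTopology K σ) (zeroLocus K I) := by
  let _ := zariskiTopology K σ
  refine isClosed_of_closure_subset fun x hx p hp => ?_
  rw [aeval_eq_eval]
  exact mem_closure_iff.mp hx p fun y hy => by simpa [aeval_eq_eval] using hy p hp

theorem isClosed_iff {C : Set (σ → K)} :
    @IsClosed _ (zariskiTopology K σ) C ↔
      ∃ I : Ideal (MvPolynomial σ K), C = zeroLocus K I := by
  let _ := zariskiTopology K σ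
  refine ⟨fun h => ⟨vanishingIdeal K C, ?_⟩, ?_⟩
  · refine (zeroLocus_vanishingIdeal_le C).antisymm fun x hx => ?_
    rw [← h.closure_eq]
    exact mem_closure_iff.mpr fun f hf => by
      simpa [aeval_eq_eval] using hx f (fun y hy => by simpa [aeval_eq_eval] using hf y hy)
  · rintro ⟨I, rfl⟩
    exact isClosed_zeroLocus I

theorem isIrreducible_iff {T : Set (σ → K)} :
    @IsIrreducible _ (zariskiTopology K σ) T ↔ T.Nonempty ∧ ∀ f g : MvPolynomial σ K,
      (∀ x ∈ T, eval x (f * g) = 0) → (∀ x ∈ T, eval x f = 0) ∨ ∀ x ∈ T, eval x g = 0 := by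
  let _ := zariskiTopology K σ
  refine and_congr_right fun _ => ⟨fun h f g hfg => ?_, fun h => ?_⟩
  · have ho (f : MvPolynomial σ K) : IsOpen {x | eval x f ≠ 0} :=
      (isTopologicalBasis_zariskiTopology K σ).isOpen ⟨f, rfl⟩
    by_contra! hne
    obtain ⟨⟨x, hx, hxf⟩, y, hy, hyg⟩ := hne
    obtain ⟨z, hz, hzf, hzg⟩ := h _ _ (ho f) (ho g) ⟨x, hx, hxf⟩ ⟨y, hy, hyg⟩
    have := hfg z hz
    rw [map_mul] at this
    exact (mul_eq_zero.mp this).elim hzf hzg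
  · rintro U V hU hV ⟨x, hx, hxU⟩ ⟨y, hy, hyV⟩
    obtain ⟨_, ⟨f, rfl⟩, hxf, hfU⟩ :=
      (isTopologicalBasis_zariskiTopology K σ).exists_subset_of_mem_open hxU hU
    obtain ⟨_, ⟨g, rfl⟩, hyg, hgV⟩ :=
      (isTopologicalBasis_zariskiTopology K σ).exists_subset_of_mem_open hyV hV
    by_contra hne
    refine (h f g fun z hz => ?_).elim (fun h0 => hxf (h0 x hx)) fun h0 => hyg (h0 y hy)
    by_contra hzfg
    rw [map_mul] at hzfg
    exact hne ⟨z, hz, hfU (left_ne_zero_of_mul hzfg), hgV (right_ne_zero_of_mul hzfg)⟩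

end zariskiTopology

/-- The Zariski closure of `T` is the union of at most `N` closed irreducible sets which are
pairwise separated by polynomials of total degree at most `D`. -/
def HasSeparatedComponents {K σ : Type*} [Field K] (N D : ℕ) (T : Set (σ → K)) : Prop :=
  ∃ 𝒲 : Set (Set (σ → K)), 𝒲.Finite ∧ 𝒲.ncard ≤ N ∧
    (∀ W ∈ 𝒲, @IsClosed _ (zariskiTopology K σ) W ∧ @IsIrreducible _ (zariskiTopology K σ) W) ∧
    @closure _ (zariskiTopology K σ) T = ⋃₀ 𝒲 ∧
    ∀ W ∈ 𝒲, ∀ W' ∈ 𝒲, W ≠ W' → ∃ p : MvPolynomial σ K, p.totalDegree ≤ D ∧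
      (∀ x ∈ W, MvPolynomial.eval x p = 0) ∧ ∃ x ∈ W', MvPolynomial.eval x p ≠ 0

namespace HasSeparatedComponents
open MvPolynomial

variable {K σ : Type*} [Field K] {N D N' D' : ℕ} {T : Set (σ → K)}

theorem mono (h : HasSeparatedComponents N D T) (hN : N ≤ N') (hD : D ≤ D') :
    HasSeparatedComponents N' D' T := by
  obtain ⟨𝒲, h1, h2, h3, h4, h5⟩ := h
  refine ⟨𝒲, h1, h2.trans hN, h3, h4, fun W hW W' hW' hne => ?_⟩
  obtain ⟨p, hp, hp'⟩ := h5 W hW W' hW' hne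
  exact ⟨p, hp.trans hD, hp'⟩

theorem exists_irredComps_eq (h : HasSeparatedComponents N D T) :
    ∃ 𝒲 : Set (Set (σ → K)),
      irredComps (zariskiTopology K σ) (@closure _ (zariskiTopology K σ) T) = 𝒲 ∧
      𝒲.Finite ∧ 𝒲.ncard ≤ N ∧ (∀ W ∈ 𝒲, @IsIrreducible _ (zariskiTopology K σ) W) ∧
      @closure _ (zariskiTopology K σ) T = ⋃₀ 𝒲 ∧
      ∀ W ∈ 𝒲, ∀ W' ∈ 𝒲, W ≠ W' → ∃ p : MvPolynomial σ K, p.totalDegree ≤ D ∧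
        (∀ x ∈ W, eval x p = 0) ∧ ∃ x ∈ W', eval x p ≠ 0 := by
  let _ := zariskiTopology K σ
  obtain ⟨𝒲, hfin, hcard, hirr, hcl, hsep⟩ := h
  refine ⟨𝒲, ?_, hfin, hcard, fun W hW => (hirr W hW).2, hcl, hsep⟩
  have hle : ∀ W, W ⊆ closure T → IsIrreducible W → ∃ W' ∈ 𝒲, W ⊆ W' := by
    intro W hW hWi
    rw [hcl] at hW
    obtain ⟨W', hW', hWW'⟩ := (isIrreducible_iff_sUnion_isClosed.mp hWi) hfin.toFinset
      (fun Z hZ => (hirr Z (hfin.mem_toFinset.mp hZ)).1) (by simpa using hW)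
    exact ⟨W', hfin.mem_toFinset.mp hW', hWW'⟩
  have hmem : ∀ W ∈ 𝒲, W ⊆ closure T ∧ IsClosed W ∧ IsIrreducible W := fun W hW =>
    ⟨hcl ▸ Set.subset_sUnion_of_mem hW, hirr W hW⟩
  ext W
  constructor
  · intro hW
    obtain ⟨W', hW', hWW'⟩ := hle W hW.1.1 hW.1.2.2
    rwa [hWW'.antisymm (hW.2 (hmem W' hW') hWW')]
  · intro hW
    refine ⟨hmem W hW, fun Z hZ hWZ => ?_⟩
    obtain ⟨W', hW', hZW'⟩ := hle Z hZ.1 hZ.2.2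
    by_cases hWW' : W = W'
    · rwa [hWW']
    · obtain ⟨p, -, hp, x, hx, hpx⟩ := hsep W' hW' W hW (Ne.symm hWW')
      exact absurd (hp x (hZW' (hWZ hx))) hpx

theorem finite_irredComps (h : HasSeparatedComponents N D T) :
    (irredComps (zariskiTopology K σ) (@closure _ (zariskiTopology K σ) T)).Finite := by
  obtain ⟨𝒲, heq, hfin, -⟩ := h.exists_irredComps_eq
  rwa [heq]

theorem ncard_irredComps_le (h : HasSeparatedComponents N D T) :
    (irredComps (zariskiTopology K σ) (@closure _ (zariskiTopology K σ) T)).ncard ≤ N := by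
  obtain ⟨𝒲, heq, -, hcard, -⟩ := h.exists_irredComps_eq
  rwa [heq]

theorem exists_orthogonal_of_le_ncard_irredComps (h : HasSeparatedComponents N D T) {k : ℕ}
    (hk : k ≤ (irredComps (zariskiTopology K σ) (@closure _ (zariskiTopology K σ) T)).ncard) :
    ∃ g : Fin k → MvPolynomial σ K, (∀ i, (g i).totalDegree ≤ N * D) ∧
      (∀ i, ∃ x ∈ T, eval x (g i) ≠ 0) ∧
      ∀ i j, i ≠ j → ∀ x ∈ T, eval x (g i) * eval x (g j) = 0 := by
  let _ := zariskiTopology K σ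
  obtain ⟨𝒲, heq, hfin, hcard, hirr, hcl, hsep⟩ := h.exists_irredComps_eq
  rw [heq] at hk
  classical
  choose! p hpdeg hp hp' using hsep
  obtain ⟨s, hs, hsc⟩ := Set.exists_subset_card_eq hk
  have hsf := hfin.subset hs
  have : Finite s := hsf
  let e : s ≃ Fin k := Finite.equivFinOfCardEq (by rw [← hsc]; rfl)
  have he (i) : (e.symm i : Set (σ → K)) ∈ 𝒲 := hs (e.symm i).2
  let g : Fin k → MvPolynomial σ K :=
    fun i => ∏ W ∈ hfin.toFinset.erase (e.symm i), p W (e.symm i)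
  have hg0 : ∀ i, ∀ W ∈ 𝒲, W ≠ e.symm i → ∀ x ∈ W, eval x (g i) = 0 := by
    intro i W hW hne x hx
    rw [map_prod]
    exact Finset.prod_eq_zero (i := W) (by simp [hW, hne]) (hp W hW _ (he i) hne x hx)
  refine ⟨g, fun i => ?_, fun i => ?_, fun i j hij x hx => ?_⟩
  · refine (totalDegree_finsetProd _ _).trans ?_
    refine (Finset.sum_le_card_nsmul _ _ D fun W hW => ?_).trans ?_
    · simp only [Finset.mem_erase, Set.Finite.mem_toFinset] at hW
      exact hpdeg W hW.2 _ (he i) hW.1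
    · rw [smul_eq_mul]
      refine Nat.mul_le_mul_right _ ((Finset.card_erase_le).trans ?_)
      rwa [← Set.ncard_eq_toFinset_card 𝒲 hfin]
  · have hne : ¬ ∀ x ∈ (e.symm i : Set (σ → K)), eval x (g i) = 0 := by
      have hi := (zariskiTopology.isIrreducible_iff.mp (hirr _ (he i)))
      have : ∀ t : Finset (Set (σ → K)), t ⊆ hfin.toFinset.erase (e.symm i) →
          ¬ ∀ x ∈ (e.symm i : Set (σ → K)), eval x (∏ W ∈ t, p W (e.symm i)) = 0 := by
        intro t
        induction t using Finset.induction_on with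
        | empty =>
          intro _ h0
          obtain ⟨x, hx⟩ := hi.1
          simpa using h0 x hx
        | insert W t hWt ih =>
          intro ht h0
          rw [Finset.prod_insert hWt] at h0
          rcases hi.2 _ _ h0 with h0 | h0
          · have hW := ht (Finset.mem_insert_self _ _)
            simp only [Finset.mem_erase, Set.Finite.mem_toFinset] at hW
            obtain ⟨x, hx, hx0⟩ := hp' W hW.2 _ (he i) hW.1
            exact hx0 (h0 x hx)
          · exact ih ((Finset.subset_insert _ _).trans ht) h0
      exact this _ subset_rfl
    by_contra! h0
    exact hne fun x hx => zariskiTopology.mem_closure_iff.mp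
      (hcl ▸ Set.mem_sUnion_of_mem hx (he i)) _ h0
  · obtain ⟨W, hW, hxW⟩ : x ∈ ⋃₀ 𝒲 := hcl ▸ subset_closure hx
    by_cases hWi : W = e.symm i
    · rw [hg0 j W hW ?_ x hxW, mul_zero]
      rw [hWi]
      exact fun h => hij (e.symm.injective (Subtype.ext h))
    · rw [hg0 i W hW hWi x hxW, zero_mul]

theorem le_ncard_irredComps_of_orthogonal (h : HasSeparatedComponents N D T) {k : ℕ}
    {g : Fin k → MvPolynomial σ K} (hg : ∀ i, ∃ x ∈ T, eval x (g i) ≠ 0)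
    (hgg : ∀ i j, i ≠ j → ∀ x ∈ T, eval x (g i) * eval x (g j) = 0) :
    k ≤ (irredComps (zariskiTopology K σ) (@closure _ (zariskiTopology K σ) T)).ncard := by
  let _ := zariskiTopology K σ
  obtain ⟨𝒲, heq, hfin, -, hirr, hcl, -⟩ := h.exists_irredComps_eq
  rw [heq]
  choose x hxT hx using hg
  have hxW (i) : ∃ W ∈ 𝒲, x i ∈ W := by
    have : x i ∈ ⋃₀ 𝒲 := hcl ▸ subset_closure (hxT i)
    exact this
  choose W hW hxW using hxW
  have hinj : Function.Injective W := by
    intro i j hij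
    by_contra hne
    have h0 : ∀ y ∈ W i, eval y (g i * g j) = 0 := fun y hy =>
      zariskiTopology.mem_closure_iff.mp (hcl ▸ Set.mem_sUnion_of_mem hy (hW i)) _
        fun z hz => by rw [map_mul]; exact hgg i j hne z hz
    rcases (zariskiTopology.isIrreducible_iff.mp (hirr _ (hW i))).2 _ _ h0 with h0 | h0
    · exact hx i (h0 _ (hxW i))
    · exact hx j (h0 _ (hij ▸ hxW j))
  have := Set.ncard_le_ncard (Set.range_subset_iff.mpr hW) hfin
  rwa [Set.ncard_range_of_injective hinj, Nat.card_fin] at this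

end HasSeparatedComponents

namespace MvPolynomial

open Filter

variable {σ τ K : Type*} [Field K]

theorem eventually_mem_zeroLocus (𝔭 : Ideal (MvPolynomial σ K)) [𝔭.IsPrime] :
    ∀ᶠ a in genericFilter 𝔭, a ∈ zeroLocus K 𝔭 :=
  eventually_genericFilter.mpr ⟨1, (Ideal.ne_top_iff_one 𝔭).mp (Ideal.IsPrime.ne_top inferInstance),
    fun _ ha _ => ha⟩

/-- Specialization of the left variables of a polynomial at a point. -/
noncomputable def evalLeft (a : σ → K) : MvPolynomial (σ ⊕ τ) K →ₐ[K] MvPolynomial τ K :=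
  aeval (Sum.elim (C ∘ a) X)

theorem eval_evalLeft (a : σ → K) (x : τ → K) (p : MvPolynomial (σ ⊕ τ) K) :
    eval x (evalLeft a p) = eval (Sum.elim a x) p := by
  have : (aeval x : MvPolynomial τ K →ₐ[K] K).comp (evalLeft a) = aeval (Sum.elim a x) := by
    ext i
    cases i <;> simp [evalLeft]
  simpa [aeval_eq_eval] using DFunLike.congr_fun this p

theorem totalDegree_evalLeft_le (a : σ → K) (p : MvPolynomial (σ ⊕ τ) K) :
    (evalLeft a p).totalDegree ≤ p.totalDegree :=
  totalDegree_aeval_le_of_forall_le_one p _ fun i => by cases i <;> simp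

/-- The fiber over `a` of the zero locus of `q`. -/
def fiberLocus (a : σ → K) (q : Ideal (MvPolynomial (σ ⊕ τ) K)) : Set (τ → K) :=
  {x | Sum.elim a x ∈ zeroLocus K q}

theorem eval_sumElim_rename_inr (a : σ → K) (x : τ → K) (f : MvPolynomial τ K) :
    eval (Sum.elim a x) (rename Sum.inr f) = eval x f := by
  rw [eval_rename, Sum.elim_comp_inr]

section fiberLocus

variable {a : σ → K} {q : Ideal (MvPolynomial (σ ⊕ τ) K)}

theorem isClosed_fiberLocus (a : σ → K) (q : Ideal (MvPolynomial (σ ⊕ τ) K)) :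
    @IsClosed _ (zariskiTopology K τ) (fiberLocus a q) := by
  let _ := zariskiTopology K τ
  refine isClosed_of_closure_subset fun x hx p hp => ?_
  rw [aeval_eq_eval, ← eval_evalLeft]
  refine zariskiTopology.mem_closure_iff.mp hx _ fun y hy => ?_
  rw [eval_evalLeft]
  simpa [aeval_eq_eval] using hy p hp

theorem forall_mem_fiberLocus_iff [IsAlgClosed K] [Finite σ] [Finite τ] [q.IsPrime]
    (hq : fiberIdeal τ a ≤ q) {f : MvPolynomial (σ ⊕ τ) K} :
    (∀ x ∈ fiberLocus a q, eval (Sum.elim a x) f = 0) ↔ f ∈ q := by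
  constructor
  · intro h
    rw [← IsPrime.vanishingIdeal_zeroLocus (K := K) q]
    intro z hz
    have hza : z ∘ Sum.inl = a := by
      have := zeroLocus_anti_mono hq hz
      rwa [zeroLocus_fiberIdeal] at this
    have hz' : z = Sum.elim a (z ∘ Sum.inr) := by
      rw [← hza, Sum.elim_comp_inl_inr]
    rw [hz'] at hz ⊢
    simpa [aeval_eq_eval] using h _ hz
  · intro hf x hx
    simpa [aeval_eq_eval] using hx f hf

theorem forall_mem_fiberLocus_iff_rename [IsAlgClosed K] [Finite σ] [Finite τ] [q.IsPrime]
    (hq : fiberIdeal τ a ≤ q) {f : MvPolynomial τ K} :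
    (∀ x ∈ fiberLocus a q, eval x f = 0) ↔ rename Sum.inr f ∈ q := by
  rw [← forall_mem_fiberLocus_iff hq]
  simp_rw [eval_sumElim_rename_inr]

theorem isIrreducible_fiberLocus [IsAlgClosed K] [Finite σ] [Finite τ] [hp : q.IsPrime]
    (hq : fiberIdeal τ a ≤ q) :
    @IsIrreducible _ (zariskiTopology K τ) (fiberLocus a q) := by
  rw [zariskiTopology.isIrreducible_iff]
  constructor
  · by_contra hne
    rw [Set.not_nonempty_iff_eq_empty] at hne
    refine hp.ne_top ((Ideal.eq_top_iff_one q).mpr ((forall_mem_fiberLocus_iff hq).mp ?_))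
    simp [hne]
  · intro f g hfg
    rw [forall_mem_fiberLocus_iff_rename hq, map_mul] at hfg
    rw [forall_mem_fiberLocus_iff_rename hq, forall_mem_fiberLocus_iff_rename hq]
    exact hp.mem_or_mem hfg

end fiberLocus

theorem closure_eq_iUnion_fiberLocus [IsAlgClosed K] [Finite σ] [Finite τ] {ι : Type*}
    {I J : ι → Ideal (MvPolynomial (σ ⊕ τ) K)} {𝔭 : Ideal (MvPolynomial σ K)}
    {L : Set (Ideal (MvPolynomial (σ ⊕ τ) K))} (hL : L.Finite)
    {a : σ → K} (ha : a ∈ zeroLocus K 𝔭)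
    (hIJ : ∀ Q : Ideal (MvPolynomial (σ ⊕ τ) K), ∀ i,
      Q ∈ (I i ⊔ 𝔭.map (rename Sum.inl : MvPolynomial σ K →ₐ[K] _)).minimalPrimes → ¬ J i ≤ Q →
        ∃ P ∈ L, P ≤ Q)
    (hfin : ∀ P ∈ L, (P ⊔ fiberIdeal τ a).minimalPrimes.Finite)
    (hgen : ∀ P ∈ L, ∃ i, I i ≤ P ∧ ∃ g ∈ J i, ∀ q ∈ (P ⊔ fiberIdeal τ a).minimalPrimes, g ∉ q) :
    @closure _ (zariskiTopology K τ)
      {x | ∃ i, Sum.elim a x ∈ zeroLocus K (I i) ∧ Sum.elim a x ∉ zeroLocus K (J i)} =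
      ⋃ P ∈ L, ⋃ q ∈ (P ⊔ fiberIdeal τ a).minimalPrimes, fiberLocus a q := by
  let _ := zariskiTopology K τ
  refine subset_antisymm (closure_minimal ?_ ?_) ?_
  · rintro x ⟨i, hxI, hxJ⟩
    let m : Ideal (MvPolynomial (σ ⊕ τ) K) := RingHom.ker (aeval (Sum.elim a x) : _ →ₐ[K] K)
    have hm : m.IsPrime := RingHom.ker_isPrime _
    have hpm : I i ⊔ 𝔭.map (rename Sum.inl : MvPolynomial σ K →ₐ[K] _) ≤ m := by
      refine sup_le (fun p hp => hxI p hp) (Ideal.map_le_iff_le_comap.mpr fun p hp => ?_)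
      rw [Ideal.mem_comap, RingHom.mem_ker, aeval_rename, Sum.elim_comp_inl]
      exact ha p hp
    obtain ⟨Q, hQ, hQm⟩ := Ideal.exists_minimalPrimes_le hpm
    obtain ⟨P, hP, hPQ⟩ := hIJ Q i hQ fun hJ => hxJ fun p hp => hQm (hJ hp)
    have hPm : P ⊔ fiberIdeal τ a ≤ m := by
      refine sup_le (hPQ.trans hQm) (fun p hp => ?_)
      have : Sum.elim a x ∈ zeroLocus K (fiberIdeal τ a) := by
        rw [zeroLocus_fiberIdeal]
        exact Sum.elim_comp_inl _ _
      exact this p hp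
    obtain ⟨q, hq, hqm⟩ := Ideal.exists_minimalPrimes_le hPm
    simp only [Set.mem_iUnion]
    exact ⟨P, hP, q, hq, fun p hp => hqm hp⟩
  · exact hL.isClosed_biUnion fun P hP => (hfin P hP).isClosed_biUnion fun q _ =>
      isClosed_fiberLocus a q
  · refine Set.iUnion₂_subset fun P hP => Set.iUnion₂_subset fun q hq x hx => ?_
    have hqp : q.IsPrime := hq.1.1
    have hPq : P ≤ q := le_sup_left.trans hq.1.2
    have hMq : fiberIdeal τ a ≤ q := le_sup_right.trans hq.1.2
    obtain ⟨i, hi, g, hgJ, hg⟩ := hgen P hP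
    refine zariskiTopology.mem_closure_iff.mpr fun f hf => ?_
    refine (forall_mem_fiberLocus_iff_rename hMq).mpr ?_ x hx
    refine (hqp.mem_or_mem (y := g) ?_).resolve_right (hg q hq)
    rw [← forall_mem_fiberLocus_iff hMq]
    intro y hy
    rw [map_mul, eval_sumElim_rename_inr]
    by_cases hgy : eval (Sum.elim a y) g = 0
    · rw [hgy, mul_zero]
    · rw [hf y ⟨i, zeroLocus_anti_mono (hi.trans hPq) hy, fun h => hgy ?_⟩, zero_mul]
      simpa [aeval_eq_eval] using h g hgJ

theorem eventually_hasSeparatedComponents [IsAlgClosed K] [Finite σ] {n : ℕ} {ι : Type*} [Finite ι]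
    (I J : ι → Ideal (MvPolynomial (σ ⊕ Fin n) K)) (𝔭 : Ideal (MvPolynomial σ K)) [𝔭.IsPrime] :
    ∃ N D : ℕ, ∀ᶠ a in genericFilter 𝔭, HasSeparatedComponents N D
      {x | ∃ i, Sum.elim a x ∈ zeroLocus K (I i) ∧ Sum.elim a x ∉ zeroLocus K (J i)} := by
  classical
  let 𝔭' := 𝔭.map (rename Sum.inl : MvPolynomial σ K →ₐ[K] MvPolynomial (σ ⊕ Fin n) K)
  let pre : Set (Ideal (MvPolynomial (σ ⊕ Fin n) K)) :=
    ⋃ i, {P | P ∈ (I i ⊔ 𝔭').minimalPrimes ∧ ¬ J i ≤ P}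
  have hpre : pre.Finite := Set.finite_iUnion fun i =>
    (Ideal.finite_minimalPrimes_of_isNoetherianRing _ _).subset fun P hP => hP.1
  let L : Set (Ideal (MvPolynomial (σ ⊕ Fin n) K)) := {P | Minimal (· ∈ pre) P}
  have hL : L.Finite := hpre.subset fun P hP => hP.1
  have hLp : ∀ P ∈ L, 
      ∃ g ∉ P, ∃ i, P ∈ (I i ⊔ 𝔭').minimalPrimes ∧ g ∈ J i := fun P hP => by
    obtain ⟨i, hi, hJ⟩ := Set.mem_iUnion.mp hP.1
    obtain ⟨g, hg, hgP⟩ := SetLike.not_le_iff_exists.mp hJ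
    exact ⟨g, hgP, i, hi, hg⟩
  choose! g hgP hi using hLp
  have hprime : ∀ P ∈ L, P.IsPrime := fun P hP => (hi P hP).choose_spec.1.1.1
  have hcomap : ∀ P ∈ L, 𝔭 ≤ P.comap
      (rename Sum.inl : MvPolynomial σ K →ₐ[K] MvPolynomial (σ ⊕ Fin n) K).toRingHom :=
    fun P hP => Ideal.map_le_iff_le_comap.mp (le_sup_right.trans (hi P hP).choose_spec.1.1.2)
  have hgen : ∀ P ∈ L, ∃ N D : ℕ, ∀ᶠ a in genericFilter 𝔭,
      (P ⊔ fiberIdeal (Fin n) a).minimalPrimes.Finite ∧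
      (P ⊔ fiberIdeal (Fin n) a).minimalPrimes.ncard ≤ N ∧
      ∀ q ∈ (P ⊔ fiberIdeal (Fin n) a).minimalPrimes,
        ∀ q' ∈ (P ⊔ fiberIdeal (Fin n) a).minimalPrimes, q ≠ q' →
          ∃ p : MvPolynomial (Fin n) K, p.totalDegree ≤ D ∧
            rename Sum.inr p ∈ q ∧ rename Sum.inr p ∉ q' := fun P hP => by
    have := hprime P hP
    exact eventually_finite_minimalPrimes_sup_fiberIdeal (hcomap P hP)
  choose! N D hND using hgen
  have hh : ∀ P ∈ L, ∀ P' ∈ L, P ≠ P' → ∃ h ∈ P, h ∉ P' := fun P hP P' hP' hne =>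
    SetLike.not_le_iff_exists.mp fun hle => hne (hle.antisymm (hP'.2 hP.1 hle))
  choose! h hhP hhP' using hh
  refine ⟨∑ P ∈ hL.toFinset, N P, (hL.toFinset.sup D) ⊔
    (hL.toFinset.sup fun P => hL.toFinset.sup fun P' => (h P P').totalDegree), ?_⟩
  have ev2 : ∀ P ∈ L, ∀ᶠ a in genericFilter 𝔭,
      ∀ q ∈ (P ⊔ fiberIdeal (Fin n) a).minimalPrimes, g P ∉ q := fun P hP => by
    have := hprime P hP
    exact eventually_notMem_of_mem_minimalPrimes_sup_fiberIdeal (hcomap P hP) (hgP P hP)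
  have ev3 : ∀ P ∈ L, ∀ P' ∈ L, ∀ᶠ a in genericFilter 𝔭, P ≠ P' →
      ∀ q ∈ (P' ⊔ fiberIdeal (Fin n) a).minimalPrimes, h P P' ∉ q := fun P hP P' hP' => by
    have := hprime P' hP'
    by_cases hne : P = P'
    · simp [hne]
    · filter_upwards [eventually_notMem_of_mem_minimalPrimes_sup_fiberIdeal (hcomap P' hP')
        (hhP' P hP P' hP' hne)] with a ha _ using ha
  filter_upwards [eventually_mem_zeroLocus 𝔭, (hL.eventually_all).mpr hND,
    (hL.eventually_all).mpr ev2,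
    (hL.eventually_all).mpr fun P hP => (hL.eventually_all).mpr (ev3 P hP)] with a ha h1 h2 h3
  have hcl := closure_eq_iUnion_fiberLocus (I := I) (J := J) hL ha
    (fun Q i hQ hJQ => by
      obtain ⟨P, hPQ, hP⟩ := hpre.exists_le_minimal (Set.mem_iUnion.mpr ⟨i, hQ, hJQ⟩)
      exact ⟨P, hP, hPQ⟩)
    (fun P hP => (h1 P hP).1)
    (fun P hP => by
      obtain ⟨i, hi, hg⟩ := hi P hP
      exact ⟨i, le_sup_left.trans hi.1.2, g P, hg, h2 P hP⟩)
  refine ⟨⋃ P ∈ L, fiberLocus a '' (P ⊔ fiberIdeal (Fin n) a).minimalPrimes, ?_, ?_, ?_, ?_, ?_⟩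
  · exact hL.biUnion fun P hP => (h1 P hP).1.image _
  · have : (⋃ P ∈ L, fiberLocus a '' (P ⊔ fiberIdeal (Fin n) a).minimalPrimes) =
        ⋃ P ∈ hL.toFinset, fiberLocus a '' (P ⊔ fiberIdeal (Fin n) a).minimalPrimes := by simp
    rw [this]
    refine (Finset.set_ncard_biUnion_le _ _).trans (Finset.sum_le_sum fun P hP => ?_)
    rw [Set.Finite.mem_toFinset] at hP
    exact (Set.ncard_image_le (h1 P hP).1).trans (h1 P hP).2.1
  · intro W hW
    simp only [Set.mem_iUnion] at hW
    obtain ⟨P, hP, q, hq, rfl⟩ := hW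
    have hqp : q.IsPrime := hq.1.1
    exact ⟨isClosed_fiberLocus a q, isIrreducible_fiberLocus (le_sup_right.trans hq.1.2)⟩
  · rw [hcl]
    simp only [Set.sUnion_iUnion, Set.sUnion_image]
  · intro W hW W' hW' hne
    simp only [Set.mem_iUnion] at hW hW'
    obtain ⟨P, hP, q, hq, rfl⟩ := hW
    obtain ⟨P', hP', q', hq', rfl⟩ := hW'
    have hqp : q.IsPrime := hq.1.1
    have hqp' : q'.IsPrime := hq'.1.1
    have hMq : fiberIdeal (Fin n) a ≤ q := le_sup_right.trans hq.1.2
    have hMq' : fiberIdeal (Fin n) a ≤ q' := le_sup_right.trans hq'.1.2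
    by_cases hPP' : P = P'
    · subst hPP'
      obtain ⟨p, hp, hpq, hpq'⟩ := (h1 P hP).2.2 q hq q' hq' fun h => hne (by rw [h])
      refine ⟨p, hp.trans (le_sup_of_le_left (Finset.le_sup (f := D) (by simpa using hP))),
        (forall_mem_fiberLocus_iff_rename hMq).mpr hpq, ?_⟩
      by_contra! h0
      exact hpq' ((forall_mem_fiberLocus_iff_rename hMq').mp h0)
    · refine ⟨evalLeft a (h P P'), (totalDegree_evalLeft_le _ _).trans (le_sup_of_le_right ?_),
        fun x hx => ?_, ?_⟩
      · exact (Finset.le_sup (f := fun P' => (h P P').totalDegree) (by simpa using hP')).trans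
          (Finset.le_sup (f := fun P => hL.toFinset.sup fun P' => (h P P').totalDegree)
            (by simpa using hP))
      · rw [eval_evalLeft]
        exact (forall_mem_fiberLocus_iff hMq).mpr
          (le_sup_left.trans hq.1.2 (hhP P hP P' hP' hPP')) x hx
      · by_contra! h0
        refine h3 P hP P' hP' hPP' q' hq' ((forall_mem_fiberLocus_iff hMq').mp fun x hx => ?_)
        rw [← eval_evalLeft]
        exact h0 x hx

theorem exists_hasSeparatedComponents [IsAlgClosed K] [Finite σ] {n : ℕ} {ι : Type*} [Finite ι]
    (I J : ι → Ideal (MvPolynomial (σ ⊕ Fin n) K)) :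
    ∃ N D : ℕ, ∀ a : σ → K, HasSeparatedComponents N D
      {x | ∃ i, Sum.elim a x ∈ zeroLocus K (I i) ∧ Sum.elim a x ∉ zeroLocus K (J i)} := by
  suffices H : ∀ 𝔞 : Ideal (MvPolynomial σ K), ∃ N D : ℕ, ∀ a ∈ zeroLocus K 𝔞,
      HasSeparatedComponents N D
        {x | ∃ i, Sum.elim a x ∈ zeroLocus K (I i) ∧ Sum.elim a x ∉ zeroLocus K (J i)} by
    obtain ⟨N, D, h⟩ := H ⊥
    exact ⟨N, D, fun a => h a (by simp)⟩
  intro 𝔞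
  induction 𝔞 using WellFoundedGT.induction with
  | _ 𝔞 ih =>
  have ih' : ∀ f ∉ 𝔞, ∃ N D : ℕ, ∀ a ∈ zeroLocus K 𝔞, aeval a f = 0 →
      HasSeparatedComponents N D
        {x | ∃ i, Sum.elim a x ∈ zeroLocus K (I i) ∧ Sum.elim a x ∉ zeroLocus K (J i)} := by
    intro f hf
    obtain ⟨N, D, h⟩ := ih (𝔞 ⊔ Ideal.span {f}) (left_lt_sup.mpr fun hle =>
      hf (hle (Ideal.mem_span_singleton_self f)))
    refine ⟨N, D, fun a ha haf => h a ?_⟩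
    have : 𝔞 ⊔ Ideal.span {f} ≤ RingHom.ker (aeval a : MvPolynomial σ K →ₐ[K] K) :=
      sup_le ha ((Ideal.span_singleton_le_iff_mem _).mpr haf)
    exact this
  by_cases htop : 𝔞 = ⊤
  · exact ⟨0, 0, fun a ha => by simp [htop] at ha⟩
  by_cases hp : 𝔞.IsPrime
  · obtain ⟨N, D, h⟩ := eventually_hasSeparatedComponents I J 𝔞
    obtain ⟨f, hf, h⟩ := eventually_genericFilter.mp h
    obtain ⟨N', D', h'⟩ := ih' f hf
    refine ⟨max N N', max D D', fun a ha => ?_⟩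
    by_cases haf : aeval a f = 0
    · exact (h' a ha haf).mono (le_max_right _ _) (le_max_right _ _)
    · exact (h a ha haf).mono (le_max_left _ _) (le_max_left _ _)
  · rw [Ideal.isPrime_iff] at hp
    push Not at hp
    obtain ⟨f, g, hfg, hf, hg⟩ := hp htop
    obtain ⟨N, D, h⟩ := ih' f hf
    obtain ⟨N', D', h'⟩ := ih' g hg
    refine ⟨max N N', max D D', fun a ha => ?_⟩
    have := ha _ hfg
    rw [map_mul, mul_eq_zero] at this
    rcases this with haf | hag
    · exact (h a ha haf).mono (le_max_left _ _) (le_max_left _ _)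
    · exact (h' a ha hag).mono (le_max_right _ _) (le_max_right _ _)

end MvPolynomial

namespace MvPolynomial
open Topology

variable {σ τ K : Type*} [Field K]

theorem mem_pointToPoint {x : σ → K} {p : MvPolynomial σ K} :
    p ∈ (pointToPoint (k := K) x).asIdeal ↔ eval x p = 0 := by
  rw [← aeval_eq_eval]
  exact mem_vanishingIdeal_singleton_iff x p

/-- A set of points is constructible if it is the trace of a constructible subset of the
prime spectrum of the polynomial ring. -/
def IsConstructibleTrace (S : Set (σ → K)) : Prop :=
  ∃ T : Set (PrimeSpectrum (MvPolynomial σ K)), IsConstructible T ∧ pointToPoint ⁻¹' T = S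

namespace IsConstructibleTrace

variable {S S' : Set (σ → K)}

theorem inter (hS : IsConstructibleTrace S) (hS' : IsConstructibleTrace S') :
    IsConstructibleTrace (S ∩ S') := by
  obtain ⟨T, hT, rfl⟩ := hS
  obtain ⟨T', hT', rfl⟩ := hS'
  exact ⟨T ∩ T', hT.inter hT', rfl⟩

theorem sdiff (hS : IsConstructibleTrace S) (hS' : IsConstructibleTrace S') :
    IsConstructibleTrace (S \ S') := by
  obtain ⟨T, hT, rfl⟩ := hS
  obtain ⟨T', hT', rfl⟩ := hS'
  exact ⟨T \ T', hT.sdiff hT', rfl⟩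

theorem compl (hS : IsConstructibleTrace S) : IsConstructibleTrace Sᶜ := by
  obtain ⟨T, hT, rfl⟩ := hS
  exact ⟨Tᶜ, isConstructible_compl.mpr hT, rfl⟩

theorem iUnion {ι : Type*} [Finite ι] {S : ι → Set (σ → K)}
    (hS : ∀ i, IsConstructibleTrace (S i)) : IsConstructibleTrace (⋃ i, S i) := by
  choose T hT hTS using hS
  exact ⟨⋃ i, T i, .iUnion hT, by simp [Set.preimage_iUnion, hTS]⟩

theorem iInter {ι : Type*} [Finite ι] {S : ι → Set (σ → K)}
    (hS : ∀ i, IsConstructibleTrace (S i)) : IsConstructibleTrace (⋂ i, S i) := by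
  choose T hT hTS using hS
  exact ⟨⋂ i, T i, .iInter hT, by simp [Set.preimage_iInter, hTS]⟩

theorem zeroLocus [Finite σ] (I : Ideal (MvPolynomial σ K)) :
    IsConstructibleTrace (zeroLocus K I) := by
  refine ⟨PrimeSpectrum.zeroLocus I, ?_, ?_⟩
  · rw [← isConstructible_compl]
    exact (PrimeSpectrum.isRetrocompact_zeroLocus_compl_of_fg
      (IsNoetherian.noetherian I)).isConstructible (PrimeSpectrum.isClosed_zeroLocus _).isOpen_compl
  · ext x
    exact forall₂_congr fun p _ => by
      rw [SetLike.mem_coe, mem_pointToPoint, aeval_eq_eval]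

theorem setOf_eval_ne_zero [Finite σ] (f : MvPolynomial σ K) :
    IsConstructibleTrace {x | eval x f ≠ 0} := by
  convert (zeroLocus (Ideal.span {f})).compl using 1
  ext x
  simp [zeroLocus_span, aeval_eq_eval]

theorem of_isConstructibleIn [Finite σ] (hS : IsConstructibleIn (zariskiTopology K σ) S) :
    IsConstructibleTrace S := by
  obtain ⟨r, C, D, hC, hD, rfl⟩ := hS
  refine iUnion fun i => ?_
  obtain ⟨I, hI⟩ := zariskiTopology.isClosed_iff.mp (hC i)
  obtain ⟨J, hJ⟩ := zariskiTopology.isClosed_iff.mp (hD i)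
  rw [hI, hJ]
  exact (zeroLocus I).sdiff (zeroLocus J)

theorem isConstructibleIn (hS : IsConstructibleTrace S) :
    IsConstructibleIn (zariskiTopology K σ) S := by
  obtain ⟨T, hT, rfl⟩ := hS
  obtain ⟨d, rfl⟩ := PrimeSpectrum.exists_constructibleSetData_iff.mpr hT
  let e := d.equivFin.symm
  refine ⟨d.card, fun i => MvPolynomial.zeroLocus K (Ideal.span (Set.range (e i).1.g)),
    fun i => MvPolynomial.zeroLocus K (Ideal.span {(e i).1.f}),
    fun i => zariskiTopology.isClosed_zeroLocus _,
    fun i => zariskiTopology.isClosed_zeroLocus _, ?_⟩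
  have h (i) : MvPolynomial.zeroLocus K (Ideal.span (Set.range (e i).1.g)) \
      MvPolynomial.zeroLocus K (Ideal.span {(e i).1.f}) =
      pointToPoint ⁻¹' (e i).1.toSet := by
    ext x
    simp [zeroLocus_span, PrimeSpectrum.BasicConstructibleSetData.toSet, aeval_eq_eval,
      Set.range_subset_iff, mem_pointToPoint]
  simp_rw [h, ← Set.preimage_iUnion]
  rw [PrimeSpectrum.ConstructibleSetData.toSet, e.surjective.iUnion_comp (fun C => C.1.toSet)]
  simp [Set.iUnion_subtype]

theorem preimage (hS : IsConstructibleTrace S) (f : MvPolynomial σ K →ₐ[K] MvPolynomial τ K)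
    {φ : (τ → K) → σ → K} (hφ : ∀ y p, eval (φ y) p = eval y (f p)) :
    IsConstructibleTrace (φ ⁻¹' S) := by
  obtain ⟨T, hT, rfl⟩ := hS
  obtain ⟨d, rfl⟩ := PrimeSpectrum.exists_constructibleSetData_iff.mpr hT
  refine ⟨_, (d.map f.toRingHom).isConstructible_toSet, ?_⟩
  rw [PrimeSpectrum.ConstructibleSetData.toSet_map, ← Set.preimage_comp, ← Set.preimage_comp]
  congr 1
  ext y : 2
  ext p
  simp only [Function.comp_apply]
  rw [mem_pointToPoint, hφ, PrimeSpectrum.comap_asIdeal, Ideal.mem_comap, mem_pointToPoint]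
  rfl

theorem setOf_exists_sumElim_mem [IsAlgClosed K] [Finite σ] [Finite τ] {S : Set (σ ⊕ τ → K)}
    (hS : IsConstructibleTrace S) :
    IsConstructibleTrace {a : σ → K | ∃ x : τ → K, Sum.elim a x ∈ S} := by
  obtain ⟨T, hT, rfl⟩ := hS
  let f : MvPolynomial σ K →ₐ[K] MvPolynomial (σ ⊕ τ) K := rename Sum.inl
  have hf : f.toRingHom.FinitePresentation := by
    rw [← RingHom.FinitePresentation.of_finiteType]
    refine RingHom.FiniteType.of_comp_finiteType (f := algebraMap K (MvPolynomial σ K)) ?_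
    have : f.toRingHom.comp (algebraMap K (MvPolynomial σ K)) = algebraMap K _ := f.comp_algebraMap
    rw [this, RingHom.finiteType_algebraMap]
    infer_instance
  refine ⟨_, PrimeSpectrum.isConstructible_comap_image hf hT, ?_⟩
  obtain ⟨d, rfl⟩ := PrimeSpectrum.exists_constructibleSetData_iff.mpr hT
  ext a
  constructor
  · rintro ⟨Q, hQ, hQa⟩
    simp only [PrimeSpectrum.ConstructibleSetData.toSet, Set.mem_iUnion] at hQ
    obtain ⟨C, hC, hQg, hQf⟩ := hQ
    have hQf' : C.f ∉ vanishingIdeal K (MvPolynomial.zeroLocus K Q.asIdeal) := by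
      rw [IsPrime.vanishingIdeal_zeroLocus]
      simpa using hQf
    rw [mem_vanishingIdeal_iff] at hQf'
    push Not at hQf'
    obtain ⟨z, hz, hzf⟩ := hQf'
    have hza : z ∘ Sum.inl = a := by
      have hle : fiberIdeal τ a ≤ Q.asIdeal := by
        rw [fiberIdeal, Ideal.map_le_iff_le_comap]
        have := congrArg PrimeSpectrum.asIdeal hQa
        intro p hp
        have hp' : p ∈ (pointToPoint (k := K) a).asIdeal := by
          rw [mem_pointToPoint, ← aeval_eq_eval]
          exact hp
        rw [← this] at hp'
        exact hp'
      have := zeroLocus_anti_mono hle hz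
      rwa [zeroLocus_fiberIdeal] at this
    refine ⟨z ∘ Sum.inr, ?_⟩
    rw [← hza, Sum.elim_comp_inl_inr]
    simp only [PrimeSpectrum.ConstructibleSetData.toSet, Set.mem_preimage, Set.mem_iUnion]
    refine ⟨C, hC, fun p hp => ?_, fun h => hzf ?_⟩
    · rw [SetLike.mem_coe, mem_pointToPoint, ← aeval_eq_eval]
      exact hz p (hQg hp)
    · have := h (Set.mem_singleton C.f)
      rwa [SetLike.mem_coe, mem_pointToPoint, ← aeval_eq_eval] at this
  · rintro ⟨x, hx⟩
    refine ⟨_, hx, ?_⟩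
    ext p
    rw [PrimeSpectrum.comap_asIdeal, Ideal.mem_comap, mem_pointToPoint, mem_pointToPoint]
    change eval _ (rename Sum.inl p) = 0 ↔ _
    rw [eval_rename, Sum.elim_comp_inl]

end IsConstructibleTrace

/-- The polynomial with the given coefficients at monomials whose exponents are all at most `d`. -/
noncomputable def ofCoeff {n d : ℕ} (c : (Fin n → Fin (d + 1)) → K) : MvPolynomial (Fin n) K :=
  ∑ e, C (c e) * ∏ j, X j ^ (e j : ℕ)

theorem exists_ofCoeff_eq {n d : ℕ} {p : MvPolynomial (Fin n) K} (hp : p.totalDegree ≤ d) :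
    ∃ c : (Fin n → Fin (d + 1)) → K, ofCoeff c = p := by
  classical
  let s (e : Fin n → Fin (d + 1)) : Fin n →₀ ℕ := Finsupp.equivFunOnFinite.symm fun j => e j
  have hs : Function.Injective s := by
    intro e e' h
    ext j
    exact DFunLike.congr_fun h j
  refine ⟨fun e => coeff (s e) p, ?_⟩
  have h1 (e : Fin n → Fin (d + 1)) : C (coeff (s e) p) * ∏ j, X j ^ (e j : ℕ) =
      monomial (s e) (coeff (s e) p) := by
    rw [monomial_eq, Finsupp.prod_fintype _ _ (fun i => pow_zero _)]
    rfl
  rw [ofCoeff, Finset.sum_congr rfl fun e _ => h1 e,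
    ← Finset.sum_image (s := Finset.univ) (g := s) (f := fun t => monomial t (coeff t p))
      hs.injOn]
  conv_rhs => rw [← support_sum_monomial_coeff p]
  refine (Finset.sum_subset (fun t ht => ?_) fun t _ ht => ?_).symm
  · refine Finset.mem_image.mpr ⟨fun j => ⟨t j, Nat.lt_succ_of_le ?_⟩, Finset.mem_univ _, ?_⟩
    · refine le_trans ?_ ((le_totalDegree ht).trans hp)
      by_cases hj : j ∈ t.support
      · exact Finset.single_le_sum (f := t) (fun _ _ => Nat.zero_le _) hj
      · simp [Finsupp.notMem_support_iff.mp hj]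
    · ext j
      rfl
  · rw [notMem_support_iff.mp ht, map_zero]

/-- The generic polynomial of which the polynomials `ofCoeff` are specializations. -/
noncomputable def genericPolynomial (K σ : Type*) [Field K] {ι : Type*} (n d : ℕ) (i : ι) :
    MvPolynomial ((σ ⊕ (ι × (Fin n → Fin (d + 1)))) ⊕ Fin n) K :=
  ∑ e : Fin n → Fin (d + 1), X (Sum.inl (Sum.inr (i, e))) * ∏ j, X (Sum.inr j) ^ (e j : ℕ)

theorem eval_genericPolynomial {ι : Type*} {n d : ℕ} (i : ι) (a : σ → K)
    (c : ι × (Fin n → Fin (d + 1)) → K) (x : Fin n → K) :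
    eval (Sum.elim (Sum.elim a c) x) (genericPolynomial K σ n d i) =
      eval x (ofCoeff fun e => c (i, e)) := by
  simp [genericPolynomial, ofCoeff]

theorem isConstructibleTrace_setOf_exists_orthogonal [IsAlgClosed K] [Finite σ] {n : ℕ}
    {S : Set (σ ⊕ Fin n → K)} (hS : IsConstructibleTrace S) (k d : ℕ) :
    IsConstructibleTrace {a : σ → K | ∃ c : Fin k × (Fin n → Fin (d + 1)) → K,
      (∀ i, ∃ x, Sum.elim a x ∈ S ∧ eval x (ofCoeff fun e => c (i, e)) ≠ 0) ∧
      ∀ i j, i ≠ j → ∀ x, Sum.elim a x ∈ S →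
        eval x (ofCoeff fun e => c (i, e)) * eval x (ofCoeff fun e => c (j, e)) = 0} := by
  let ρ := Fin k × (Fin n → Fin (d + 1))
  have hE : IsConstructibleTrace {z : (σ ⊕ ρ) ⊕ Fin n → K | z ∘ Sum.map Sum.inl id ∈ S} :=
    hS.preimage (rename (Sum.map Sum.inl id)) fun y p => (eval_rename _ _ _).symm
  have h1 (f : MvPolynomial ((σ ⊕ ρ) ⊕ Fin n) K) :=
    (hE.inter (.setOf_eval_ne_zero f)).setOf_exists_sumElim_mem
  have h2 := ((IsConstructibleTrace.iInter fun i => h1 (genericPolynomial K σ n d i)).inter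
    (IsConstructibleTrace.iInter fun ij : {ij : Fin k × Fin k // ij.1 ≠ ij.2} =>
      (h1 (genericPolynomial K σ n d ij.1.1 * genericPolynomial K σ n d ij.1.2)).compl)
    ).setOf_exists_sumElim_mem
  convert h2 using 1
  ext a
  have h3 (c : ρ → K) (x : Fin n → K) :
      Sum.elim (Sum.elim a c) x ∘ Sum.map Sum.inl id = Sum.elim a x := by
    ext i
    cases i <;> rfl
  simp [h3, ρ, eval_genericPolynomial, or_iff_not_imp_left]

end MvPolynomial

theorem HasSeparatedComponents.le_ncard_irredComps_iff {K : Type*} [Field K] {n N D : ℕ}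
    {T : Set (Fin n → K)} (h : HasSeparatedComponents N D T) {k : ℕ} :
    k ≤ (irredComps (zariskiTopology K (Fin n))
      (@closure _ (zariskiTopology K (Fin n)) T)).ncard ↔
      ∃ c : Fin k × (Fin n → Fin (N * D + 1)) → K,
        (∀ i, ∃ x, x ∈ T ∧ MvPolynomial.eval x (MvPolynomial.ofCoeff fun e => c (i, e)) ≠ 0) ∧
        ∀ i j, i ≠ j → ∀ x, x ∈ T →
          MvPolynomial.eval x (MvPolynomial.ofCoeff fun e => c (i, e)) *
            MvPolynomial.eval x (MvPolynomial.ofCoeff fun e => c (j, e)) = 0 := by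
  constructor
  · intro hk
    obtain ⟨g, hdeg, hg, hgg⟩ := h.exists_orthogonal_of_le_ncard_irredComps hk
    choose c hc using fun i => MvPolynomial.exists_ofCoeff_eq (hdeg i)
    refine ⟨fun ie => c ie.1 ie.2, ?_, ?_⟩
    · simpa only [hc] using hg
    · simpa only [hc] using hgg
  · rintro ⟨c, hg, hgg⟩
    exact h.le_ncard_irredComps_of_orthogonal hg hgg

/-- The number of irreducible components of the Zariski closure is bounded and
definable in families over an algebraically closed field: if `S ⊆ K^m × K^n` is
constructible, then there is `N` bounding the number of irreducible components
of the closure of every fiber `S_a`, and for every `k` the set of parameters `a`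
whose fiber closure has exactly `k` irreducible components is constructible. -/
theorem number_of_components_definable_in_families
    {K : Type*} [Field K] [IsAlgClosed K] (m n : ℕ)
    (S : Set (Fin m ⊕ Fin n → K))
    (hS : IsConstructibleIn (zariskiTopology K (Fin m ⊕ Fin n)) S) :
    (∃ N : ℕ, ∀ a : Fin m → K,
        (irredComps (zariskiTopology K (Fin n))
          (@closure _ (zariskiTopology K (Fin n))
            {x : Fin n → K | Sum.elim a x ∈ S})).Finite ∧
        (irredComps (zariskiTopology K (Fin n))
          (@closure _ (zariskiTopology K (Fin n))
            {x : Fin n → K | Sum.elim a x ∈ S})).ncard ≤ N) ∧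
      ∀ k : ℕ, IsConstructibleIn (zariskiTopology K (Fin m))
        {a : Fin m → K |
          (irredComps (zariskiTopology K (Fin n))
            (@closure _ (zariskiTopology K (Fin n))
              {x : Fin n → K | Sum.elim a x ∈ S})).Finite ∧
          (irredComps (zariskiTopology K (Fin n))
            (@closure _ (zariskiTopology K (Fin n))
              {x : Fin n → K | Sum.elim a x ∈ S})).ncard = k} := by
  obtain ⟨r, C, D, hC, hD, hSCD⟩ := id hS
  choose I hI using fun i => zariskiTopology.isClosed_iff.mp (hC i)
  choose J hJ using fun i => zariskiTopology.isClosed_iff.mp (hD i)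
  obtain ⟨N, d, hNd⟩ := MvPolynomial.exists_hasSeparatedComponents I J
  have hsep (a : Fin m → K) :
      HasSeparatedComponents N d {x : Fin n → K | Sum.elim a x ∈ S} := by
    convert hNd a using 1
    ext x
    rw [hSCD, Set.mem_ofPred_eq, Set.mem_iUnion, Set.mem_ofPred_eq]
    exact exists_congr fun i => by rw [hI, hJ]; rfl
  have hfin (a : Fin m → K) := (hsep a).finite_irredComps
  refine ⟨⟨N, fun a => ⟨hfin a, (hsep a).ncard_irredComps_le⟩⟩, fun k => ?_⟩
  have htrace (k : ℕ) := MvPolynomial.isConstructibleTrace_setOf_exists_orthogonal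
    (.of_isConstructibleIn hS) k (N * d)
  convert ((htrace k).sdiff (htrace (k + 1))).isConstructibleIn using 1
  ext a
  refine Iff.trans ?_ (and_congr (hsep a).le_ncard_irredComps_iff
    (not_congr (hsep a).le_ncard_irredComps_iff))
  rw [Set.mem_ofPred_eq, and_iff_right (hfin a)]
  omega
end
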